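/- arXiv:2404.09926 — 7 statements merged into one kernel-verified Lean document; each statement's English description precedes it below -/
import Mathlib

section
/- Let 0 < α < 1 and let ψ : ℝ² → ℂ be a compactly supported Lipschitz function such that ∫₀^{2π} ψ(r cos θ, r sin θ) dθ = 0 for every r > 0. Then ∫_{ℝ²} (1+|x|)^{-2α} |∇((1+|x|)^{α} ψ(x))|² dx ≥ (8/9) ∫_{ℝ²} |∇ψ(x)|² dx. -/
open MeasureTheory Real

lemma aux_ac_comp {X Y : Type*} [PseudoMetricSpace X] [PseudoMetricSpace Y] {f : ℝ → X} {g : X → Y} {a b : ℝ}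
    (hf : AbsolutelyContinuousOnInterval f a b) (hg : LipschitzWith 1 g) :
    AbsolutelyContinuousOnInterval (fun x => g (f x)) a b := by
  rw [absolutelyContinuousOnInterval_iff] at hf ⊢
  intro ε hε
  obtain ⟨δ, hδ, h⟩ := hf ε hε
  refine ⟨δ, hδ, fun E hE hs => lt_of_le_of_lt (Finset.sum_le_sum fun i _ => ?_) (h E hE hs)⟩
  simpa using hg.dist_le_mul (f (E.2 i).1) (f (E.2 i).2)

lemma aux_ftc_real {F F' : ℝ → ℝ} {a b : ℝ} (hF : AbsolutelyContinuousOnInterval F a b)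
    (hd : ∀ᵐ x, x ∈ Set.uIoc a b → HasDerivAt F (F' x) x) :
    ∫ x in a..b, F' x = F b - F a := by
  rw [← hF.integral_deriv_eq_sub]
  apply intervalIntegral.integral_congr_ae
  filter_upwards [hd] with x hx hxx
  exact (hx hxx).deriv.symm

lemma aux_ftc_complex {F F' : ℝ → ℂ} {a b : ℝ} (hF : AbsolutelyContinuousOnInterval F a b)
    (hd : ∀ᵐ x, x ∈ Set.uIoc a b → HasDerivAt F (F' x) x)
    (hi : IntervalIntegrable F' volume a b) :
    ∫ x in a..b, F' x = F b - F a := by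
  have hre : LipschitzWith 1 Complex.re := by
    refine LipschitzWith.of_dist_le_mul fun x y => ?_
    simpa [Real.dist_eq, Complex.dist_eq] using Complex.abs_re_le_norm (x - y)
  have him : LipschitzWith 1 Complex.im := by
    refine LipschitzWith.of_dist_le_mul fun x y => ?_
    simpa [Real.dist_eq, Complex.dist_eq] using Complex.abs_im_le_norm (x - y)
  have h1 := aux_ftc_real (F' := fun x => (F' x).re) (aux_ac_comp hF hre) (by
    filter_upwards [hd] with x hx hxx
    exact (Complex.reCLM.hasFDerivAt.comp_hasDerivAt x (hx hxx)))
  have h2 := aux_ftc_real (F' := fun x => (F' x).im) (aux_ac_comp hF him) (by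
    filter_upwards [hd] with x hx hxx
    exact (Complex.imCLM.hasFDerivAt.comp_hasDerivAt x (hx hxx)))
  have e1 : (∫ x in a..b, F' x).re = ∫ x in a..b, (F' x).re :=
    (Complex.reCLM.intervalIntegral_comp_comm hi).symm
  have e2 : (∫ x in a..b, F' x).im = ∫ x in a..b, (F' x).im :=
    (Complex.imCLM.intervalIntegral_comp_comm hi).symm
  apply Complex.ext
  · rw [e1, h1]; simp
  · rw [e2, h2]; simp

lemma aux_wirtinger {f f' : ℝ → ℂ} {C : NNReal} {C' : ℝ} (hf : LipschitzWith C f)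
    (hper : f (-π) = f π) (hmean : ∫ x in (-π)..π, f x = 0)
    (hm : Measurable f') (hb : ∀ x, ‖f' x‖ ≤ C')
    (hd : ∀ᵐ x, x ∈ Set.Ioc (-π) π → HasDerivAt f (f' x) x) :
    ∫ x in (-π)..π, ‖f x‖ ^ 2 ≤ ∫ x in (-π)..π, ‖f' x‖ ^ 2 := by
  have hab : -π < π := by linarith [pi_pos]
  have hT : (0:ℝ) < π - -π := by linarith
  have hI : Set.uIoc (-π) π = Set.Ioc (-π) π := Set.uIoc_of_le hab.le
  have hi' : IntervalIntegrable f' volume (-π) π := by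
    rw [intervalIntegrable_iff_integrableOn_Ioc_of_le hab.le]
    exact Measure.integrableOn_of_bounded (M := C') (by simp) hm.aestronglyMeasurable
      (Filter.Eventually.of_forall hb)
  have hL' : MemLp f' 2 (volume.restrict (Set.Ioc (-π) π)) :=
    MemLp.of_bound hm.aestronglyMeasurable C' (Filter.Eventually.of_forall hb)
  have hL : MemLp f 2 (volume.restrict (Set.Ioc (-π) π)) := by
    obtain ⟨M, hM⟩ := isCompact_Icc.exists_bound_of_continuousOn (s := Set.Icc (-π) π)
      hf.continuous.continuousOn
    refine MemLp.of_bound hf.continuous.aestronglyMeasurable M ?_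
    filter_upwards [ae_restrict_mem measurableSet_Ioc] with x hx
    exact hM x ⟨hx.1.le, hx.2⟩
  have S := hasSum_sq_fourierCoeffOn hab hL
  have S' := hasSum_sq_fourierCoeffOn hab hL'
  have key : ∀ n : ℤ, fourierCoeffOn hab f' n = (Complex.I * n) * fourierCoeffOn hab f n := by
    intro n
    rw [fourierCoeffOn_eq_integral, fourierCoeffOn_eq_integral]
    have hder := fun x => hasDerivAt_fourier (π - -π) (-n) x
    have hcont : Continuous fun x : ℝ => fourier (-n) (x : AddCircle (π - -π)) := by fun_prop
    have hAC : AbsolutelyContinuousOnInterval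
        (fun x : ℝ => fourier (-n) (x : AddCircle (π - -π)) • f x) (-π) π := by
      apply AbsolutelyContinuousOnInterval.fun_smul
      · apply ContDiffOn.absolutelyContinuousOnInterval
        apply ContDiff.contDiffOn
        rw [contDiff_one_iff_deriv]
        refine ⟨fun x => (hder x).differentiableAt, ?_⟩
        rw [funext fun x => (hder x).deriv]
        fun_prop
      · exact hf.lipschitzOnWith.absolutelyContinuousOnInterval
    have i1 : IntervalIntegrable (fun x : ℝ => fourier (-n) (x : AddCircle (π - -π)) • f' x)
        volume (-π) π := by
      simpa using hi'.continuousOn_mul hcont.continuousOn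
    have i2 : IntervalIntegrable (fun x : ℝ => (-(Complex.I * n)) *
        (fourier (-n) (x : AddCircle (π - -π)) • f x)) volume (-π) π := by
      apply Continuous.intervalIntegrable
      have := hf.continuous
      fun_prop
    have := aux_ftc_complex (F' := fun x : ℝ => fourier (-n) (x : AddCircle (π - -π)) • f' x +
        (-(Complex.I * n)) * (fourier (-n) (x : AddCircle (π - -π)) • f x)) hAC (by
      rw [hI]
      filter_upwards [hd] with x hx hxx
      have h := (hder x).mul (hx hxx)
      refine HasDerivAt.congr_deriv h ?_
      symm
      simp only [smul_eq_mul]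
      rw [add_comm]
      congr 1
      rw [← mul_assoc]
      congr 2
      have : (π : ℂ) ≠ 0 := by exact_mod_cast pi_ne_zero
      push_cast
      field_simp
      ring) (i1.add i2)
    rw [intervalIntegral.integral_add i1 i2, intervalIntegral.integral_const_mul] at this
    have hz : fourier (-n) ((π : ℝ) : AddCircle (π - -π)) = fourier (-n) ((-π : ℝ) : AddCircle (π - -π)) := by
      congr 1
      have := AddCircle.coe_add_period (π - -π) (-π)
      rw [← this]; congr 1; ring
    rw [hper, hz, sub_self] at this
    rw [eq_neg_of_add_eq_zero_left this]
    simp only [Complex.real_smul]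
    ring
  have h0 : fourierCoeffOn hab f 0 = 0 := by
    rw [fourierCoeffOn_eq_integral]
    simp [hmean]
  have hle := hasSum_le (fun n => ?_) S S'
  · simp only [smul_eq_mul] at hle
    exact le_of_mul_le_mul_left hle (inv_pos.mpr hT)
  · rw [key]
    by_cases hn : n = 0
    · simp [hn, h0]
    · have : (1:ℝ) ≤ |(n:ℝ)| := by exact_mod_cast Int.one_le_abs hn
      rw [norm_mul, norm_mul, Complex.norm_I, one_mul, Complex.norm_intCast, mul_pow]
      nlinarith [sq_nonneg ‖fourierCoeffOn hab f n‖, mul_self_nonneg (|(n:ℝ)|-1), sq_nonneg (|(n:ℝ)|)]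

/-- The polar coordinate target. -/
def auxT : Set (ℝ × ℝ) := Set.Ioi (0:ℝ) ×ˢ Set.Ioo (-π) π

lemma aux_intg {h : ℝ × ℝ → ℝ} {R C : ℝ} (hm : Measurable h)
    (hb : ∀ p : ℝ × ℝ, 0 < p.1 → p.1 ≤ R → |h p| ≤ C) (hz : ∀ p : ℝ × ℝ, R < p.1 → h p = 0) :
    IntegrableOn h auxT := by
  have h1 : IntegrableOn h (Set.Ioc (0:ℝ) R ×ˢ Set.Ioo (-π) π) := by
    refine Measure.integrableOn_of_bounded (M := C) ?_ hm.aestronglyMeasurable ?_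
    · rw [Measure.volume_eq_prod, Measure.prod_prod]
      simp only [Real.volume_Ioc, Real.volume_Ioo]
      exact ENNReal.mul_ne_top ENNReal.ofReal_ne_top ENNReal.ofReal_ne_top
    · filter_upwards [ae_restrict_mem (measurableSet_Ioc.prod measurableSet_Ioo)] with p hp
      exact hb p hp.1.1 hp.1.2
  refine h1.of_forall_sdiff_eq_zero (measurableSet_Ioi.prod measurableSet_Ioo) ?_
  rintro p ⟨hp, hp'⟩
  apply hz
  by_contra hcon
  exact hp' ⟨⟨hp.1, not_lt.mp hcon⟩, hp.2⟩

lemma aux_scalar (α r x y : ℝ) (hα1 : α < 1) (hr : 0 < r) :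
    0 ≤ r * (y + α / (1 + r) * x) ^ 2 - 8 / 9 * r * y ^ 2 + x ^ 2 / (9 * r) +
      (1 / 9 - α) * (x ^ 2 / (1 + r) ^ 2 + r / (1 + r) * (2 * (x * y))) := by
  have e : r * (y + α / (1 + r) * x) ^ 2 - 8 / 9 * r * y ^ 2 + x ^ 2 / (9 * r) +
      (1 / 9 - α) * (x ^ 2 / (1 + r) ^ 2 + r / (1 + r) * (2 * (x * y))) =
      ((r * y * (1 + r) + x * r) ^ 2 + x ^ 2 * ((3 * α * r - 1) ^ 2 + 3 * (1 - α) * r)) /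
        (9 * r * (1 + r) ^ 2) := by
    have : 1 + r ≠ 0 := by positivity
    field_simp
    ring
  rw [e]
  have : 0 < 1 - α := by linarith
  positivity

lemma aux_pointwise (α r : ℝ) (hα1 : α < 1) (hr : 0 < r) (Φ q t : ℂ) :
    1 / 9 * (r * ‖t‖ ^ 2 - ‖Φ‖ ^ 2 / r) -
      (1 / 9 - α) * (‖Φ‖ ^ 2 / (1 + r) ^ 2 + r / (1 + r) * (2 * (Φ.re * q.re + Φ.im * q.im))) ≤
    r * (‖q + (α / (1 + r) : ℝ) * Φ‖ ^ 2 + ‖t‖ ^ 2) - 8 / 9 * (r * (‖q‖ ^ 2 + ‖t‖ ^ 2)) := by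
  have h1 := aux_scalar α r Φ.re q.re hα1 hr
  have h2 := aux_scalar α r Φ.im q.im hα1 hr
  have n : ∀ z : ℂ, ‖z‖ ^ 2 = z.re ^ 2 + z.im ^ 2 := by
    intro z; rw [Complex.sq_norm, Complex.normSq_apply]; ring
  rw [n (q + _), n q, n Φ]
  simp only [Complex.add_re, Complex.add_im, Complex.re_ofReal_mul, Complex.im_ofReal_mul]
  have e : (Φ.re ^ 2 + Φ.im ^ 2) / r = 9 * (Φ.re ^ 2 / (9 * r)) + 9 * (Φ.im ^ 2 / (9 * r)) := by
    field_simp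
  rw [e, add_div]
  linarith

lemma aux_polar_core (α : ℝ) (hα0 : 0 < α) (hα1 : α < 1) (Φ q t : ℝ × ℝ → ℂ) (K : NNReal)
    (A R : ℝ) (hR : 0 < R)
    (mΦ : Measurable Φ) (mq : Measurable q) (mt : Measurable t)
    (bq : ∀ p, ‖q p‖ ≤ A) (bt : ∀ p, ‖t p‖ ≤ A) (bΦ : ∀ p : ℝ × ℝ, 0 < p.1 → ‖Φ p‖ ≤ K * p.1)
    (zΦ : ∀ p : ℝ × ℝ, R < p.1 → Φ p = 0) (zq : ∀ p : ℝ × ℝ, R < p.1 → q p = 0)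
    (zt : ∀ p : ℝ × ℝ, R < p.1 → t p = 0)
    (lr : ∀ θ : ℝ, LipschitzWith K (fun r => Φ (r, θ)))
    (lθ : ∀ r : ℝ, 0 < r → ∃ C, LipschitzWith C (fun θ => Φ (r, θ)))
    (per : ∀ r, Φ (r, -π) = Φ (r, π))
    (mean : ∀ r, 0 < r → ∫ θ in (-π)..π, Φ (r, θ) = 0)
    (dr : ∀ᵐ p ∂(volume.restrict auxT), HasDerivAt (fun r => Φ (r, p.2)) (q p) p.1)
    (dθ : ∀ᵐ p ∂(volume.restrict auxT), HasDerivAt (fun θ => Φ (p.1, θ)) (p.1 * t p) p.2) :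
    8 / 9 * ∫ p in auxT, p.1 * (‖q p‖ ^ 2 + ‖t p‖ ^ 2) ≤
      ∫ p in auxT, p.1 * (‖q p + (α / (1 + p.1) : ℝ) * Φ p‖ ^ 2 + ‖t p‖ ^ 2) := by
  have hA : 0 ≤ A := (norm_nonneg _).trans (bq 0)
  have hK : (0:ℝ) ≤ K := K.2
  have hmT : MeasurableSet auxT := measurableSet_Ioi.prod measurableSet_Ioo
  have bΦ' : ∀ p : ℝ × ℝ, 0 < p.1 → p.1 ≤ R → ‖Φ p‖ ≤ K * R := fun p h1 h2 =>
    (bΦ p h1).trans (by gcongr)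
  have I1 : IntegrableOn (fun p : ℝ × ℝ =>
      p.1 * (‖q p + (α / (1 + p.1) : ℝ) * Φ p‖ ^ 2 + ‖t p‖ ^ 2)) auxT := by
    refine aux_intg (R := R) (C := R * ((A + K * R) ^ 2 + A ^ 2)) (by fun_prop) ?_ ?_
    · intro p h1 h2
      rw [abs_of_nonneg (by positivity)]
      have : ‖q p + (α / (1 + p.1) : ℝ) * Φ p‖ ≤ A + K * R := by
        refine (norm_add_le _ _).trans (add_le_add (bq p) ?_)
        rw [norm_mul, Complex.norm_real, Real.norm_of_nonneg (by positivity)]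
        refine (mul_le_of_le_one_left (norm_nonneg _) ?_).trans (bΦ' p h1 h2)
        rw [div_le_one (by positivity)]; linarith
      have := bt p
      gcongr
    · intro p hp
      simp [zΦ p hp, zq p hp, zt p hp]
  have I2 : IntegrableOn (fun p : ℝ × ℝ => p.1 * (‖q p‖ ^ 2 + ‖t p‖ ^ 2)) auxT := by
    refine aux_intg (R := R) (C := R * (A ^ 2 + A ^ 2)) (by fun_prop) ?_ ?_
    · intro p h1 h2
      rw [abs_of_nonneg (by positivity)]
      have := bt p
      have := bq p
      gcongr
    · intro p hp
      simp [zq p hp, zt p hp]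
  have I3 : IntegrableOn (fun p : ℝ × ℝ => 1 / 9 * (p.1 * ‖t p‖ ^ 2 - ‖Φ p‖ ^ 2 / p.1)) auxT := by
    refine aux_intg (R := R) (C := 1 / 9 * (R * A ^ 2 + K ^ 2 * R)) (by fun_prop) ?_ ?_
    · intro p h1 h2
      rw [abs_mul, abs_of_pos (by norm_num : (0:ℝ) < 1 / 9)]
      refine mul_le_mul_of_nonneg_left ((abs_sub _ _).trans ?_) (by norm_num)
      rw [abs_of_nonneg (by positivity), abs_of_nonneg (by positivity)]
      have := bt p
      refine add_le_add (by gcongr) ?_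
      rw [div_le_iff₀ h1]
      calc ‖Φ p‖ ^ 2 ≤ (K * p.1) ^ 2 := by have := bΦ p h1; gcongr
        _ = K ^ 2 * p.1 * p.1 := by ring
        _ ≤ K ^ 2 * R * p.1 := by gcongr
    · intro p hp
      simp [zΦ p hp, zt p hp]
  have mre : Measurable fun p => (Φ p).re := Complex.measurable_re.comp mΦ
  have mim : Measurable fun p => (Φ p).im := Complex.measurable_im.comp mΦ
  have mre' : Measurable fun p => (q p).re := Complex.measurable_re.comp mq
  have mim' : Measurable fun p => (q p).im := Complex.measurable_im.comp mq
  have I4 : IntegrableOn (fun p : ℝ × ℝ => (1 / 9 - α) * (‖Φ p‖ ^ 2 / (1 + p.1) ^ 2 +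
      p.1 / (1 + p.1) * (2 * ((Φ p).re * (q p).re + (Φ p).im * (q p).im)))) auxT := by
    refine aux_intg (R := R)
      (C := |1 / 9 - α| * ((K * R) ^ 2 + 1 * (2 * (K * R * A + K * R * A)))) (by fun_prop) ?_ ?_
    · intro p h1 h2
      rw [abs_mul]
      refine mul_le_mul_of_nonneg_left ((abs_add_le _ _).trans ?_) (abs_nonneg _)
      have h3 := bΦ' p h1 h2
      have h4 := bq p
      refine add_le_add ?_ ?_
      · rw [abs_of_nonneg (by positivity)]
        calc ‖Φ p‖ ^ 2 / (1 + p.1) ^ 2 ≤ ‖Φ p‖ ^ 2 := by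
              apply div_le_self (by positivity)
              apply one_le_pow₀; linarith
          _ ≤ _ := by gcongr
      · rw [abs_mul, abs_mul, abs_of_nonneg (by positivity : 0 ≤ p.1 / (1 + p.1)), abs_two]
        have h5 : p.1 / (1 + p.1) ≤ 1 := by rw [div_le_one (by positivity)]; linarith
        refine mul_le_mul h5 ?_ (by positivity) (by norm_num)
        refine mul_le_mul_of_nonneg_left ((abs_add_le _ _).trans ?_) (by norm_num)
        rw [abs_mul, abs_mul]
        have a1 := (Complex.abs_re_le_norm (Φ p)).trans h3
        have a2 := (Complex.abs_im_le_norm (Φ p)).trans h3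
        have a3 := (Complex.abs_re_le_norm (q p)).trans h4
        have a4 := (Complex.abs_im_le_norm (q p)).trans h4
        gcongr
    · intro p hp
      simp [zΦ p hp]
  -- the angular part
  have N1 : 0 ≤ ∫ p in auxT, 1 / 9 * (p.1 * ‖t p‖ ^ 2 - ‖Φ p‖ ^ 2 / p.1) := by
    unfold auxT at I3 dθ ⊢
    rw [Measure.volume_eq_prod] at I3 dθ ⊢
    rw [setIntegral_prod _ I3]
    rw [← Measure.prod_restrict] at dθ
    have dθ2 := Measure.ae_ae_of_ae_prod dθ
    apply integral_nonneg_of_ae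
    filter_upwards [dθ2, ae_restrict_mem measurableSet_Ioi] with r hr hr0
    have hr0 : 0 < r := hr0
    obtain ⟨C, hC⟩ := lθ r hr0
    have hab : -π ≤ π := by linarith [pi_pos]
    have mt' : Measurable fun θ => t (r, θ) := mt.comp (by fun_prop)
    have W := aux_wirtinger (f' := fun θ => r * t (r, θ)) (C' := r * A) hC (per r) (mean r hr0)
      (by fun_prop) (by
        intro x
        rw [norm_mul, Complex.norm_real, Real.norm_of_nonneg hr0.le]
        have := bt (r, x)
        gcongr) (by
        have := (ae_restrict_iff' measurableSet_Ioo).mp hr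
        have h2 : ∀ᵐ x : ℝ, x ≠ π := by simp [ae_iff]
        filter_upwards [this, h2] with x hx hx2 hx3
        exact hx ⟨hx3.1, lt_of_le_of_ne hx3.2 hx2⟩)
    rw [intervalIntegral.integral_of_le hab, intervalIntegral.integral_of_le hab,
      integral_Ioc_eq_integral_Ioo, integral_Ioc_eq_integral_Ioo] at W
    have j1 : IntegrableOn (fun θ => r * ‖t (r, θ)‖ ^ 2) (Set.Ioo (-π) π) := by
      refine Measure.integrableOn_of_bounded (M := r * A ^ 2) (by simp)
        (by
          have : Measurable fun θ => r * ‖t (r, θ)‖ ^ 2 := by fun_prop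
          exact this.aestronglyMeasurable) (Filter.Eventually.of_forall ?_)
      intro x
      rw [Real.norm_of_nonneg (by positivity)]
      have := bt (r, x)
      gcongr
    have j2 : IntegrableOn (fun θ => ‖Φ (r, θ)‖ ^ 2 / r) (Set.Ioo (-π) π) := by
      have := hC.continuous
      refine (Continuous.integrableOn_Icc ?_).mono_set Set.Ioo_subset_Icc_self
      exact (this.norm.pow 2).div_const r
    simp only [Pi.zero_apply]
    rw [integral_const_mul, integral_sub j1 j2, integral_const_mul, integral_div]
    have e : ∫ x in Set.Ioo (-π) π, ‖(r:ℂ) * t (r, x)‖ ^ 2 =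
        r ^ 2 * ∫ x in Set.Ioo (-π) π, ‖t (r, x)‖ ^ 2 := by
      rw [← integral_const_mul]
      congr 1; ext x
      rw [norm_mul, Complex.norm_real, mul_pow, Real.norm_eq_abs, sq_abs]
    rw [e] at W
    refine mul_nonneg (by norm_num) (sub_nonneg.mpr ?_)
    rw [div_le_iff₀ hr0]
    linarith
  have N2 : ∫ p in auxT, (1 / 9 - α) * (‖Φ p‖ ^ 2 / (1 + p.1) ^ 2 +
      p.1 / (1 + p.1) * (2 * ((Φ p).re * (q p).re + (Φ p).im * (q p).im))) = 0 := by
    unfold auxT at I4 dr ⊢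
    rw [Measure.volume_eq_prod] at I4 dr ⊢
    unfold IntegrableOn at I4
    rw [← Measure.prod_restrict] at I4 dr ⊢
    rw [integral_prod_symm _ I4]
    have dr1 := Measure.measurePreserving_swap.quasiMeasurePreserving.ae dr
    have dr2 := Measure.ae_ae_of_ae_prod dr1
    apply integral_eq_zero_of_ae
    filter_upwards [dr2] with θ hθ
    simp only [Pi.zero_apply, Prod.swap_prod_mk] at hθ ⊢
    rw [ae_restrict_iff' measurableSet_Ioi] at hθ
    have hs : ∫ x in Set.Ioi (0:ℝ), (1 / 9 - α) * (‖Φ (x, θ)‖ ^ 2 / (1 + x) ^ 2 +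
        x / (1 + x) * (2 * ((Φ (x, θ)).re * (q (x, θ)).re + (Φ (x, θ)).im * (q (x, θ)).im))) =
        ∫ x in (0:ℝ)..(R + 1), (1 / 9 - α) * (‖Φ (x, θ)‖ ^ 2 / (1 + x) ^ 2 +
        x / (1 + x) * (2 * ((Φ (x, θ)).re * (q (x, θ)).re + (Φ (x, θ)).im * (q (x, θ)).im))) := by
      rw [intervalIntegral.integral_of_le (by linarith)]
      apply setIntegral_eq_of_subset_of_forall_sdiff_eq_zero measurableSet_Ioi
        Set.Ioc_subset_Ioi_self
      intro x hx
      have : R + 1 < x := by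
        by_contra hcon
        exact hx.2 ⟨hx.1, not_lt.mp hcon⟩
      simp [zΦ (x, θ) (by simp; linarith)]
    rw [hs]
    have hre : LipschitzWith 1 Complex.re := by
      refine LipschitzWith.of_dist_le_mul fun x y => ?_
      simpa [Real.dist_eq, Complex.dist_eq] using Complex.abs_re_le_norm (x - y)
    have him : LipschitzWith 1 Complex.im := by
      refine LipschitzWith.of_dist_le_mul fun x y => ?_
      simpa [Real.dist_eq, Complex.dist_eq] using Complex.abs_im_le_norm (x - y)
    have ac0 : AbsolutelyContinuousOnInterval (fun r => Φ (r, θ)) 0 (R + 1) :=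
      (lr θ).lipschitzOnWith.absolutelyContinuousOnInterval
    have ac1 := aux_ac_comp ac0 hre
    have ac2 := aux_ac_comp ac0 him
    have ac3 : AbsolutelyContinuousOnInterval (fun r : ℝ => (1 / 9 - α) * (r / (1 + r))) 0 (R + 1) := by
      apply ContDiffOn.absolutelyContinuousOnInterval
      apply ContDiffOn.mul contDiffOn_const
      apply ContDiffOn.div contDiffOn_id (contDiffOn_const.add contDiffOn_id)
      intro x hx
      rw [Set.uIcc_of_le (by linarith)] at hx
      have := hx.1
      simp only [id]
      positivity
    have ac := ac3.fun_mul ((ac1.fun_mul ac1).fun_add (ac2.fun_mul ac2))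
    have hh := aux_ftc_real (F' := fun x => (1 / 9 - α) * (‖Φ (x, θ)‖ ^ 2 / (1 + x) ^ 2 +
        x / (1 + x) * (2 * ((Φ (x, θ)).re * (q (x, θ)).re + (Φ (x, θ)).im * (q (x, θ)).im)))) ac (by
      filter_upwards [hθ] with x hx hxx
      rw [Set.uIoc_of_le (by linarith)] at hxx
      have hx0 : 0 < x := hxx.1
      have hd := hx hx0
      have d1 : HasDerivAt (fun r => (Φ (r, θ)).re) (q (x, θ)).re x :=
        Complex.reCLM.hasFDerivAt.comp_hasDerivAt x hd
      have d2 : HasDerivAt (fun r => (Φ (r, θ)).im) (q (x, θ)).im x :=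
        Complex.imCLM.hasFDerivAt.comp_hasDerivAt x hd
      have hne : 1 + x ≠ 0 := by positivity
      have d3 := ((hasDerivAt_id x).div ((hasDerivAt_id x).const_add 1) hne).const_mul (1 / 9 - α)
      refine HasDerivAt.congr_deriv (d3.mul ((d1.mul d1).add (d2.mul d2))) ?_
      rw [Complex.sq_norm, Complex.normSq_apply]
      simp only [id, Pi.mul_apply, Pi.add_apply, Pi.div_apply]
      field_simp
      ring)
    rw [hh]
    simp [zΦ (R + 1, θ) (by simp)]
  have key : ∫ p in auxT, (1 / 9 * (p.1 * ‖t p‖ ^ 2 - ‖Φ p‖ ^ 2 / p.1) -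
      (1 / 9 - α) * (‖Φ p‖ ^ 2 / (1 + p.1) ^ 2 +
      p.1 / (1 + p.1) * (2 * ((Φ p).re * (q p).re + (Φ p).im * (q p).im)))) ≤
      ∫ p in auxT, (p.1 * (‖q p + (α / (1 + p.1) : ℝ) * Φ p‖ ^ 2 + ‖t p‖ ^ 2) -
        8 / 9 * (p.1 * (‖q p‖ ^ 2 + ‖t p‖ ^ 2))) := by
    refine setIntegral_mono_on (I3.sub I4) (I1.sub (I2.const_mul _)) hmT ?_
    intro p hp
    exact aux_pointwise α p.1 hα1 hp.1 _ _ _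
  rw [integral_sub I3 I4, N2, integral_sub I1 (I2.const_mul _), integral_const_mul (8 / 9 : ℝ)] at key
  linarith

/-- Polar coordinates on the Euclidean plane. -/
noncomputable def auxPol (p : ℝ × ℝ) : EuclideanSpace ℝ (Fin 2) :=
  (p.1 * cos p.2) • EuclideanSpace.single 0 (1:ℝ) + (p.1 * sin p.2) • EuclideanSpace.single 1 (1:ℝ)

lemma auxPol_eq (r θ : ℝ) :
    (EuclideanSpace.equiv (Fin 2) ℝ).symm ![r * Real.cos θ, r * Real.sin θ] = auxPol (r, θ) := by
  ext i
  fin_cases i <;> simp [auxPol]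

lemma auxPol_zero (p : ℝ × ℝ) : auxPol p 0 = p.1 * cos p.2 := by simp [auxPol]

lemma auxPol_one (p : ℝ × ℝ) : auxPol p 1 = p.1 * sin p.2 := by simp [auxPol]

lemma auxPol_norm (p : ℝ × ℝ) : ‖auxPol p‖ = |p.1| := by
  rw [EuclideanSpace.norm_eq, Fin.sum_univ_two, auxPol_zero, auxPol_one]
  rw [← Real.sqrt_sq_eq_abs]
  congr 1
  simp only [Real.norm_eq_abs, sq_abs]
  linear_combination p.1 ^ 2 * Real.sin_sq_add_cos_sq p.2

lemma auxPol_continuous : Continuous auxPol := by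
  unfold auxPol
  fun_prop

lemma auxPol_mp : ∃ e : ℝ × ℝ ≃ᵐ EuclideanSpace ℝ (Fin 2),
    MeasurePreserving e volume volume ∧ ∀ p, e (polarCoord.symm p) = auxPol p := by
  refine ⟨((MeasurableEquiv.toLp 2 (Fin 2 → ℝ)).symm.trans MeasurableEquiv.finTwoArrow).symm,
    ?_, ?_⟩
  · exact MeasurePreserving.symm _ ((volume_preserving_finTwoArrow ℝ).comp
      (EuclideanSpace.volume_preserving_symm_measurableEquiv_toLp (Fin 2)))
  · intro p
    rw [MeasurableEquiv.symm_apply_eq]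
    apply Prod.ext
    · exact (auxPol_zero p).symm
    · exact (auxPol_one p).symm

lemma auxPol_integral (f : EuclideanSpace ℝ (Fin 2) → ℝ) :
    ∫ x, f x = ∫ p in auxT, p.1 * f (auxPol p) := by
  obtain ⟨e, he, hp⟩ := auxPol_mp
  rw [← he.integral_comp e.measurableEmbedding, ← integral_comp_polarCoord_symm]
  simp_rw [hp]
  rfl

lemma auxPol_ae {P : EuclideanSpace ℝ (Fin 2) → Prop} (hm : MeasurableSet {x | P x})
    (h : ∀ᵐ x, P x) : ∀ᵐ p ∂(volume.restrict auxT), P (auxPol p) := by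
  obtain ⟨e, he, hp⟩ := auxPol_mp
  have h1 : ∀ᵐ z : ℝ × ℝ, P (e z) := he.quasiMeasurePreserving.ae h
  have hmT : MeasurableSet auxT := measurableSet_Ioi.prod measurableSet_Ioo
  have hms : MeasurableSet {z | P (e z)} := e.measurable hm
  have h2 : ∫⁻ z, Set.indicator {z | P (e z)}ᶜ 1 z = 0 := by
    rw [lintegral_indicator_one hms.compl]
    exact h1
  rw [← lintegral_comp_polarCoord_symm] at h2
  have hmeas : Measurable fun p : ℝ × ℝ => ENNReal.ofReal p.1 •
      Set.indicator {z | P (e z)}ᶜ (1 : ℝ × ℝ → ENNReal) (polarCoord.symm p) := by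
    simp only [smul_eq_mul]
    refine Measurable.mul (ENNReal.measurable_ofReal.comp measurable_fst) ?_
    exact (measurable_one.indicator hms.compl).comp continuous_polarCoord_symm.measurable
  rw [lintegral_eq_zero_iff hmeas] at h2
  change _ =ᵐ[volume.restrict auxT] _ at h2
  filter_upwards [h2, ae_restrict_mem hmT] with p hz hpT
  by_contra hcon
  have hpos : 0 < p.1 := hpT.1
  rw [← hp] at hcon
  rw [Set.indicator_of_mem (show polarCoord.symm p ∈ {z | P (e z)}ᶜ from hcon)] at hz
  simp [hpos.not_ge] at hz

lemma aux_rot (c s : ℝ) (h : c ^ 2 + s ^ 2 = 1) (U V : ℂ) :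
    ‖(c:ℂ) * U + s * V‖ ^ 2 + ‖-(s:ℂ) * U + c * V‖ ^ 2 = ‖U‖ ^ 2 + ‖V‖ ^ 2 := by
  have n : ∀ z : ℂ, ‖z‖ ^ 2 = z.re ^ 2 + z.im ^ 2 := by
    intro z; rw [Complex.sq_norm, Complex.normSq_apply]; ring
  rw [n, n, n U, n V]
  simp
  linear_combination (U.re ^ 2 + U.im ^ 2 + V.re ^ 2 + V.im ^ 2) * h

lemma aux_fderiv (α : ℝ) {ψ : EuclideanSpace ℝ (Fin 2) → ℂ} {x : EuclideanSpace ℝ (Fin 2)}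
    (hx : x ≠ 0) (hd : DifferentiableAt ℝ ψ x) (v : EuclideanSpace ℝ (Fin 2)) :
    (1 + ‖x‖) ^ (-(2 * α)) * ‖fderiv ℝ (fun y => ((1 + ‖y‖) ^ α : ℝ) • ψ y) x v‖ ^ 2 =
      ‖fderiv ℝ ψ x v + (α / (1 + ‖x‖) * (inner ℝ x v / ‖x‖) : ℝ) * ψ x‖ ^ 2 := by
  have hn : 0 < ‖x‖ := norm_pos_iff.mpr hx
  have h1 : HasFDerivAt (fun y : EuclideanSpace ℝ (Fin 2) => ‖y‖)
      ((1 / (2 * √(‖x‖ ^ 2))) • (2 • (innerSL ℝ x))) x := by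
    have := (hasStrictFDerivAt_norm_sq x).hasFDerivAt.sqrt (by positivity)
    simpa [Real.sqrt_sq (norm_nonneg _)] using this
  have h2 := (h1.const_add 1).rpow_const (p := α) (Or.inl (by positivity))
  have h3 := h2.smul hd.hasFDerivAt
  have h4 : fderiv ℝ (fun y => ((1 + ‖y‖) ^ α : ℝ) • ψ y) x = _ := h3.fderiv
  rw [h4]
  have hp : 0 < (1 + ‖x‖) ^ α := by positivity
  have e1 : (1 + ‖x‖) ^ (-(2 * α)) = (((1 + ‖x‖) ^ α) ^ 2)⁻¹ := by
    rw [Real.rpow_neg (by positivity), mul_comm, Real.rpow_mul (by positivity)]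
    norm_cast
  have e2 : (1 + ‖x‖) ^ (α - 1) = (1 + ‖x‖) ^ α / (1 + ‖x‖) := by
    rw [Real.rpow_sub_one (by positivity)]
  rw [e1]
  set w := (1 + ‖x‖) ^ α with hw
  have e3 : (w • fderiv ℝ ψ x + ((α * (1 + ‖x‖) ^ (α - 1)) •
      ((1 / (2 * √(‖x‖ ^ 2))) • (2 • (innerSL ℝ x)))).smulRight (ψ x)) v =
      (w : ℂ) * (fderiv ℝ ψ x v + (α / (1 + ‖x‖) * (inner ℝ x v / ‖x‖) : ℝ) * ψ x) := by
    rw [e2, Real.sqrt_sq hn.le]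
    simp only [ContinuousLinearMap.add_apply, ContinuousLinearMap.smul_apply,
      ContinuousLinearMap.smulRight_apply, innerSL_apply_apply, Complex.real_smul, smul_eq_mul,
      nsmul_eq_mul]
    push_cast
    have : (‖x‖ : ℂ) ≠ 0 := by exact_mod_cast hn.ne'
    have : (1 + ‖x‖ : ℂ) ≠ 0 := by exact_mod_cast (by positivity : (1 + ‖x‖) ≠ 0)
    field_simp
  erw [e3]
  rw [norm_mul, mul_pow, Complex.norm_real, Real.norm_of_nonneg hp.le]
  field_simp

lemma auxPol_sub (r s θ : ℝ) : auxPol (r, θ) - auxPol (s, θ) = auxPol (r - s, θ) := by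
  simp only [auxPol]
  module

lemma aux_single_norm (i : Fin 2) : ‖EuclideanSpace.single i (1:ℝ)‖ = 1 := by simp

lemma auxPol_lip (r θ η : ℝ) (hr : 0 < r) :
    dist (auxPol (r, θ)) (auxPol (r, η)) ≤ 2 * r * |θ - η| := by
  rw [dist_eq_norm]
  have : auxPol (r, θ) - auxPol (r, η) = (r * (cos θ - cos η)) • EuclideanSpace.single 0 (1:ℝ)
      + (r * (sin θ - sin η)) • EuclideanSpace.single 1 (1:ℝ) := by
    simp only [auxPol]
    module
  rw [this]
  refine (norm_add_le _ _).trans ?_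
  rw [norm_smul, norm_smul, aux_single_norm, aux_single_norm, Real.norm_eq_abs, Real.norm_eq_abs,
    abs_mul, abs_mul, abs_of_pos hr]
  have h1 := Real.abs_cos_sub_cos_le θ η
  have h2 := Real.abs_sin_sub_sin_le θ η
  nlinarith

lemma auxPol_deriv_r (r θ : ℝ) : HasDerivAt (fun r => auxPol (r, θ))
    (cos θ • EuclideanSpace.single 0 (1:ℝ) + sin θ • EuclideanSpace.single 1 (1:ℝ)) r := by
  have h1 := (((hasDerivAt_id r).mul_const (cos θ)).smul_const
    (EuclideanSpace.single (0 : Fin 2) (1:ℝ)))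
  have h2 := (((hasDerivAt_id r).mul_const (sin θ)).smul_const
    (EuclideanSpace.single (1 : Fin 2) (1:ℝ)))
  have h3 := h1.add h2
  simp only [one_mul] at h3
  exact h3

lemma auxPol_deriv_t (r θ : ℝ) : HasDerivAt (fun θ => auxPol (r, θ))
    ((r * -sin θ) • EuclideanSpace.single 0 (1:ℝ) + (r * cos θ) • EuclideanSpace.single 1 (1:ℝ))
    θ := by
  have h1 := (((Real.hasDerivAt_cos θ).const_mul r).smul_const
    (EuclideanSpace.single (0 : Fin 2) (1:ℝ)))
  have h2 := (((Real.hasDerivAt_sin θ).const_mul r).smul_const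
    (EuclideanSpace.single (1 : Fin 2) (1:ℝ)))
  exact h1.add h2

lemma auxPol_inner_zero (p : ℝ × ℝ) :
    inner ℝ (auxPol p) (EuclideanSpace.single 0 1) = p.1 * cos p.2 := by
  rw [EuclideanSpace.inner_single_right]
  simp [auxPol_zero]

lemma auxPol_inner_one (p : ℝ × ℝ) :
    inner ℝ (auxPol p) (EuclideanSpace.single 1 1) = p.1 * sin p.2 := by
  rw [EuclideanSpace.inner_single_right]
  simp [auxPol_one]

/-- Proof step of Proposition 4.1: for `0 < α < 1` and `ψ` with vanishing angular
averages, the weighted Dirichlet integral of `(1+|x|)^α ψ` dominates `8/9` of the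
unweighted Dirichlet integral of `ψ`. -/
theorem weighted_dirichlet_bound_orthogonal_radial
    (α : ℝ) (hα0 : 0 < α) (hα1 : α < 1)
    (ψ : EuclideanSpace ℝ (Fin 2) → ℂ) (K : NNReal)
    (hψ : LipschitzWith K ψ) (hsupp : HasCompactSupport ψ)
    (horth : ∀ r : ℝ, 0 < r →
      ∫ θ in (0:ℝ)..(2 * Real.pi),
        ψ ((EuclideanSpace.equiv (Fin 2) ℝ).symm ![r * Real.cos θ, r * Real.sin θ]) = 0) :
    ∫ x : EuclideanSpace ℝ (Fin 2),
        (1 + ‖x‖) ^ (-(2 * α)) *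
          (‖fderiv ℝ (fun y => ((1 + ‖y‖) ^ α : ℝ) • ψ y) x
              (EuclideanSpace.single 0 1)‖ ^ 2 +
            ‖fderiv ℝ (fun y => ((1 + ‖y‖) ^ α : ℝ) • ψ y) x
              (EuclideanSpace.single 1 1)‖ ^ 2) ≥
      (8 / 9) * ∫ x : EuclideanSpace ℝ (Fin 2),
        (‖fderiv ℝ ψ x (EuclideanSpace.single 0 1)‖ ^ 2 +
          ‖fderiv ℝ ψ x (EuclideanSpace.single 1 1)‖ ^ 2) := by
  simp only [auxPol_eq] at horth
  have hcont : Continuous ψ := hψ.continuous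
  have hcp : Continuous fun p => ψ (auxPol p) := hcont.comp auxPol_continuous
  have hmT : MeasurableSet auxT := measurableSet_Ioi.prod measurableSet_Ioo
  -- vanishing at the origin
  have h0 : ψ 0 = 0 := by
    have key : ∀ r : ℝ, 0 < r → ‖ψ 0‖ ≤ K * r := by
      intro r hr
      have i1 : ∫ θ in (0:ℝ)..(2 * π), (ψ 0 - ψ (auxPol (r, θ))) = (2 * π : ℝ) • ψ 0 := by
        have hci : IntervalIntegrable (fun θ => ψ (auxPol (r, θ))) volume 0 (2 * π) :=
          (hcp.comp (by fun_prop : Continuous fun θ : ℝ => (r, θ))).intervalIntegrable _ _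
        rw [intervalIntegral.integral_sub intervalIntegrable_const hci, horth r hr]
        simp
      have i2 := intervalIntegral.norm_integral_le_of_norm_le_const (a := 0) (b := 2 * π)
        (f := fun θ => ψ 0 - ψ (auxPol (r, θ))) (C := K * r) (by
          intro θ _
          have := hψ.dist_le_mul 0 (auxPol (r, θ))
          rw [dist_eq_norm, dist_eq_norm, zero_sub, norm_neg, auxPol_norm] at this
          simpa [abs_of_pos hr] using this)
      rw [i1, norm_smul, Real.norm_of_nonneg (by positivity), sub_zero,
        abs_of_pos (by positivity), mul_comm] at i2
      exact le_of_mul_le_mul_right i2 (by positivity)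
    have hle : ‖ψ 0‖ ≤ 0 := by
      have ht : Filter.Tendsto (fun r : ℝ => (K : ℝ) * r) (nhdsWithin 0 (Set.Ioi 0))
          (nhds 0) := by
        have : Continuous fun r : ℝ => (K : ℝ) * r := by fun_prop
        have := this.tendsto 0
        rw [mul_zero] at this
        exact this.mono_left nhdsWithin_le_nhds
      refine ge_of_tendsto ht ?_
      filter_upwards [self_mem_nhdsWithin] with r hr
      exact key r hr
    exact norm_le_zero_iff.mp hle
  obtain ⟨R, hR, hRs⟩ : ∃ R : ℝ, 0 < R ∧ tsupport ψ ⊆ Metric.closedBall 0 R := by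
    obtain ⟨R, hRs⟩ := hsupp.isBounded.subset_closedBall 0
    exact ⟨max R 1, by positivity, hRs.trans (Metric.closedBall_subset_closedBall (le_max_left _ _))⟩
  have hout : ∀ p : ℝ × ℝ, R < p.1 → auxPol p ∉ tsupport ψ := by
    intro p hp hmem
    have := hRs hmem
    rw [mem_closedBall_zero_iff, auxPol_norm] at this
    have := le_abs_self p.1
    linarith
  set u : ℝ × ℝ → ℂ := fun p => fderiv ℝ ψ (auxPol p) (EuclideanSpace.single 0 1) with hu
  set v : ℝ × ℝ → ℂ := fun p => fderiv ℝ ψ (auxPol p) (EuclideanSpace.single 1 1) with hv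
  have mu : Measurable u :=
    (measurable_fderiv_apply_const ℝ ψ _).comp auxPol_continuous.measurable
  have mv : Measurable v :=
    (measurable_fderiv_apply_const ℝ ψ _).comp auxPol_continuous.measurable
  have bu : ∀ p, ‖u p‖ ≤ K := by
    intro p
    have := (fderiv ℝ ψ (auxPol p)).le_of_opNorm_le (norm_fderiv_le_of_lipschitz ℝ hψ)
      (EuclideanSpace.single 0 1)
    rwa [aux_single_norm, mul_one] at this
  have bv : ∀ p, ‖v p‖ ≤ K := by
    intro p
    have := (fderiv ℝ ψ (auxPol p)).le_of_opNorm_le (norm_fderiv_le_of_lipschitz ℝ hψ)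
      (EuclideanSpace.single 1 1)
    rwa [aux_single_norm, mul_one] at this
  have zu : ∀ p : ℝ × ℝ, R < p.1 → u p = 0 := by
    intro p hp
    simp [hu, fderiv_of_notMem_tsupport ℝ (hout p hp)]
  have zv : ∀ p : ℝ × ℝ, R < p.1 → v p = 0 := by
    intro p hp
    simp [hv, fderiv_of_notMem_tsupport ℝ (hout p hp)]
  have bcomb : ∀ (a b : ℝ) (z w : ℂ), |a| ≤ 1 → |b| ≤ 1 → ‖z‖ ≤ K → ‖w‖ ≤ K →
      ‖(a:ℂ) * z + b * w‖ ≤ 2 * K := by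
    intro a b z w ha hb hz hw
    refine (norm_add_le _ _).trans ?_
    rw [norm_mul, norm_mul, Complex.norm_real, Complex.norm_real, Real.norm_eq_abs,
      Real.norm_eq_abs]
    have := mul_le_mul ha hz (norm_nonneg _) zero_le_one
    have := mul_le_mul hb hw (norm_nonneg _) zero_le_one
    linarith
  have hdiff : ∀ᵐ p ∂(volume.restrict auxT), DifferentiableAt ℝ ψ (auxPol p) :=
    auxPol_ae (measurableSet_of_differentiableAt ℝ ψ) hψ.ae_differentiableAt
  have core := aux_polar_core α hα0 hα1 (fun p => ψ (auxPol p))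
    (fun p => (cos p.2 : ℂ) * u p + (sin p.2 : ℂ) * v p)
    (fun p => -(sin p.2 : ℂ) * u p + (cos p.2 : ℂ) * v p) K (2 * K) R hR
    hcp.measurable (by fun_prop) (by fun_prop)
    (fun p => by
      have := bcomb (cos p.2) (sin p.2) _ _ (abs_cos_le_one _) (abs_sin_le_one _) (bu p) (bv p)
      simpa using this)
    (fun p => by
      have := bcomb (-sin p.2) (cos p.2) _ _ (by rw [abs_neg]; exact abs_sin_le_one _)
        (abs_cos_le_one _) (bu p) (bv p)
      simpa using this)
    (fun p hp => by
      have := hψ.dist_le_mul (auxPol p) 0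
      rw [h0, dist_zero_right, dist_zero_right, auxPol_norm, abs_of_pos hp] at this
      exact this)
    (fun p hp => image_eq_zero_of_notMem_tsupport (hout p hp))
    (fun p hp => by simp [zu p hp, zv p hp])
    (fun p hp => by simp [zu p hp, zv p hp])
    (fun θ => LipschitzWith.of_dist_le_mul fun r s => by
      have := hψ.dist_le_mul (auxPol (r, θ)) (auxPol (s, θ))
      rw [dist_eq_norm (auxPol _), auxPol_sub, auxPol_norm] at this
      rwa [Real.dist_eq])
    (fun r hr => ⟨K * (2 * r.toNNReal), LipschitzWith.of_dist_le_mul fun θ η => by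
      refine (hψ.dist_le_mul (auxPol (r, θ)) (auxPol (r, η))).trans ?_
      have := auxPol_lip r θ η hr
      push_cast
      rw [Real.coe_toNNReal _ hr.le, Real.dist_eq, mul_assoc]
      exact mul_le_mul_of_nonneg_left this K.2⟩)
    (fun r => by simp [auxPol])
    (fun r hr => by
      have hper : Function.Periodic (fun θ => ψ (auxPol (r, θ))) (2 * π) := by
        intro θ
        simp [auxPol]
      have := hper.intervalIntegral_add_eq (-π) 0
      rw [zero_add, horth r hr] at this
      rw [← this]
      congr 1
      ring)
    (by
      filter_upwards [hdiff] with p hp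
      have := hp.hasFDerivAt.comp_hasDerivAt p.1 (auxPol_deriv_r p.1 p.2)
      simp only [map_add, map_smul, Complex.real_smul] at this
      exact this)
    (by
      filter_upwards [hdiff] with p hp
      have := hp.hasFDerivAt.comp_hasDerivAt p.2 (auxPol_deriv_t p.1 p.2)
      simp only [map_add, map_smul, Complex.real_smul] at this
      refine this.congr_deriv ?_
      simp only [hu, hv]
      push_cast
      ring)
  rw [ge_iff_le, auxPol_integral, auxPol_integral]
  have eR : ∀ p : ℝ × ℝ, ‖(cos p.2 : ℂ) * u p + (sin p.2 : ℂ) * v p‖ ^ 2 +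
      ‖-(sin p.2 : ℂ) * u p + (cos p.2 : ℂ) * v p‖ ^ 2 = ‖u p‖ ^ 2 + ‖v p‖ ^ 2 := by
    intro p
    have := aux_rot (cos p.2) (sin p.2) (Real.cos_sq_add_sin_sq p.2) (u p) (v p)
    simpa using this
  simp only [eR] at core
  refine core.trans (le_of_eq ?_)
  apply integral_congr_ae
  filter_upwards [hdiff, ae_restrict_mem hmT] with p hp hpT
  have hr : 0 < p.1 := hpT.1
  have hne : auxPol p ≠ 0 := by
    rw [← norm_pos_iff, auxPol_norm]
    exact abs_pos.mpr hr.ne'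
  rw [mul_add ((1 + ‖auxPol p‖) ^ (-(2 * α))), aux_fderiv α hne hp, aux_fderiv α hne hp,
    auxPol_inner_zero, auxPol_inner_one, auxPol_norm, abs_of_pos hr,
    mul_div_cancel_left₀ _ hr.ne', mul_div_cancel_left₀ _ hr.ne']
  congr 1
  refine Eq.trans ?_ (aux_rot (cos p.2) (sin p.2) (Real.cos_sq_add_sin_sq p.2) _ _)
  have hcs : (cos p.2 : ℂ) ^ 2 + (sin p.2 : ℂ) ^ 2 = 1 := by
    exact_mod_cast Real.cos_sq_add_sin_sq p.2
  congr 3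
  · simp only [hu, hv]
    push_cast at hcs ⊢
    linear_combination (-(α / (1 + p.1) : ℂ) * ψ (auxPol p)) * hcs
  · simp only [hu, hv]
    push_cast
    ring
end

section
/- Let α ≥ 0 and let ψ : ℝ² → ℂ be a compactly supported Lipschitz function. Then ∫_{ℝ²} (1+|x|)^{-2α} |∇((1+|x|)^{α} ψ(x))|² dx = ∫_{ℝ²} ( |∇ψ(x)|² - α (1+|x|)^{-2} (|x|^{-1} - α) |ψ(x)|² ) dx. -/
open MeasureTheory Real

section helpers

open Filter Topology

abbrev E2 := EuclideanSpace ℝ (Fin 2)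

lemma integrable_ball_inv (R c : ℝ) :
    Integrable ((Metric.ball (0:E2) R).indicator (fun x => c * (1 + ‖x‖⁻¹))) := by
  rw [integrable_indicator_iff Metric.isOpen_ball.measurableSet]
  have := (integrableOn_fun_norm_addHaar (E := E2) (F := ℝ) volume (r := R)
    (f := fun y => c * (1 + y⁻¹)))
  rw [this]
  have h : IntegrableOn (fun y : ℝ => c * (y + 1)) (Set.Ioo 0 R) :=
    ((by fun_prop : Continuous (fun y : ℝ => c * (y + 1))).integrableOn_Icc).mono_set
      Set.Ioo_subset_Icc_self
  refine h.congr_fun ?_ measurableSet_Ioo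
  intro y hy
  have : y ≠ 0 := hy.1.ne'
  simp
  field_simp

lemma ibp_smooth {V g : E2 → ℝ} (hV : ContDiff ℝ 1 V) {D : NNReal} (hg : LipschitzWith D g)
    {R : ℝ} (hR : 0 < R) (hs : tsupport g ⊆ Metric.ball 0 R) (hcs : HasCompactSupport g) (v : E2) :
    ∫ x, V x * fderiv ℝ g x v = - ∫ x, fderiv ℝ V x v * g x := by
  have h0 : ∀ x, R ≤ ‖x‖ → g x = 0 := fun x hx =>
    image_eq_zero_of_notMem_tsupport (fun h => hx.not_gt (by simpa using hs h))
  let χ : ContDiffBump (0 : E2) := ⟨R, R + 1, hR, by linarith⟩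
  have hW : ContDiff ℝ 1 (fun x => V x * χ x) := hV.mul χ.contDiff
  have hWc : HasCompactSupport (fun x => V x * χ x) := χ.hasCompactSupport.mul_left
  obtain ⟨C, hC⟩ := hW.lipschitzWith_of_hasCompactSupport hWc (by simp)
  have key := hC.integral_lineDeriv_mul_eq (μ := volume) hg hcs v
  have e1 : ∀ x, lineDeriv ℝ (fun x => V x * χ x) x v * g x = fderiv ℝ V x v * g x := by
    intro x
    by_cases hx : R ≤ ‖x‖
    · simp [h0 x hx]
    · have hb : x ∈ Metric.ball (0:E2) χ.rIn := by simpa using hx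
      have he : (fun x => V x * χ x) =ᶠ[𝓝 x] V := by
        filter_upwards [χ.eventuallyEq_one_of_mem_ball hb] with y hy
        simp [hy]
      rw [((hW.differentiable (by simp)) x).lineDeriv_eq_fderiv, he.fderiv_eq]
  have e2 : ∀ᵐ x : E2, lineDeriv ℝ g x (-v) * (V x * χ x) = - (V x * fderiv ℝ g x v) := by
    filter_upwards [hg.ae_differentiableAt] with x hx
    rw [hx.lineDeriv_eq_fderiv]
    by_cases hx' : R ≤ ‖x‖
    · rw [fderiv_of_notMem_tsupport ℝ (fun h => hx'.not_gt (by simpa using hs h))]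
      simp
    · have := χ.one_of_mem_closedBall (x := x) (by simpa using le_of_lt (not_le.1 hx'))
      rw [this]; simp; ring
  rw [integral_congr_ae (Eventually.of_forall e1), integral_congr_ae e2, integral_neg] at key
  linarith

/-- the regularised field -/
lemma contDiff_V {ε : ℝ} (hε : 0 < ε) (i : Fin 2) :
    ContDiff ℝ 1 (fun x : E2 => x i * (√(‖x‖^2+ε^2) + (‖x‖^2+ε^2))⁻¹) := by
  have h1 : ContDiff ℝ 1 (fun x : E2 => ‖x‖^2+ε^2) := (contDiff_norm_sq ℝ).add contDiff_const
  have h2 : ∀ x : E2, 0 < ‖x‖^2+ε^2 := fun x => by positivity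
  refine ContDiff.mul (by fun_prop) (ContDiff.inv ((h1.sqrt fun x => (h2 x).ne').add h1) ?_)
  intro x
  have := h2 x
  positivity

lemma fderiv_V {ε : ℝ} (hε : 0 < ε) (i : Fin 2) (x : E2) :
    fderiv ℝ (fun x : E2 => x i * (√(‖x‖^2+ε^2) + (‖x‖^2+ε^2))⁻¹) x (EuclideanSpace.single i 1)
     = (√(‖x‖^2+ε^2) + (‖x‖^2+ε^2))⁻¹ - (x i)^2 * ((√(‖x‖^2+ε^2))⁻¹ + 2)
        * ((√(‖x‖^2+ε^2) + (‖x‖^2+ε^2))⁻¹)^2 := by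
  have hu : 0 < ‖x‖^2+ε^2 := by positivity
  have h1 : HasFDerivAt (fun x : E2 => ‖x‖^2+ε^2) (2 • (innerSL ℝ x)) x :=
    (hasStrictFDerivAt_norm_sq x).hasFDerivAt.add_const _
  have h2 := (h1.sqrt hu.ne').add h1
  have h3 := (hasDerivAt_inv (x := √(‖x‖^2+ε^2) + (‖x‖^2+ε^2)) (by positivity)).comp_hasFDerivAt x h2
  have h4 : HasFDerivAt (fun x : E2 => x i) (EuclideanSpace.proj i : E2 →L[ℝ] ℝ) x :=
    (EuclideanSpace.proj i : E2 →L[ℝ] ℝ).hasFDerivAt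
  have h5 := h4.mul h3
  have h6 : (fun x : E2 => x i * (√(‖x‖^2+ε^2) + (‖x‖^2+ε^2))⁻¹) =
    (fun x : E2 => x i) * (Inv.inv ∘ ((fun x : E2 => √(‖x‖^2+ε^2)) + fun x => (‖x‖^2+ε^2))) := by
    ext; simp
  rw [h6, h5.fderiv]
  have : 0 < √(‖x‖^2+ε^2) := by positivity
  simp [EuclideanSpace.inner_single_right]
  field_simp
  ring

lemma V_bound (a r s : ℝ) (hr : 0 < r) (hs : r ≤ s) (ha : |a| ≤ r) :
    |a * (s + s^2)⁻¹| ≤ 1 ∧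
    |(s + s^2)⁻¹ - a^2 * (s⁻¹ + 2) * ((s + s^2)⁻¹)^2| ≤ 2 * r⁻¹ := by
  have hs0 : 0 < s := by linarith
  have h1 : (s + s^2)⁻¹ ≤ s⁻¹ := inv_anti₀ hs0 (by nlinarith)
  have h2 : s⁻¹ ≤ r⁻¹ := inv_anti₀ hr hs
  have h3 : 0 ≤ (s + s^2)⁻¹ := by positivity
  have h0 : a^2 ≤ s^2 := sq_le_sq' (by linarith [neg_abs_le a]) (by linarith [le_abs_self a])
  constructor
  · rw [abs_mul, abs_of_nonneg h3]
    calc |a| * (s+s^2)⁻¹ ≤ s * s⁻¹ := by gcongr; linarith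
      _ = 1 := by field_simp
  · have h4 : a^2 * (s⁻¹ + 2) * ((s + s^2)⁻¹)^2 ≤ 2 * s⁻¹ := by
      calc _ ≤ s^2 * (s⁻¹ + 2) * ((s + s^2)⁻¹)^2 := by gcongr
        _ ≤ 2 * s⁻¹ := by
          field_simp
          nlinarith
    have h5 : 0 ≤ a^2 * (s⁻¹ + 2) * ((s + s^2)⁻¹)^2 := by positivity
    have h6 : 0 < r⁻¹ := by positivity
    rw [abs_le]; constructor <;> linarith

lemma integrable_of_bd {f : E2 → ℝ} (hf : AEStronglyMeasurable f) {R c : ℝ}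
    (hb : ∀ᵐ x, ‖f x‖ ≤ (Metric.ball (0:E2) R).indicator (fun x => c * (1 + ‖x‖⁻¹)) x) :
    Integrable f := (integrable_ball_inv R c).mono' hf hb

lemma ae_ne_zero : ∀ᵐ x : E2, x ≠ 0 := by
  simp [ae_iff]

lemma abs_coord_le (x : E2) (i : Fin 2) : |x i| ≤ ‖x‖ := by
  simpa using PiLp.norm_apply_le x i

lemma ibp_sing {g : E2 → ℝ} {D : NNReal} (hg : LipschitzWith D g)
    {R : ℝ} (hR : 0 < R) (hs : tsupport g ⊆ Metric.ball 0 R) (hcs : HasCompactSupport g)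
    {M : ℝ} (hM : ∀ x, |g x| ≤ M) (i : Fin 2) :
    Integrable (fun x : E2 => x i * (‖x‖ + ‖x‖^2)⁻¹ * fderiv ℝ g x (EuclideanSpace.single i 1)) ∧
    Integrable (fun x : E2 => ((‖x‖ + ‖x‖^2)⁻¹ - (x i)^2 * (‖x‖⁻¹ + 2) * ((‖x‖ + ‖x‖^2)⁻¹)^2)
      * g x) ∧
    ∫ x : E2, x i * (‖x‖ + ‖x‖^2)⁻¹ * fderiv ℝ g x (EuclideanSpace.single i 1) =
    - ∫ x : E2, ((‖x‖ + ‖x‖^2)⁻¹ - (x i)^2 * (‖x‖⁻¹ + 2) * ((‖x‖ + ‖x‖^2)⁻¹)^2) * g x := by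
  have hM0 : 0 ≤ M := (abs_nonneg _).trans (hM 0)
  have hmd : Measurable (fun x => fderiv ℝ g x (EuclideanSpace.single i 1)) :=
    measurable_fderiv_apply_const ℝ g _
  have hmg : Measurable g := hg.continuous.measurable
  have hmi : Measurable (fun x : E2 => x i) := by fun_prop
  let S : ℝ → E2 → ℝ := fun ε x => √(‖x‖^2 + ε^2)
  have hSm : ∀ ε, Measurable (S ε) := fun ε => by simp only [S]; fun_prop
  have hS2 : ∀ ε x, (S ε x)^2 = ‖x‖^2+ε^2 := fun ε x => Real.sq_sqrt (by positivity)
  have hS0 : ∀ x, S 0 x = ‖x‖ := fun x => by simp [S]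
  have hSr : ∀ ε x, ‖x‖ ≤ S ε x := fun ε x => Real.le_sqrt_of_sq_le (by nlinarith [sq_nonneg ε])
  have hSt : ∀ x, Tendsto (fun ε => S ε x) (𝓝[>] 0) (𝓝 ‖x‖) := fun x => by
    have : Continuous (fun ε => S ε x) := by simp only [S]; fun_prop
    have := this.tendsto 0
    rw [hS0] at this
    exact this.mono_left nhdsWithin_le_nhds
  let P : ℝ → E2 → ℝ := fun s x => x i * (s + s^2)⁻¹ * fderiv ℝ g x (EuclideanSpace.single i 1)
  let Q : ℝ → E2 → ℝ := fun s x => ((s + s^2)⁻¹ - (x i)^2 * (s⁻¹ + 2) * ((s + s^2)⁻¹)^2) * g x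
  have hPm : ∀ ε, AEStronglyMeasurable (fun x => P (S ε x) x) volume := fun ε => by
    have := hSm ε
    apply Measurable.aestronglyMeasurable
    simp only [P]; fun_prop
  have hQm : ∀ ε, AEStronglyMeasurable (fun x => Q (S ε x) x) volume := fun ε => by
    have := hSm ε
    apply Measurable.aestronglyMeasurable
    simp only [Q]; fun_prop
  have hPb : ∀ ε, ∀ᵐ x : E2, ‖P (S ε x) x‖ ≤
      (Metric.ball (0:E2) R).indicator (fun x => D * (1 + ‖x‖⁻¹)) x := fun ε => by
    filter_upwards [ae_ne_zero] with x hx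
    have hr : 0 < ‖x‖ := norm_pos_iff.2 hx
    by_cases hb : x ∈ Metric.ball (0:E2) R
    · rw [Set.indicator_of_mem hb]
      have h1 := (V_bound (x i) ‖x‖ (S ε x) hr (hSr ε x) (abs_coord_le x i)).1
      have h2 : |fderiv ℝ g x (EuclideanSpace.single i 1)| ≤ D := by
        have := (fderiv ℝ g x).le_of_opNorm_le (norm_fderiv_le_of_lipschitz ℝ hg)
          (EuclideanSpace.single i 1)
        simpa using this
      simp only [P]
      rw [norm_mul, Real.norm_eq_abs, Real.norm_eq_abs]
      calc _ ≤ 1 * (D:ℝ) := by gcongr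
        _ ≤ _ := by nlinarith [D.coe_nonneg, inv_pos.2 hr, mul_nonneg D.coe_nonneg (inv_pos.2 hr).le]
    · rw [Set.indicator_of_notMem hb]
      simp only [P]
      rw [fderiv_of_notMem_tsupport ℝ (fun h => hb (hs h))]
      simp
  have hQb : ∀ ε, ∀ᵐ x : E2, ‖Q (S ε x) x‖ ≤
      (Metric.ball (0:E2) R).indicator (fun x => (2 * M) * (1 + ‖x‖⁻¹)) x := fun ε => by
    filter_upwards [ae_ne_zero] with x hx
    have hr : 0 < ‖x‖ := norm_pos_iff.2 hx
    by_cases hb : x ∈ Metric.ball (0:E2) R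
    · rw [Set.indicator_of_mem hb]
      have h1 := (V_bound (x i) ‖x‖ (S ε x) hr (hSr ε x) (abs_coord_le x i)).2
      simp only [Q]
      rw [norm_mul, Real.norm_eq_abs, Real.norm_eq_abs]
      calc _ ≤ (2 * ‖x‖⁻¹) * M := by gcongr; exact hM x
        _ ≤ _ := by nlinarith
    · rw [Set.indicator_of_notMem hb]
      simp only [Q]
      rw [image_eq_zero_of_notMem_tsupport (fun h => hb (hs h))]
      simp
  have hPl := tendsto_integral_filter_of_dominated_convergence (l := 𝓝[>] (0:ℝ)) (μ := volume)
    (F := fun ε x => P (S ε x) x) (f := fun x => P ‖x‖ x) _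
    (Eventually.of_forall hPm) (Eventually.of_forall hPb) (integrable_ball_inv R D) (by
      filter_upwards [ae_ne_zero] with x hx
      have hr : 0 < ‖x‖ := norm_pos_iff.2 hx
      have : ContinuousAt (fun s => P s x) ‖x‖ := by
        simp only [P]
        have : ‖x‖ + ‖x‖^2 ≠ 0 := by positivity
        fun_prop (disch := assumption)
      exact this.tendsto.comp (hSt x))
  have hQl := tendsto_integral_filter_of_dominated_convergence (l := 𝓝[>] (0:ℝ)) (μ := volume)
    (F := fun ε x => Q (S ε x) x) (f := fun x => Q ‖x‖ x) _
    (Eventually.of_forall hQm) (Eventually.of_forall hQb) (integrable_ball_inv R (2*M)) (by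
      filter_upwards [ae_ne_zero] with x hx
      have hr : 0 < ‖x‖ := norm_pos_iff.2 hx
      have : ContinuousAt (fun s => Q s x) ‖x‖ := by
        simp only [Q]
        have : ‖x‖ + ‖x‖^2 ≠ 0 := by positivity
        have : ‖x‖ ≠ 0 := by positivity
        fun_prop (disch := assumption)
      exact this.tendsto.comp (hSt x))
  refine ⟨?_, ?_, ?_⟩
  · have := integrable_of_bd (hPm 0) (hPb 0)
    simpa only [hS0] using this
  · have := integrable_of_bd (hQm 0) (hQb 0)
    simpa only [hS0] using this
  · refine tendsto_nhds_unique hPl (hQl.neg.congr' ?_)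
    filter_upwards [self_mem_nhdsWithin] with ε (hε : 0 < ε)
    have := ibp_smooth (contDiff_V hε i) hg hR hs hcs (EuclideanSpace.single i 1)
    simp only [fderiv_V hε] at this
    simp only [P, Q, hS2]
    exact this.symm

/-- The key identity. -/
lemma key_ibp {g : E2 → ℝ} {D : NNReal} (hg : LipschitzWith D g)
    {R : ℝ} (hR : 0 < R) (hs : tsupport g ⊆ Metric.ball 0 R) (hcs : HasCompactSupport g)
    {M : ℝ} (hM : ∀ x, |g x| ≤ M) :
    Integrable (fun x : E2 => x 0 * (‖x‖ + ‖x‖^2)⁻¹ * fderiv ℝ g x (EuclideanSpace.single 0 1)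
      + x 1 * (‖x‖ + ‖x‖^2)⁻¹ * fderiv ℝ g x (EuclideanSpace.single 1 1)
      + ‖x‖⁻¹ * ((1 + ‖x‖)^2)⁻¹ * g x) ∧
    ∫ x : E2, (x 0 * (‖x‖ + ‖x‖^2)⁻¹ * fderiv ℝ g x (EuclideanSpace.single 0 1)
      + x 1 * (‖x‖ + ‖x‖^2)⁻¹ * fderiv ℝ g x (EuclideanSpace.single 1 1)
      + ‖x‖⁻¹ * ((1 + ‖x‖)^2)⁻¹ * g x) = 0 := by
  obtain ⟨a0, b0, c0⟩ := ibp_sing hg hR hs hcs hM 0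
  obtain ⟨a1, b1, c1⟩ := ibp_sing hg hR hs hcs hM 1
  have e : (fun x : E2 => ‖x‖⁻¹ * ((1 + ‖x‖)^2)⁻¹ * g x) =ᵐ[volume] fun x =>
      ((‖x‖ + ‖x‖^2)⁻¹ - (x 0)^2 * (‖x‖⁻¹ + 2) * ((‖x‖ + ‖x‖^2)⁻¹)^2) * g x +
      ((‖x‖ + ‖x‖^2)⁻¹ - (x 1)^2 * (‖x‖⁻¹ + 2) * ((‖x‖ + ‖x‖^2)⁻¹)^2) * g x := by
    filter_upwards [ae_ne_zero] with x hx
    have hr : 0 < ‖x‖ := norm_pos_iff.2 hx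
    have h : (x 1)^2 = ‖x‖^2 - (x 0)^2 := by
      rw [EuclideanSpace.norm_sq_eq]; simp [Fin.sum_univ_two]
    rw [h]
    field_simp
    ring
  have hd := (b0.add b1).congr e.symm
  refine ⟨(a0.add a1).add hd, ?_⟩
  have := integral_add (a0.add a1) hd
  simp only [Pi.add_apply] at this
  rw [this, integral_add a0 a1, integral_congr_ae e, integral_add b0 b1, c0, c1]
  ring

lemma hasFDerivAt_norm' {x : E2} (hx : x ≠ 0) :
    HasFDerivAt (fun y : E2 => ‖y‖) (‖x‖⁻¹ • innerSL ℝ x) x := by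
  have h := (hasStrictFDerivAt_norm_sq x).hasFDerivAt.sqrt (by simpa using hx)
  simp only [norm_nonneg, Real.sqrt_sq] at h
  have e : (1 / (2 * ‖x‖)) • 2 • innerSL ℝ x = ‖x‖⁻¹ • innerSL ℝ x := by
    ext v
    simp
    ring
  rwa [e] at h

lemma pointwise_one {ψ : E2 → ℂ} {x : E2} (hx : x ≠ 0) (hd : DifferentiableAt ℝ ψ x) (α : ℝ)
    (i : Fin 2) :
    (1 + ‖x‖) ^ (-(2 * α)) * ‖fderiv ℝ (fun y => ((1 + ‖y‖) ^ α : ℝ) • ψ y) x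
              (EuclideanSpace.single i 1)‖ ^ 2 =
    ‖fderiv ℝ ψ x (EuclideanSpace.single i 1)‖^2 +
      α * (x i * (‖x‖ + ‖x‖^2)⁻¹ * fderiv ℝ (fun y => ‖ψ y‖^2) x (EuclideanSpace.single i 1))
      + α^2 * (x i)^2 * ((‖x‖ + ‖x‖^2)⁻¹)^2 * ‖ψ x‖^2 := by
  have hr : 0 < ‖x‖ := norm_pos_iff.2 hx
  have hw : 0 < 1 + ‖x‖ := by linarith
  have h1 := ((hasFDerivAt_norm' hx).const_add 1).rpow_const (p := α) (Or.inl hw.ne')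
  have h2 := h1.smul hd.hasFDerivAt
  have h3 : fderiv ℝ (fun y => ((1 + ‖y‖) ^ α : ℝ) • ψ y) x (EuclideanSpace.single i 1) =
      ((1 + ‖x‖) ^ α : ℝ) • (fderiv ℝ ψ x (EuclideanSpace.single i 1)
        + (α * (x i * (‖x‖ + ‖x‖^2)⁻¹)) • ψ x) := by
    have h2' : HasFDerivAt (fun y => ((1 + ‖y‖) ^ α : ℝ) • ψ y) _ x := h2
    rw [h2'.fderiv, smul_add]
    simp only [add_apply, smul_apply,
      ContinuousLinearMap.smulRight_apply, innerSL_apply_apply,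
      EuclideanSpace.inner_single_right, smul_eq_mul]
    rw [smul_smul]
    congr 2
    rw [Real.rpow_sub_one hw.ne']
    simp
    field_simp
  have h4 : fderiv ℝ (fun y => ‖ψ y‖^2) x (EuclideanSpace.single i 1) =
      2 * inner ℝ (fderiv ℝ ψ x (EuclideanSpace.single i 1)) (ψ x) := by
    have : HasFDerivAt (fun y => ‖ψ y‖^2) _ x := hd.hasFDerivAt.norm_sq
    rw [this.fderiv, real_inner_comm]
    simp
    ring
  have h5 : (1 + ‖x‖) ^ (-(2 * α)) * ((1 + ‖x‖) ^ α)^2 = 1 := by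
    rw [← Real.rpow_natCast, ← Real.rpow_mul hw.le, ← Real.rpow_add hw]
    simp [mul_comm]
  rw [h3, h4, norm_smul, mul_pow, ← mul_assoc, Real.norm_eq_abs, sq_abs, h5, one_mul,
    norm_add_sq_real, norm_smul, inner_smul_right, mul_pow, Real.norm_eq_abs, sq_abs]
  ring

end helpers

/-- Integration-by-parts identity from the proof of Proposition 4.1: for `α ≥ 0` and a
compactly supported Lipschitz function `ψ` on `ℝ²`,
`∫ (1+|x|)^{-2α} |∇((1+|x|)^α ψ)|² dx = ∫ (|∇ψ|² - α(1+|x|)^{-2}(|x|^{-1}-α)|ψ|²) dx`. -/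
theorem weighted_dirichlet_identity
    (α : ℝ) (hα : 0 ≤ α)
    (ψ : EuclideanSpace ℝ (Fin 2) → ℂ) (K : NNReal)
    (hψ : LipschitzWith K ψ) (hsupp : HasCompactSupport ψ) :
    ∫ x : EuclideanSpace ℝ (Fin 2),
        (1 + ‖x‖) ^ (-(2 * α)) *
          (‖fderiv ℝ (fun y => ((1 + ‖y‖) ^ α : ℝ) • ψ y) x
              (EuclideanSpace.single 0 1)‖ ^ 2 +
            ‖fderiv ℝ (fun y => ((1 + ‖y‖) ^ α : ℝ) • ψ y) x
              (EuclideanSpace.single 1 1)‖ ^ 2) =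
      ∫ x : EuclideanSpace ℝ (Fin 2),
        ((‖fderiv ℝ ψ x (EuclideanSpace.single 0 1)‖ ^ 2 +
            ‖fderiv ℝ ψ x (EuclideanSpace.single 1 1)‖ ^ 2) -
          α * ((1 + ‖x‖) ^ 2)⁻¹ * (‖x‖⁻¹ - α) * ‖ψ x‖ ^ 2) := by
  obtain ⟨R, hR, hs⟩ : ∃ R : ℝ, 0 < R ∧ tsupport ψ ⊆ Metric.ball 0 R :=
    hsupp.isCompact.isBounded.subset_ball_lt 0 0
  obtain ⟨M, hM⟩ : ∃ M : ℝ, ∀ x, ‖ψ x‖ ≤ M :=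
    hsupp.exists_bound_of_continuous hψ.continuous
  have hM0 : 0 ≤ M := (norm_nonneg _).trans (hM 0)
  have hgts : tsupport (fun x => ‖ψ x‖ ^ 2) ⊆ tsupport ψ := by
    apply closure_mono
    intro x hx
    simpa using hx
  have hgcs : HasCompactSupport (fun x => ‖ψ x‖ ^ 2) :=
    hsupp.of_isClosed_subset isClosed_closure hgts
  have hgl : LipschitzWith (2 * M.toNNReal * K) (fun x => ‖ψ x‖ ^ 2) := by
    apply LipschitzWith.of_dist_le_mul
    intro x y
    have h1 : |‖ψ x‖ - ‖ψ y‖| ≤ K * dist x y :=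
      (abs_norm_sub_norm_le _ _).trans (by simpa [dist_eq_norm] using hψ.dist_le_mul x y)
    have h2 : |‖ψ x‖ + ‖ψ y‖| ≤ 2 * M := by
      rw [abs_of_nonneg (by positivity)]; linarith [hM x, hM y]
    have e : ‖ψ x‖ ^ 2 - ‖ψ y‖ ^ 2 = (‖ψ x‖ + ‖ψ y‖) * (‖ψ x‖ - ‖ψ y‖) := by ring
    rw [Real.dist_eq, e, abs_mul]
    push_cast
    rw [Real.coe_toNNReal _ hM0, mul_assoc (2 * M)]
    gcongr
  obtain ⟨hki, hk0⟩ := key_ibp hgl hR (hgts.trans hs) hgcs (M := M ^ 2) (fun x => by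
    rw [abs_of_nonneg (by positivity)]
    have := hM x
    gcongr)
  have hmψ : Measurable ψ := hψ.continuous.measurable
  have hm : ∀ v, Measurable (fun x => fderiv ℝ ψ x v) := fun v =>
    measurable_fderiv_apply_const ℝ ψ v
  have hint : Integrable (fun x : EuclideanSpace ℝ (Fin 2) =>
      ((‖fderiv ℝ ψ x (EuclideanSpace.single 0 1)‖ ^ 2 +
            ‖fderiv ℝ ψ x (EuclideanSpace.single 1 1)‖ ^ 2) -
          α * ((1 + ‖x‖) ^ 2)⁻¹ * (‖x‖⁻¹ - α) * ‖ψ x‖ ^ 2)) := by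
    refine integrable_of_bd (R := R) (c := 2 * (K : ℝ) ^ 2 + (α + α ^ 2) * M ^ 2) ?_ ?_
    · apply Measurable.aestronglyMeasurable
      have h0 := hm (EuclideanSpace.single 0 1)
      have h1 := hm (EuclideanSpace.single 1 1)
      fun_prop
    · refine Filter.Eventually.of_forall fun x => ?_
      by_cases hb : x ∈ Metric.ball (0 : EuclideanSpace ℝ (Fin 2)) R
      · rw [Set.indicator_of_mem hb]
        have hd : ∀ i : Fin 2, ‖fderiv ℝ ψ x (EuclideanSpace.single i 1)‖ ^ 2 ≤ (K : ℝ) ^ 2 := by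
          intro i
          have := (fderiv ℝ ψ x).le_of_opNorm_le (norm_fderiv_le_of_lipschitz ℝ hψ)
            (EuclideanSpace.single i 1)
          have h' : ‖fderiv ℝ ψ x (EuclideanSpace.single i 1)‖ ≤ K := by simpa using this
          gcongr
        have hi : 0 ≤ ‖x‖⁻¹ := by positivity
        have hψ2 : ‖ψ x‖ ^ 2 ≤ M ^ 2 := by
          have := hM x
          gcongr
        have hw0 : 0 ≤ ((1 + ‖x‖) ^ 2)⁻¹ := by positivity
        have hw1 : ((1 + ‖x‖) ^ 2)⁻¹ ≤ 1 := inv_le_one_of_one_le₀ (by nlinarith [norm_nonneg x])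
        have hd2 : |α * ((1 + ‖x‖) ^ 2)⁻¹ * (‖x‖⁻¹ - α) * ‖ψ x‖ ^ 2| ≤
            α * 1 * (‖x‖⁻¹ + α) * M ^ 2 := by
          rw [abs_mul, abs_mul, abs_mul, abs_of_nonneg hα, abs_of_nonneg hw0,
            abs_of_nonneg (sq_nonneg ‖ψ x‖)]
          have : |‖x‖⁻¹ - α| ≤ ‖x‖⁻¹ + α := by
            rw [abs_le]; constructor <;> linarith
          gcongr
        have h0 := hd 0
        have h1 := hd 1
        have hA : |‖fderiv ℝ ψ x (EuclideanSpace.single 0 1)‖ ^ 2 +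
            ‖fderiv ℝ ψ x (EuclideanSpace.single 1 1)‖ ^ 2| ≤ 2 * (K : ℝ) ^ 2 := by
          rw [abs_of_nonneg (by positivity)]; linarith
        rw [Real.norm_eq_abs]
        refine (abs_sub _ _).trans ((add_le_add hA hd2).trans ?_)
        have p1 : 0 ≤ 2 * (K : ℝ) ^ 2 * ‖x‖⁻¹ := by positivity
        have p2 : 0 ≤ α * M ^ 2 := by positivity
        have p3 : 0 ≤ α ^ 2 * M ^ 2 * ‖x‖⁻¹ := by positivity
        nlinarith
      · rw [Set.indicator_of_notMem hb]
        rw [fderiv_of_notMem_tsupport ℝ (fun h => hb (hs h)),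
          image_eq_zero_of_notMem_tsupport (fun h => hb (hs h))]
        simp
  have hae : (fun x : EuclideanSpace ℝ (Fin 2) => (1 + ‖x‖) ^ (-(2 * α)) *
          (‖fderiv ℝ (fun y => ((1 + ‖y‖) ^ α : ℝ) • ψ y) x
              (EuclideanSpace.single 0 1)‖ ^ 2 +
            ‖fderiv ℝ (fun y => ((1 + ‖y‖) ^ α : ℝ) • ψ y) x
              (EuclideanSpace.single 1 1)‖ ^ 2)) =ᵐ[volume] fun x =>
      ((‖fderiv ℝ ψ x (EuclideanSpace.single 0 1)‖ ^ 2 +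
            ‖fderiv ℝ ψ x (EuclideanSpace.single 1 1)‖ ^ 2) -
          α * ((1 + ‖x‖) ^ 2)⁻¹ * (‖x‖⁻¹ - α) * ‖ψ x‖ ^ 2) +
      α * (x 0 * (‖x‖ + ‖x‖ ^ 2)⁻¹ *
          fderiv ℝ (fun y => ‖ψ y‖ ^ 2) x (EuclideanSpace.single 0 1)
        + x 1 * (‖x‖ + ‖x‖ ^ 2)⁻¹ *
          fderiv ℝ (fun y => ‖ψ y‖ ^ 2) x (EuclideanSpace.single 1 1)
        + ‖x‖⁻¹ * ((1 + ‖x‖) ^ 2)⁻¹ * ‖ψ x‖ ^ 2) := by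
    filter_upwards [ae_ne_zero, hψ.ae_differentiableAt] with x hx hd
    rw [mul_add, pointwise_one hx hd, pointwise_one hx hd]
    have hr : 0 < ‖x‖ := norm_pos_iff.2 hx
    have h : (x 1) ^ 2 = ‖x‖ ^ 2 - (x 0) ^ 2 := by
      rw [EuclideanSpace.norm_sq_eq]; simp [Fin.sum_univ_two]
    rw [h]
    field_simp
    ring
  rw [integral_congr_ae hae, integral_add hint (hki.const_mul α), integral_const_mul, hk0]
  simp
end

section
/- Let 0 < α < 1. Then for all r > 0 one has 1 + α (1+r)^{-2} r (1 - α r) ≤ (5α+4)/(4(α+1)), with equality at r = 1/(2α+1). In particular, sup_{r>0} ( 1 + α (1+r)^{-2} r (1 - α r) ) = (5α+4)/(4(α+1)) ≤ 9/8. -/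
open Set

/-- Elementary optimization from the proof of Proposition 4.1: for `0 < α < 1`,
`sup_{r>0} (1 + α(1+r)^{-2} r (1-αr)) = (5α+4)/(4(α+1)) ≤ 9/8`, the supremum being
attained at `r = 1/(2α+1)`. -/
theorem sup_interpolation_function
    (α : ℝ) (hα0 : 0 < α) (hα1 : α < 1) :
    (∀ r : ℝ, 0 < r →
        1 + α * ((1 + r) ^ 2)⁻¹ * r * (1 - α * r) ≤ (5 * α + 4) / (4 * (α + 1))) ∧
    (1 + α * ((1 + 1 / (2 * α + 1)) ^ 2)⁻¹ * (1 / (2 * α + 1)) *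
        (1 - α * (1 / (2 * α + 1))) = (5 * α + 4) / (4 * (α + 1))) ∧
    IsGreatest ((fun r : ℝ => 1 + α * ((1 + r) ^ 2)⁻¹ * r * (1 - α * r)) '' Ioi 0)
      ((5 * α + 4) / (4 * (α + 1))) ∧
    (5 * α + 4) / (4 * (α + 1)) ≤ 9 / 8 := by
  have h1 : ∀ r : ℝ, 0 < r →
      1 + α * ((1 + r) ^ 2)⁻¹ * r * (1 - α * r) ≤ (5 * α + 4) / (4 * (α + 1)) := by
    intro r hr
    have ha : α + 1 ≠ 0 := by positivity
    have hb : 1 + r ≠ 0 := by positivity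
    have key : (5 * α + 4) / (4 * (α + 1)) - (1 + α * ((1 + r) ^ 2)⁻¹ * r * (1 - α * r))
        = α * (1 - (2 * α + 1) * r) ^ 2 / (4 * (α + 1) * (1 + r) ^ 2) := by
      field_simp
      ring
    have hn : 0 ≤ α * (1 - (2 * α + 1) * r) ^ 2 / (4 * (α + 1) * (1 + r) ^ 2) := by
      positivity
    linarith
  have h2 : 1 + α * ((1 + 1 / (2 * α + 1)) ^ 2)⁻¹ * (1 / (2 * α + 1)) *
        (1 - α * (1 / (2 * α + 1))) = (5 * α + 4) / (4 * (α + 1)) := by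
    have ha : α + 1 ≠ 0 := by positivity
    have hs : 2 * α + 1 ≠ 0 := by positivity
    have e : 1 + 1 / (2 * α + 1) = 2 * (α + 1) / (2 * α + 1) := by
      field_simp
      ring
    rw [e]
    field_simp
    ring
  refine ⟨h1, h2, ⟨⟨1 / (2 * α + 1), ?_, h2⟩, ?_⟩, ?_⟩
  · show 0 < 1 / (2 * α + 1)
    positivity
  · rintro _ ⟨r, hr, rfl⟩
    exact h1 r hr
  · rw [div_le_div_iff₀ (by positivity) (by norm_num)]
    linarith
end

section
/- Let B : ℝ² → ℝ be measurable with ∫_{ℝ²} |B(x)| (1 + ln₊|x|) dx < ∞, and suppose that for some p > 1 one has sup_{x∈ℝ²} ∫_{|y-x|<1} |B(y)|^p dy < ∞. Define α = (2π)^{-1} ∫_{ℝ²} B(x) dx and h(x) = (2π)^{-1} ∫_{ℝ²} B(y) ln|x-y| dy. Then the function x ↦ h(x) - α ln(1+|x|) is bounded on ℝ², i.e., sup_{x∈ℝ²} |h(x) - α ln(1+|x|)| < ∞. -/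
open MeasureTheory Real

theorem aux_log (a : ℝ) (ha : 0 ≤ a) : Real.log (1 + a) ≤ Real.log 2 + max (Real.log a) 0 := by
  rcases le_total a 1 with h | h
  · have : Real.log (1 + a) ≤ Real.log 2 := Real.log_le_log (by linarith) (by linarith)
    linarith [le_max_right (Real.log a) 0]
  · have h1 : Real.log (1 + a) ≤ Real.log (2 * a) := Real.log_le_log (by linarith) (by linarith)
    rw [Real.log_mul (by norm_num) (by linarith)] at h1
    linarith [le_max_left (Real.log a) 0]

/-- Pointwise bound on the kernel. Here `s = |x|`, `a = |y|`, `d = |x-y|`. -/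
theorem aux_kernel (s a d : ℝ) (hs : 0 ≤ s) (ha : 0 ≤ a) (hd : 0 ≤ d)
    (h1 : d ≤ s + a) (h2 : s ≤ d + a) :
    |Real.log d - Real.log (1 + s)| ≤
      2 * (1 + max (Real.log a) 0) + (if d < 1 then |Real.log d| else 0) := by
  have l2 := Real.log_two_lt_d9
  have l20 : 0 < Real.log 2 := Real.log_pos (by norm_num)
  have hA := aux_log a ha
  have hm := le_max_right (Real.log a) 0
  have hs0 : 0 ≤ Real.log (1 + s) := Real.log_nonneg (by linarith)
  split_ifs with hd1
  · have h3 : Real.log (1 + s) ≤ Real.log (2 * (1 + a)) :=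
      Real.log_le_log (by linarith) (by linarith)
    rw [Real.log_mul (by norm_num) (by linarith)] at h3
    have := abs_sub (Real.log d) (Real.log (1 + s))
    rw [abs_of_nonneg hs0] at this
    linarith
  · push Not at hd1
    have h3 : Real.log (1 + s) ≤ Real.log (2 * d * (1 + a)) :=
      Real.log_le_log (by linarith) (by nlinarith)
    rw [Real.log_mul (by linarith) (by linarith), Real.log_mul (by norm_num) (by linarith)] at h3
    have h4 : Real.log d ≤ Real.log ((1 + s) * (1 + a)) :=
      Real.log_le_log (by linarith) (by nlinarith)
    rw [Real.log_mul (by linarith) (by linarith)] at h4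
    rw [abs_le]
    constructor <;> linarith

theorem aux_young (b d p q : ℝ) (hpq : p.HolderConjugate q) (hb : 0 ≤ b) (hd : 0 ≤ d)
    (hd1 : d < 1) : b * |Real.log d| ≤ b ^ p + q ^ q * d⁻¹ := by
  have hq := hpq.symm.lt
  have hp := hpq.lt
  have hy := Real.young_inequality_of_nonneg hb (abs_nonneg (Real.log d)) hpq
  have e1 : b ^ p / p ≤ b ^ p := div_le_self (by positivity) hp.le
  have e2 : |Real.log d| ^ q / q ≤ |Real.log d| ^ q := div_le_self (by positivity) hq.le
  have e3 : |Real.log d| ^ q ≤ q ^ q * d⁻¹ := by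
    rcases hd.eq_or_lt with h | h
    · subst h
      simp [Real.zero_rpow (by linarith : q ≠ 0)]
    · have h5 := Real.abs_log_mul_self_rpow_lt d (1 / q) h hd1.le (by positivity)
      rw [abs_mul, abs_of_pos (Real.rpow_pos_of_pos h _), one_div_one_div] at h5
      have h6 : (|Real.log d| * d ^ (1 / q)) ^ q ≤ q ^ q :=
        Real.rpow_le_rpow (by positivity) h5.le (by linarith)
      rw [Real.mul_rpow (by positivity) (by positivity), ← Real.rpow_mul hd,
        one_div_mul_cancel (by linarith), Real.rpow_one] at h6
      rw [← div_eq_mul_inv, le_div_iff₀ h]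
      exact h6
  linarith

theorem aux_int : Integrable (fun z : EuclideanSpace ℝ (Fin 2) =>
    (if ‖z‖ < 1 then ‖z‖⁻¹ else 0)) volume := by
  have := (integrable_fun_norm_addHaar (E := EuclideanSpace ℝ (Fin 2)) volume
    (f := fun t : ℝ => if t < 1 then t⁻¹ else 0)).2 ?_
  · exact this
  · have h : IntegrableOn (Set.indicator (Set.Ioo (0:ℝ) 1) (fun _ => (1:ℝ))) (Set.Ioi 0) := by
      apply Integrable.integrableOn
      rw [integrable_indicator_iff measurableSet_Ioo]
      simp
    refine h.congr_fun ?_ measurableSet_Ioi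
    intro t ht
    have ht' : (0:ℝ) < t := ht
    simp only [Set.indicator, Set.mem_Ioo, finrank_euclideanSpace, Fintype.card_fin, ht', true_and]
    split_ifs
    · simp [ht'.ne']
    · simp

/-- Lemma A.2: under the stated integrability assumptions on `B`, the logarithmic
potential `h(x) = (2π)⁻¹ ∫ B(y) ln|x-y| dy` satisfies
`sup_x |h(x) - α ln(1+|x|)| < ∞` with `α = (2π)⁻¹ ∫ B`. -/
theorem log_potential_bounded
    (B : EuclideanSpace ℝ (Fin 2) → ℝ) (hB : Measurable B)
    (hB1 : Integrable (fun x : EuclideanSpace ℝ (Fin 2) =>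
      |B x| * (1 + max (Real.log ‖x‖) 0)) volume)
    (p : ℝ) (hp : 1 < p)
    (hBp : (⨆ x : EuclideanSpace ℝ (Fin 2),
        ∫⁻ y in Metric.ball x 1, ENNReal.ofReal (|B y| ^ p)) < ⊤) :
    ∃ C : ℝ, ∀ x : EuclideanSpace ℝ (Fin 2),
      |(2 * Real.pi)⁻¹ * (∫ y, B y * Real.log ‖x - y‖) -
          ((2 * Real.pi)⁻¹ * ∫ y, B y) * Real.log (1 + ‖x‖)| ≤ C := by
  obtain ⟨q, hpq⟩ : ∃ q, p.HolderConjugate q := ⟨_, Real.HolderConjugate.conjExponent hp⟩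
  set S := (⨆ x : EuclideanSpace ℝ (Fin 2),
        ∫⁻ y in Metric.ball x 1, ENNReal.ofReal (|B y| ^ p)) with hS
  have hBi : Integrable B volume := by
    refine hB1.mono' hB.aestronglyMeasurable (Filter.Eventually.of_forall fun y => ?_)
    rw [Real.norm_eq_abs]
    nlinarith [abs_nonneg (B y), le_max_right (Real.log ‖y‖) 0]
  let g : EuclideanSpace ℝ (Fin 2) → ℝ := fun z => if ‖z‖ < 1 then ‖z‖⁻¹ else 0
  have hmeas : Measurable fun y => |B y| ^ p := hB.abs.pow_const p
  have hSx : ∀ x, ∫⁻ y in Metric.ball x 1, ENNReal.ofReal (|B y| ^ p) ≤ S := fun x =>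
    le_iSup (fun x : EuclideanSpace ℝ (Fin 2) =>
        ∫⁻ y in Metric.ball x 1, ENNReal.ofReal (|B y| ^ p)) x
  have hIp : ∀ x, IntegrableOn (fun y => |B y| ^ p) (Metric.ball x 1) := by
    intro x
    refine ⟨hmeas.aestronglyMeasurable, ?_⟩
    rw [hasFiniteIntegral_iff_ofReal (Filter.Eventually.of_forall fun y => by positivity)]
    exact (hSx x).trans_lt hBp
  have hIpb : ∀ x, ∫ y in Metric.ball x 1, |B y| ^ p ≤ S.toReal := by
    intro x
    rw [integral_eq_lintegral_of_nonneg_ae (Filter.Eventually.of_forall fun y => by positivity)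
      hmeas.aestronglyMeasurable]
    exact ENNReal.toReal_mono hBp.ne (hSx x)
  refine ⟨(2 * Real.pi)⁻¹ * (2 * (∫ y, |B y| * (1 + max (Real.log ‖y‖) 0)) +
    (S.toReal + q ^ q * ∫ z, g z)), fun x => ?_⟩
  let F : EuclideanSpace ℝ (Fin 2) → ℝ := fun y => 2 * (|B y| * (1 + max (Real.log ‖y‖) 0)) +
    ((Metric.ball x 1).indicator (fun y => |B y| ^ p) y + q ^ q * g (x - y))
  have hg : Integrable (fun y => g (x - y)) := aux_int.comp_sub_left x
  have hi1 : Integrable ((Metric.ball x 1).indicator (fun y => |B y| ^ p)) :=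
    (integrable_indicator_iff Metric.isOpen_ball.measurableSet).2 (hIp x)
  have hF : Integrable F := (hB1.const_mul 2).add (hi1.add (hg.const_mul _))
  have hbound : ∀ y, ‖B y * (Real.log ‖x - y‖ - Real.log (1 + ‖x‖))‖ ≤ F y := by
    intro y
    rw [norm_mul, Real.norm_eq_abs, Real.norm_eq_abs]
    have h1 := aux_kernel ‖x‖ ‖y‖ ‖x - y‖ (norm_nonneg _) (norm_nonneg _) (norm_nonneg _)
      (norm_sub_le x y) (by simpa using norm_add_le (x - y) y)
    have h2 := mul_le_mul_of_nonneg_left h1 (abs_nonneg (B y))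
    refine h2.trans ?_
    simp only [F, g, Set.indicator, Metric.mem_ball, dist_eq_norm, norm_sub_rev y x]
    split_ifs with hd
    · have := aux_young |B y| ‖x - y‖ p q hpq (abs_nonneg _) (norm_nonneg _) hd
      linarith
    · linarith
  have hD : Integrable (fun y => B y * (Real.log ‖x - y‖ - Real.log (1 + ‖x‖))) := by
    refine hF.mono' (Measurable.aestronglyMeasurable ?_) (Filter.Eventually.of_forall hbound)
    fun_prop
  have hsplit : ∫ y, B y * Real.log ‖x - y‖ =
      (∫ y, B y * (Real.log ‖x - y‖ - Real.log (1 + ‖x‖))) +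
        (∫ y, B y) * Real.log (1 + ‖x‖) := by
    rw [← integral_mul_const, ← integral_add hD (hBi.mul_const _)]
    congr 1
    ext y
    ring
  have hfin := norm_integral_le_of_norm_le hF (Filter.Eventually.of_forall hbound)
  have hFi : ∫ y, F y = 2 * (∫ y, |B y| * (1 + max (Real.log ‖y‖) 0)) +
      ((∫ y in Metric.ball x 1, |B y| ^ p) + q ^ q * ∫ z, g z) := by
    have hj : Integrable (fun y => (Metric.ball x 1).indicator (fun y => |B y| ^ p) y +
        q ^ q * g (x - y)) := hi1.add (hg.const_mul _)
    simp only [F]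
    rw [integral_add (hB1.const_mul 2) hj, integral_const_mul,
      integral_add hi1 (hg.const_mul _), integral_const_mul,
      integral_indicator Metric.isOpen_ball.measurableSet, integral_sub_left_eq_self g volume x]
  rw [hsplit]
  have : ∀ c u v w : ℝ, c * (u + v * w) - c * v * w = c * u := by intros; ring
  rw [this, abs_mul, abs_of_pos (by positivity : (0:ℝ) < (2 * Real.pi)⁻¹)]
  refine mul_le_mul_of_nonneg_left ?_ (by positivity)
  rw [Real.norm_eq_abs] at hfin
  linarith [hIpb x]
end

section
/- For every α ∈ (0,1) there exists a constant C_α > 0 with the following property. Let v : (0,∞) → ℝ be measurable with ∫₀^∞ v(r)₋^{1+α} r dr < ∞ and ∫₀^∞ v(r)₋ (1+r)^{-2α} r dr < ∞, where v₋ = max(-v, 0). Then for every locally absolutely continuous function φ : (0,∞) → ℂ for which the integrals below are finite, one has ∫₀^∞ (1+r)^{-2α} |φ'(r)|² r dr + ∫₀^∞ v(r) |φ(r)|² (1+r)^{-2α} r dr ≥ - ( C_α ( ∫₀^∞ v(r)₋^{1+α} r dr + ∫₀^∞ v(r)₋ (1+r)^{-2α} r dr ) )^{1/α} · ∫₀^∞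 |φ(r)|² (1+r)^{-2α} r dr. -/
open MeasureTheory Real Set

lemma cs_bound (w G : ℝ → ℝ) (φ φ' : ℝ → ℂ) (a b P : ℝ) (ha : 0 < a) (hab : a ≤ b)
    (hw : ∀ t, 0 < t → 0 < w t)
    (hφ' : IntervalIntegrable φ' volume a b) (hφ : φ b - φ a = ∫ t in a..b, φ' t)
    (hD : IntegrableOn (fun r => w r * ‖φ' r‖ ^ 2) (Ioi 0) volume)
    (hG : IntervalIntegrable G volume a b) (hGw : ∀ t ∈ Icc a b, 1 ≤ G t * w t)
    (hP : ∫ t in a..b, G t ≤ P) (hP0 : 0 < P) :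
    ‖φ b - φ a‖ ^ 2 ≤ P * ∫ r in Ioi (0:ℝ), w r * ‖φ' r‖ ^ 2 := by
  have hnn : ∀ t ∈ Ioi (0:ℝ), 0 ≤ w t * ‖φ' t‖ ^ 2 := fun t ht =>
    mul_nonneg (hw t ht).le (by positivity)
  have hD0 : 0 ≤ ∫ r in Ioi (0:ℝ), w r * ‖φ' r‖ ^ 2 :=
    setIntegral_nonneg measurableSet_Ioi hnn
  have hsub : Ioc a b ⊆ Ioi 0 := fun t ht => lt_trans ha ht.1
  have hDab : IntervalIntegrable (fun r => w r * ‖φ' r‖ ^ 2) volume a b := by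
    rw [intervalIntegrable_iff_integrableOn_Ioc_of_le hab]
    exact hD.mono_set hsub
  have hDle : ∫ t in a..b, w t * ‖φ' t‖ ^ 2 ≤ ∫ r in Ioi (0:ℝ), w r * ‖φ' r‖ ^ 2 := by
    rw [intervalIntegral.integral_of_le hab]
    apply setIntegral_mono_set hD _ hsub.eventuallyLE
    exact (ae_restrict_iff' measurableSet_Ioi).2 (Filter.Eventually.of_forall hnn)
  set D := ∫ r in Ioi (0:ℝ), w r * ‖φ' r‖ ^ 2
  have hA : ‖φ b - φ a‖ ≤ ∫ t in a..b, ‖φ' t‖ := by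
    rw [hφ]; exact intervalIntegral.norm_integral_le_integral_norm hab
  set A := ‖φ b - φ a‖ with hAdef
  rcases (norm_nonneg (φ b - φ a)).eq_or_lt with h0 | h0
  · rw [← hAdef] at h0
    rw [← h0]; simp; positivity
  rw [← hAdef] at h0
  have hl : 0 < A / P := by positivity
  have h1 : ∫ t in a..b, ‖φ' t‖ ≤
      ∫ t in a..b, ((A / P / 2) * G t + (1 / (2 * (A / P))) * (w t * ‖φ' t‖ ^ 2)) := by
    apply intervalIntegral.integral_mono_on hab hφ'.norm
      ((hG.const_mul _).add (hDab.const_mul _))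
    intro t ht
    have hwt := hw t (lt_of_lt_of_le ha ht.1)
    have hg := hGw t ht
    have hg0 : 0 < G t := by
      by_contra hc
      nlinarith
    generalize A / P = l at *
    have e : l / 2 * G t + 1 / (2 * l) * (w t * ‖φ' t‖ ^ 2)
       = (l * G t + (w t * ‖φ' t‖ ^ 2) / l) / 2 := by field_simp
    rw [e, le_div_iff₀ (by norm_num)]
    apply abs_le_of_sq_le_sq' _ (by positivity) |>.2
    have e2 : ‖φ' t‖ ^ 2 ≤ (l * G t) * (w t * ‖φ' t‖ ^ 2 / l) := by
      have : (l * G t) * (w t * ‖φ' t‖ ^ 2 / l) = (G t * w t) * ‖φ' t‖ ^ 2 := by field_simp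
      rw [this]
      nlinarith [sq_nonneg ‖φ' t‖]
    nlinarith [sq_nonneg (l * G t - w t * ‖φ' t‖ ^ 2 / l)]
  rw [intervalIntegral.integral_add (hG.const_mul _) (hDab.const_mul _),
    intervalIntegral.integral_const_mul, intervalIntegral.integral_const_mul] at h1
  have h2 : A ≤ (A / P / 2) * P + (1 / (2 * (A / P))) * D := by
    refine hA.trans (h1.trans ?_)
    gcongr
  have h3 : (A / P / 2) * P + (1 / (2 * (A / P))) * D = (A + P * D / A) / 2 := by
    field_simp
  rw [h3, le_div_iff₀ (by norm_num)] at h2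
  have h4 : A ≤ P * D / A := by linarith
  rw [le_div_iff₀ h0] at h4
  nlinarith

lemma avg_bound (w G : ℝ → ℝ) (φ φ' : ℝ → ℂ) (r a L P Q : ℝ) (hr : 0 < r) (hra : r ≤ a)
    (hL : 0 < L) (hQ : 0 < Q)
    (hw : ∀ t, 0 < t → 0 < w t)
    (hφ : ∀ a b : ℝ, 0 < a → a ≤ b →
            IntervalIntegrable φ' volume a b ∧ φ b - φ a = ∫ t in a..b, φ' t)
    (hD : IntegrableOn (fun r => w r * ‖φ' r‖ ^ 2) (Ioi 0) volume)
    (hM : IntegrableOn (fun r => w r * ‖φ r‖ ^ 2) (Ioi 0) volume)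
    (hG : IntervalIntegrable G volume r (a + L)) (hGw : ∀ t ∈ Icc r (a + L), 1 ≤ G t * w t)
    (hP : ∫ t in r..(a + L), G t ≤ P) (hP0 : 0 < P)
    (hQw : ∀ t ∈ Icc a (a + L), 1 ≤ Q * w t) :
    ‖φ r‖ ^ 2 ≤ 2 * P * (∫ r in Ioi (0:ℝ), w r * ‖φ' r‖ ^ 2) +
      2 * Q / L * (∫ r in Ioi (0:ℝ), w r * ‖φ r‖ ^ 2) := by
  have hnn : ∀ t ∈ Ioi (0:ℝ), 0 ≤ w t * ‖φ t‖ ^ 2 := fun t ht =>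
    mul_nonneg (hw t ht).le (by positivity)
  have hab : a ≤ a + L := by linarith
  have hsub : Ioc a (a + L) ⊆ Ioi 0 := fun t ht => lt_trans (hr.trans_le hra) ht.1
  have hMab : IntervalIntegrable (fun r => w r * ‖φ r‖ ^ 2) volume a (a + L) := by
    rw [intervalIntegrable_iff_integrableOn_Ioc_of_le hab]
    exact hM.mono_set hsub
  have hMle : ∫ t in a..(a + L), w t * ‖φ t‖ ^ 2 ≤ ∫ r in Ioi (0:ℝ), w r * ‖φ r‖ ^ 2 := by
    rw [intervalIntegral.integral_of_le hab]
    apply setIntegral_mono_set hM _ hsub.eventuallyLE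
    exact (ae_restrict_iff' measurableSet_Ioi).2 (Filter.Eventually.of_forall hnn)
  set D := ∫ r in Ioi (0:ℝ), w r * ‖φ' r‖ ^ 2 with hDdef
  set M := ∫ r in Ioi (0:ℝ), w r * ‖φ r‖ ^ 2
  have key : ∫ t in a..(a + L), (‖φ r‖ ^ 2 / 2 - P * D) ≤
      ∫ t in a..(a + L), Q * (w t * ‖φ t‖ ^ 2) := by
    apply intervalIntegral.integral_mono_on hab (by simp) (hMab.const_mul _)
    intro s hs
    have hrs : r ≤ s := hra.trans hs.1
    have hsubs : Icc r s ⊆ Icc r (a + L) := Icc_subset_Icc_right hs.2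
    have hG0 : ∀ t ∈ Icc r (a + L), 0 ≤ G t := by
      intro t ht
      have := hGw t ht
      have := hw t (hr.trans_le ht.1)
      by_contra hc
      nlinarith
    have h1 := cs_bound w G φ φ' r s P hr hrs hw (hφ r s hr hrs).1 (hφ r s hr hrs).2 hD
      (hG.mono_set (by
        rw [uIcc_of_le hrs, uIcc_of_le (hrs.trans hs.2)]; exact hsubs))
      (fun t ht => hGw t (hsubs ht))
      (by
        refine le_trans ?_ hP
        apply intervalIntegral.integral_mono_interval le_rfl hrs hs.2 _ hG
        rw [Filter.EventuallyLE, ae_restrict_iff' measurableSet_Ioc]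
        exact Filter.Eventually.of_forall fun t ht => hG0 t ⟨ht.1.le, ht.2⟩)
      hP0
    rw [← hDdef] at h1
    have h2 : ‖φ r‖ ≤ ‖φ s‖ + ‖φ s - φ r‖ := by
      have := norm_sub_le (φ s) (φ s - φ r)
      simpa using this
    have h3 := hQw s hs
    have h4 : ‖φ r‖ ^ 2 ≤ 2 * ‖φ s‖ ^ 2 + 2 * ‖φ s - φ r‖ ^ 2 := by
      nlinarith [sq_nonneg (‖φ s‖ - ‖φ s - φ r‖), norm_nonneg (φ r)]
    nlinarith [sq_nonneg ‖φ s‖]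
  rw [intervalIntegral.integral_const, intervalIntegral.integral_const_mul] at key
  simp only [add_sub_cancel_left, smul_eq_mul] at key
  have k2 : L * (‖φ r‖ ^ 2 / 2 - P * D) ≤ Q * M := key.trans (by gcongr)
  have k3 : ‖φ r‖ ^ 2 / 2 - P * D ≤ Q * M / L := by
    rw [le_div_iff₀ hL]; linarith
  have : 2 * Q / L * M = 2 * (Q * M / L) := by ring
  rw [this]; linarith

lemma one_add_rpow_le (α t : ℝ) (hα0 : 0 < α) (hα1 : α < 1) (ht : 0 < t) :
    (1 + t) ^ (2 * α) ≤ 4 * (1 + t ^ (2 * α)) := by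
  have h2 : (2:ℝ) ^ (2 * α) ≤ 4 := by
    calc (2:ℝ) ^ (2 * α) ≤ 2 ^ (2:ℝ) := by
          apply rpow_le_rpow_of_exponent_le <;> linarith
      _ = 4 := by norm_num
  have hp : 0 < t ^ (2 * α) := by positivity
  rcases le_total t 1 with h | h
  · calc (1 + t) ^ (2 * α) ≤ 2 ^ (2 * α) := by
          apply rpow_le_rpow <;> linarith
      _ ≤ _ := by linarith
  · calc (1 + t) ^ (2 * α) ≤ (2 * t) ^ (2 * α) := by
          apply rpow_le_rpow <;> linarith
      _ = 2 ^ (2 * α) * t ^ (2 * α) := by rw [mul_rpow (by norm_num) ht.le]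
      _ ≤ _ := by nlinarith

/-- far bound -/
lemma far_bound (α : ℝ) (hα0 : 0 < α) (hα1 : α < 1) (φ φ' : ℝ → ℂ) (r L : ℝ)
    (hL : 0 < L) (hrL : L ≤ r)
    (hφ : ∀ a b : ℝ, 0 < a → a ≤ b →
            IntervalIntegrable φ' volume a b ∧ φ b - φ a = ∫ t in a..b, φ' t)
    (hD : IntegrableOn (fun r => ((1 + r) ^ (-(2 * α)) * r) * ‖φ' r‖ ^ 2) (Ioi 0) volume)
    (hM : IntegrableOn (fun r => ((1 + r) ^ (-(2 * α)) * r) * ‖φ r‖ ^ 2) (Ioi 0) volume) :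
    ‖φ r‖ ^ 2 * ((1 + r) ^ (-(2 * α)) * r) ≤ 8 * L *
      ((∫ r in Ioi (0:ℝ), ((1 + r) ^ (-(2 * α)) * r) * ‖φ' r‖ ^ 2) +
       (L ^ 2)⁻¹ * (∫ r in Ioi (0:ℝ), ((1 + r) ^ (-(2 * α)) * r) * ‖φ r‖ ^ 2)) := by
  have hr : 0 < r := hL.trans_le hrL
  have hwr : 0 < (1 + r) ^ (-(2 * α)) * r := by positivity
  have hq : ∀ t ∈ Icc r (r + L),
      1 ≤ 4 / ((1 + r) ^ (-(2 * α)) * r) * ((1 + t) ^ (-(2 * α)) * t) := by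
    intro t ht
    rw [div_mul_eq_mul_div, one_le_div hwr]
    have h1 : (1 + r) ^ (-(2 * α)) ≤ 4 * (1 + t) ^ (-(2 * α)) := by
      have ht0 : 0 < 1 + t := by linarith [ht.1]
      have h2 : (2:ℝ) ^ (2 * α) ≤ 4 := by
        calc (2:ℝ) ^ (2 * α) ≤ 2 ^ (2:ℝ) := by
              apply rpow_le_rpow_of_exponent_le <;> linarith
          _ = 4 := by norm_num
      rw [rpow_neg ht0.le, rpow_neg (by linarith)]
      have : (1 + t) ^ (2 * α) ≤ 4 * (1 + r) ^ (2 * α) := by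
        calc (1 + t) ^ (2 * α) ≤ (2 * (1 + r)) ^ (2 * α) := by
              apply rpow_le_rpow <;> linarith [ht.2]
          _ = 2 ^ (2 * α) * (1 + r) ^ (2 * α) := by rw [mul_rpow (by norm_num) (by linarith)]
          _ ≤ _ := by gcongr
      rw [← div_eq_mul_inv, le_div_iff₀ (by positivity), inv_mul_le_iff₀ (by positivity)]
      linarith
    have : 0 ≤ (1 + t) ^ (-(2 * α)) := by
      have : 0 < 1 + t := by linarith [ht.1]
      positivity
    calc (1 + r) ^ (-(2 * α)) * r ≤ (4 * (1 + t) ^ (-(2 * α))) * t := by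
          apply mul_le_mul h1 ht.1 hr.le (by positivity)
      _ = _ := by ring
  have := avg_bound (fun r => (1 + r) ^ (-(2 * α)) * r)
    (fun _ => 4 / ((1 + r) ^ (-(2 * α)) * r)) φ φ' r r L (4 / ((1 + r) ^ (-(2 * α)) * r) * L)
    (4 / ((1 + r) ^ (-(2 * α)) * r)) hr le_rfl hL (by positivity)
    (fun t ht => by positivity) hφ hD hM (by simp) hq (by simp only [intervalIntegral.integral_const, smul_eq_mul]; apply le_of_eq; ring) (by positivity) hq
  rw [← le_div_iff₀ hwr]
  refine this.trans (le_of_eq ?_)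
  field_simp
  ring

lemma near_bound (α δ : ℝ) (hα0 : 0 < α) (hα1 : α < 1) (hδ : 0 < δ) (hδ1 : δ < 1)
    (φ φ' : ℝ → ℂ) (r L : ℝ) (hr : 0 < r) (hrL : r ≤ L)
    (hφ : ∀ a b : ℝ, 0 < a → a ≤ b →
            IntervalIntegrable φ' volume a b ∧ φ b - φ a = ∫ t in a..b, φ' t)
    (hD : IntegrableOn (fun r => ((1 + r) ^ (-(2 * α)) * r) * ‖φ' r‖ ^ 2) (Ioi 0) volume)
    (hM : IntegrableOn (fun r => ((1 + r) ^ (-(2 * α)) * r) * ‖φ r‖ ^ 2) (Ioi 0) volume) :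
    ‖φ r‖ ^ 2 ≤ (32 + 16 / δ + 16 / α) * ((L / r) ^ δ + L ^ (2 * α)) *
      ((∫ r in Ioi (0:ℝ), ((1 + r) ^ (-(2 * α)) * r) * ‖φ' r‖ ^ 2) +
       (L ^ 2)⁻¹ * (∫ r in Ioi (0:ℝ), ((1 + r) ^ (-(2 * α)) * r) * ‖φ r‖ ^ 2)) := by
  have hL : 0 < L := hr.trans_le hrL
  have hrL2 : r ≤ L + L := by linarith
  have hcont : ∀ p : ℝ, IntervalIntegrable (fun t : ℝ => t ^ p) volume r (L + L) := by
    intro p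
    apply intervalIntegral.intervalIntegrable_rpow
    right
    rw [uIcc_of_le hrL2]
    intro h; exact absurd h.1 (not_le.2 hr)
  have hinv : IntervalIntegrable (fun t : ℝ => t⁻¹) volume r (L + L) := by
    simpa [rpow_neg_one] using hcont (-1)
  have hGw : ∀ t : ℝ, 0 < t →
      1 ≤ ((1 + t) ^ (2 * α) / t) * ((1 + t) ^ (-(2 * α)) * t) := by
    intro t ht
    rw [rpow_neg (by linarith)]
    have : 0 < (1 + t) ^ (2 * α) := by positivity
    apply le_of_eq; field_simp
  have hG : ∀ t : ℝ, 0 < t → (1 + t) ^ (2 * α) / t ≤ 4 * (t⁻¹ + t ^ (2 * α - 1)) := by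
    intro t ht
    rw [div_le_iff₀ ht, rpow_sub_one ht.ne']
    refine (one_add_rpow_le α t hα0 hα1 ht).trans (le_of_eq ?_)
    field_simp
  have h2a : (2:ℝ) ^ (2 * α) ≤ 4 := by
    calc (2:ℝ) ^ (2 * α) ≤ 2 ^ (2:ℝ) := by
          apply rpow_le_rpow_of_exponent_le <;> linarith
      _ = 4 := by norm_num
  have h2L : (L + L) ^ (2 * α) ≤ 4 * L ^ (2 * α) := by
    rw [← two_mul, mul_rpow (by norm_num) hL.le]; gcongr
  have hX1 : 1 ≤ (L / r) ^ δ := one_le_rpow ((one_le_div hr).2 hrL) hδ.le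
  have hY0 : 0 < L ^ (2 * α) := by positivity
  have hint : ∫ t in r..(L + L), 4 * (t⁻¹ + t ^ (2 * α - 1)) ≤
      8 / δ * (L / r) ^ δ + 8 / α * L ^ (2 * α) := by
    rw [intervalIntegral.integral_const_mul, intervalIntegral.integral_add hinv (hcont _),
      integral_inv_of_pos hr (by linarith), integral_rpow (by left; linarith)]
    have h1 : Real.log ((L + L) / r) ≤ 2 / δ * (L / r) ^ δ := by
      refine (Real.log_le_rpow_div (by positivity) hδ).trans ?_
      rw [← two_mul, mul_div_assoc, mul_rpow (by norm_num) (by positivity)]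
      have : (2:ℝ) ^ δ ≤ 2 := by
        calc (2:ℝ) ^ δ ≤ 2 ^ (1:ℝ) := by
              apply rpow_le_rpow_of_exponent_le <;> linarith
          _ = 2 := by norm_num
      calc _ ≤ 2 * (L / r) ^ δ / δ := by gcongr
        _ = _ := by ring
    have h2 : ((L + L) ^ (2 * α - 1 + 1) - r ^ (2 * α - 1 + 1)) / (2 * α - 1 + 1) ≤
        2 / α * L ^ (2 * α) := by
      have : 0 < r ^ (2 * α) := by positivity
      rw [sub_add_cancel]
      calc _ ≤ (4 * L ^ (2 * α)) / (2 * α) := by gcongr; linarith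
        _ = _ := by field_simp; norm_num
    calc _ ≤ 4 * (2 / δ * (L / r) ^ δ + 2 / α * L ^ (2 * α)) := by gcongr
      _ = _ := by ring
  have := avg_bound (fun r => (1 + r) ^ (-(2 * α)) * r)
    (fun t => 4 * (t⁻¹ + t ^ (2 * α - 1))) φ φ' r L L
    (8 / δ * (L / r) ^ δ + 8 / α * L ^ (2 * α))
    ((1 + (L + L)) ^ (2 * α) / L) hr hrL hL (by positivity)
    (fun t ht => by positivity) hφ hD hM ((hinv.add (hcont _)).const_mul 4)
    (fun t ht => by
      have ht0 : 0 < t := hr.trans_le ht.1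
      refine (hGw t ht0).trans ?_
      have := hG t ht0
      gcongr)
    hint (by positivity)
    (fun t ht => by
      have ht0 : 0 < t := hL.trans_le ht.1
      refine (hGw t ht0).trans ?_
      have h1 := ht.1
      have h2 := ht.2
      gcongr)
  have hD0 : 0 ≤ ∫ r in Ioi (0:ℝ), ((1 + r) ^ (-(2 * α)) * r) * ‖φ' r‖ ^ 2 :=
    setIntegral_nonneg measurableSet_Ioi fun t ht => by
      have : 0 < t := ht
      positivity
  have hM0 : 0 ≤ ∫ r in Ioi (0:ℝ), ((1 + r) ^ (-(2 * α)) * r) * ‖φ r‖ ^ 2 :=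
    setIntegral_nonneg measurableSet_Ioi fun t ht => by
      have : 0 < t := ht
      positivity
  refine this.trans ?_
  rw [mul_add ((32 + 16 / δ + 16 / α) * ((L / r) ^ δ + L ^ (2 * α)))]
  have hq : (1 + (L + L)) ^ (2 * α) ≤ 16 * ((L / r) ^ δ + L ^ (2 * α)) := by
    have := one_add_rpow_le α (L + L) hα0 hα1 (by positivity)
    linarith
  apply add_le_add
  · apply mul_le_mul_of_nonneg_right _ hD0
    have e1 : 0 ≤ 1 / δ * L ^ (2 * α) := by positivity
    have e2 : 0 ≤ 1 / α * (L / r) ^ δ := by positivity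
    have e : (32 + 16 / δ + 16 / α) * ((L / r) ^ δ + L ^ (2 * α)) -
      2 * (8 / δ * (L / r) ^ δ + 8 / α * L ^ (2 * α)) = 32 * ((L / r) ^ δ + L ^ (2 * α))
        + 16 * (1 / δ * L ^ (2 * α)) + 16 * (1 / α * (L / r) ^ δ) := by ring
    nlinarith
  · rw [← mul_assoc]
    apply mul_le_mul_of_nonneg_right _ hM0
    have : 2 * ((1 + (L + L)) ^ (2 * α) / L) / L = 2 * (1 + (L + L)) ^ (2 * α) * (L ^ 2)⁻¹ := by
      field_simp
    rw [this]
    apply mul_le_mul_of_nonneg_right _ (by positivity)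
    have e1 : 0 ≤ (16 / δ + 16 / α) * ((L / r) ^ δ + L ^ (2 * α)) := by positivity
    nlinarith

noncomputable def hker (α L r : ℝ) : ℝ :=
  if r ≤ L then 1 / L else L ^ (1 / α - 1) * r ^ (-(1 / α))

lemma hker_integral (α L : ℝ) (hα0 : 0 < α) (hα1 : α < 1) (hL : 0 < L) :
    IntegrableOn (hker α L) (Ioi 0) volume ∧ ∫ r in Ioi (0:ℝ), hker α L r = 1 / (1 - α) := by
  have hu : Ioc 0 L ∪ Ioi L = Ioi (0:ℝ) := Ioc_union_Ioi_eq_Ioi hL.le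
  have hd : Disjoint (Ioc 0 L) (Ioi L) := by
    rw [Set.disjoint_left]; intro x hx hx'; exact absurd hx.2 (not_le.2 hx')
  have h1a : (1:ℝ) < 1 / α := by rw [lt_div_iff₀ hα0]; linarith
  have e1 : EqOn (fun _ => 1 / L) (hker α L) (Ioc 0 L) := fun r hr => by
    simp [hker, hr.2]
  have e2 : EqOn (fun r : ℝ => L ^ (1 / α - 1) * r ^ (-(1 / α))) (hker α L) (Ioi L) := fun r hr => by
    have : ¬ r ≤ L := not_le.2 hr
    simp [hker, this]
  have i1 : IntegrableOn (fun _ : ℝ => 1 / L) (Ioc 0 L) volume := by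
    exact integrableOn_const (by simp) (by simp)
  have i2 : IntegrableOn (fun r : ℝ => L ^ (1 / α - 1) * r ^ (-(1 / α))) (Ioi L) volume :=
    (integrableOn_Ioi_rpow_of_lt (by linarith) hL).const_mul _
  have j1 := i1.congr_fun e1 measurableSet_Ioc
  have j2 := i2.congr_fun e2 measurableSet_Ioi
  refine ⟨hu ▸ j1.union j2, ?_⟩
  rw [← hu, setIntegral_union hd measurableSet_Ioi j1 j2,
    ← setIntegral_congr_fun measurableSet_Ioc e1, ← setIntegral_congr_fun measurableSet_Ioi e2,
    integral_const_mul, integral_Ioi_rpow_of_lt (by linarith) hL]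
  simp only [integral_const, MeasurableSet.univ, measureReal_restrict_apply, univ_inter,
    Real.volume_real_Ioc_of_le hL.le, smul_eq_mul, sub_zero]
  have h3 : L ^ (1 / α - 1) * L ^ (-(1 / α) + 1) = 1 := by
    rw [← rpow_add hL]; simp
  rw [← mul_div_assoc (L ^ (1 / α - 1)), mul_neg, h3]
  have : 1 - α ≠ 0 := by linarith
  have : -(1 / α) + 1 = -((1 - α) / α) := by field_simp; ring
  rw [this]
  field_simp
  ring

lemma young_aux (α V r g L ε : ℝ) (hα0 : 0 < α) (hV : 0 ≤ V) (hr : 0 < r) (hg : 0 ≤ g)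
    (hL : 0 < L) (hε : 0 < ε) :
    V * r * g ≤ ε ^ (-(1 + α)) * L ^ (2 * α) * (V ^ (1 + α) * r)
      + ε ^ ((1 + α) / α) * ((L ^ 2)⁻¹ * r * g ^ ((1 + α) / α)) := by
  have hpq : (1 + α).HolderConjugate ((1 + α) / α) := by
    rw [Real.holderConjugate_iff]
    refine ⟨by linarith, ?_⟩
    field_simp
  have hY := Real.young_inequality_of_nonneg (a := V * L ^ 2 / ε) (b := ε * g)
    (by positivity) (by positivity) hpq
  have hp1 : 1 ≤ 1 + α := by linarith
  have hq1 : 1 ≤ (1 + α) / α := hpq.symm.lt.le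
  have hY2 := hY.trans (add_le_add (div_le_self (by positivity) hp1)
    (div_le_self (by positivity) hq1))
  have ea : (V * L ^ 2 / ε) ^ (1 + α) = ε ^ (-(1 + α)) * L ^ (2 * α) * V ^ (1 + α) * L ^ 2 := by
    rw [div_rpow (by positivity) hε.le, mul_rpow hV (by positivity), rpow_neg hε.le,
      ← rpow_natCast L 2, ← rpow_mul hL.le]
    have : ((2:ℕ):ℝ) * (1 + α) = 2 * α + (2:ℕ) := by push_cast; ring
    rw [this, rpow_add hL, div_eq_mul_inv]
    ring
  have eb : (ε * g) ^ ((1 + α) / α) = ε ^ ((1 + α) / α) * g ^ ((1 + α) / α) :=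
    mul_rpow hε.le hg
  rw [ea, eb] at hY2
  have e0 : V * L ^ 2 / ε * (ε * g) = V * g * L ^ 2 := by field_simp
  rw [e0] at hY2
  have := mul_le_mul_of_nonneg_right hY2 (show 0 ≤ (L ^ 2)⁻¹ * r by positivity)
  refine le_trans (le_of_eq ?_) (this.trans (le_of_eq ?_))
  · field_simp
  · field_simp

lemma pointwise_bound (α ε : ℝ) (hα0 : 0 < α) (hα1 : α < 1) (hε : 0 < ε) (L : ℝ) (hL : 0 < L)
    (v r : ℝ) (hr : 0 < r) (φ φ' : ℝ → ℂ)
    (hφ : ∀ a b : ℝ, 0 < a → a ≤ b →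
            IntervalIntegrable φ' volume a b ∧ φ b - φ a = ∫ t in a..b, φ' t)
    (hD : IntegrableOn (fun r => ((1 + r) ^ (-(2 * α)) * r) * ‖φ' r‖ ^ 2) (Ioi 0) volume)
    (hM : IntegrableOn (fun r => ((1 + r) ^ (-(2 * α)) * r) * ‖φ r‖ ^ 2) (Ioi 0) volume)
    (S : ℝ) (hS0 : 0 ≤ S)
    (hS : S = (∫ r in Ioi (0:ℝ), ((1 + r) ^ (-(2 * α)) * r) * ‖φ' r‖ ^ 2) +
       (L ^ 2)⁻¹ * (∫ r in Ioi (0:ℝ), ((1 + r) ^ (-(2 * α)) * r) * ‖φ r‖ ^ 2)) :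
    -(v * ‖φ r‖ ^ 2 * (1 + r) ^ (-(2 * α)) * r) ≤
      ((32 + 16 / (α / (1 + α)) + 16 / α) * S) *
       (L ^ (2 * α) * (max (-v) 0 * (1 + r) ^ (-(2 * α)) * r) +
        ε ^ (-(1 + α)) * L ^ (2 * α) * (max (-v) 0 ^ (1 + α) * r) +
        ε ^ ((1 + α) / α) * hker α L r) := by
  set K := 32 + 16 / (α / (1 + α)) + 16 / α with hK
  have hK8 : 8 ≤ K := by
    have : 0 ≤ 16 / (α / (1 + α)) := by positivity
    have : 0 ≤ 16 / α := by positivity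
    linarith
  set V := max (-v) 0 with hVdef
  have hV : 0 ≤ V := le_max_right _ _
  have hvV : -v ≤ V := le_max_left _ _
  have hw0 : 0 < (1 + r) ^ (-(2 * α)) := by positivity
  have hw1 : (1 + r) ^ (-(2 * α)) ≤ 1 :=
    rpow_le_one_of_one_le_of_nonpos (by linarith) (by linarith)
  have h1 : -(v * ‖φ r‖ ^ 2 * (1 + r) ^ (-(2 * α)) * r) ≤
      V * (‖φ r‖ ^ 2 * ((1 + r) ^ (-(2 * α)) * r)) := by
    have : 0 ≤ ‖φ r‖ ^ 2 * ((1 + r) ^ (-(2 * α)) * r) := by positivity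
    nlinarith
  refine h1.trans ?_
  have hKS : 0 ≤ K * S := by positivity
  rcases le_or_gt r L with hrL | hrL
  · have hn := near_bound α (α / (1 + α)) hα0 hα1 (by positivity)
      (by rw [div_lt_one (by positivity)]; linarith) φ φ' r L hr hrL hφ hD hM
    rw [← hS, ← hK] at hn
    have hy := young_aux α V r ((L / r) ^ (α / (1 + α))) L ε hα0 hV hr (by positivity) hL hε
    have hg : (L ^ 2)⁻¹ * r * ((L / r) ^ (α / (1 + α))) ^ ((1 + α) / α) = hker α L r := by
      rw [← rpow_mul (by positivity)]
      have : α / (1 + α) * ((1 + α) / α) = 1 := by field_simp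
      rw [this, rpow_one, hker, if_pos hrL]
      field_simp
    rw [hg] at hy
    set X := (L / r) ^ (α / (1 + α))
    have hX : 0 ≤ X := by positivity
    calc V * (‖φ r‖ ^ 2 * ((1 + r) ^ (-(2 * α)) * r))
        ≤ V * ((K * (X + L ^ (2 * α)) * S) * ((1 + r) ^ (-(2 * α)) * r)) := by gcongr
      _ = K * S * (L ^ (2 * α) * (V * (1 + r) ^ (-(2 * α)) * r)
            + (V * r * X) * (1 + r) ^ (-(2 * α))) := by ring
      _ ≤ K * S * (L ^ (2 * α) * (V * (1 + r) ^ (-(2 * α)) * r) + V * r * X) := by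
          apply mul_le_mul_of_nonneg_left _ hKS
          have : V * r * X * (1 + r) ^ (-(2 * α)) ≤ V * r * X :=
            mul_le_of_le_one_right (by positivity) hw1
          linarith
      _ ≤ _ := by
          apply mul_le_mul_of_nonneg_left _ hKS
          linarith
  · have hn := far_bound α hα0 hα1 φ φ' r L hL hrL.le hφ hD hM
    rw [← hS] at hn
    have hy := young_aux α V r (L / r) L ε hα0 hV hr (by positivity) hL hε
    have hg : (L ^ 2)⁻¹ * r * (L / r) ^ ((1 + α) / α) = hker α L r := by
      rw [hker, if_neg (not_le.2 hrL)]
      have : (1 + α) / α = 1 / α + 1 := by field_simp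
      rw [this, rpow_add_one (by positivity), div_rpow hL.le hr.le, rpow_sub_one hL.ne',
        rpow_neg hr.le]
      have : 0 < r ^ (1 / α) := by positivity
      field_simp
    rw [hg] at hy
    have hz : 0 ≤ L ^ (2 * α) * (V * (1 + r) ^ (-(2 * α)) * r) := by positivity
    calc V * (‖φ r‖ ^ 2 * ((1 + r) ^ (-(2 * α)) * r))
        ≤ V * (8 * L * S) := by gcongr
      _ = 8 * S * (V * r * (L / r)) := by field_simp
      _ ≤ K * S * (V * r * (L / r)) := by gcongr
      _ ≤ _ := by
          apply mul_le_mul_of_nonneg_left _ hKS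
          linarith

theorem lowest_eigenvalue_bound_form
    (α : ℝ) (hα0 : 0 < α) (hα1 : α < 1) :
    ∃ C : ℝ, 0 < C ∧
      ∀ (v : ℝ → ℝ), Measurable v →
        IntegrableOn (fun r => max (-v r) 0 ^ (1 + α) * r) (Ioi 0) volume →
        IntegrableOn (fun r => max (-v r) 0 * (1 + r) ^ (-(2 * α)) * r) (Ioi 0) volume →
        ∀ (φ φ' : ℝ → ℂ),
          (∀ a b : ℝ, 0 < a → a ≤ b →
            IntervalIntegrable φ' volume a b ∧ φ b - φ a = ∫ t in a..b, φ' t) →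
          IntegrableOn (fun r => (1 + r) ^ (-(2 * α)) * ‖φ' r‖ ^ 2 * r) (Ioi 0) volume →
          IntegrableOn (fun r => v r * ‖φ r‖ ^ 2 * (1 + r) ^ (-(2 * α)) * r) (Ioi 0) volume →
          IntegrableOn (fun r => ‖φ r‖ ^ 2 * (1 + r) ^ (-(2 * α)) * r) (Ioi 0) volume →
          (∫ r in Ioi (0:ℝ), (1 + r) ^ (-(2 * α)) * ‖φ' r‖ ^ 2 * r) +
              (∫ r in Ioi (0:ℝ), v r * ‖φ r‖ ^ 2 * (1 + r) ^ (-(2 * α)) * r) ≥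
            - (C * ((∫ r in Ioi (0:ℝ), max (-v r) 0 ^ (1 + α) * r) +
                  ∫ r in Ioi (0:ℝ), max (-v r) 0 * (1 + r) ^ (-(2 * α)) * r)) ^ (1 / α) *
              ∫ r in Ioi (0:ℝ), ‖φ r‖ ^ 2 * (1 + r) ^ (-(2 * α)) * r := by
  obtain ⟨K, hKdef⟩ : ∃ K, K = 32 + 16 / (α / (1 + α)) + 16 / α := ⟨_, rfl⟩
  have hK : 0 < K := by rw [hKdef]; positivity
  have h1α : 0 < 1 - α := by linarith
  obtain ⟨ε, hεdef⟩ : ∃ ε : ℝ, ε = ((1 - α) / (2 * K)) ^ (α / (1 + α)) := ⟨_, rfl⟩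
  have hε : 0 < ε := by rw [hεdef]; positivity
  have hεq : ε ^ ((1 + α) / α) = (1 - α) / (2 * K) := by
    rw [hεdef, ← rpow_mul (by positivity)]
    have : α / (1 + α) * ((1 + α) / α) = 1 := by field_simp
    rw [this, rpow_one]
  have he : 0 < ε ^ (-(1 + α)) := by positivity
  refine ⟨2 * K * (1 + ε ^ (-(1 + α))), by positivity, ?_⟩
  intro v _ hI1 hI2 φ φ' hφ hD0 hv hM0
  have eD : (fun r : ℝ => (1 + r) ^ (-(2 * α)) * ‖φ' r‖ ^ 2 * r) =
      fun r => ((1 + r) ^ (-(2 * α)) * r) * ‖φ' r‖ ^ 2 := by funext r; ring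
  have eM : (fun r : ℝ => ‖φ r‖ ^ 2 * (1 + r) ^ (-(2 * α)) * r) =
      fun r => ((1 + r) ^ (-(2 * α)) * r) * ‖φ r‖ ^ 2 := by funext r; ring
  rw [eD] at hD0 ⊢
  rw [eM] at hM0 ⊢
  have hDn : 0 ≤ ∫ r in Ioi (0:ℝ), ((1 + r) ^ (-(2 * α)) * r) * ‖φ' r‖ ^ 2 :=
    setIntegral_nonneg measurableSet_Ioi fun t ht => by
      have : 0 < t := ht
      positivity
  have hMn : 0 ≤ ∫ r in Ioi (0:ℝ), ((1 + r) ^ (-(2 * α)) * r) * ‖φ r‖ ^ 2 :=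
    setIntegral_nonneg measurableSet_Ioi fun t ht => by
      have : 0 < t := ht
      positivity
  have hI1n : 0 ≤ ∫ r in Ioi (0:ℝ), max (-v r) 0 ^ (1 + α) * r :=
    setIntegral_nonneg measurableSet_Ioi fun t ht => by
      have : 0 < t := ht
      positivity
  have hI2n : 0 ≤ ∫ r in Ioi (0:ℝ), max (-v r) 0 * (1 + r) ^ (-(2 * α)) * r :=
    setIntegral_nonneg measurableSet_Ioi fun t ht => by
      have : 0 < t := ht
      positivity
  have key : ∀ L : ℝ, 0 < L →
      2 * K * (1 + ε ^ (-(1 + α))) * ((∫ r in Ioi (0:ℝ), max (-v r) 0 ^ (1 + α) * r) +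
        ∫ r in Ioi (0:ℝ), max (-v r) 0 * (1 + r) ^ (-(2 * α)) * r) * L ^ (2 * α) ≤ 1 →
      -(∫ r in Ioi (0:ℝ), v r * ‖φ r‖ ^ 2 * (1 + r) ^ (-(2 * α)) * r) ≤
       (∫ r in Ioi (0:ℝ), ((1 + r) ^ (-(2 * α)) * r) * ‖φ' r‖ ^ 2) +
       (L ^ 2)⁻¹ * (∫ r in Ioi (0:ℝ), ((1 + r) ^ (-(2 * α)) * r) * ‖φ r‖ ^ 2) := by
    intro L hL hLC
    obtain ⟨S, hS⟩ : ∃ S, S = (∫ r in Ioi (0:ℝ), ((1 + r) ^ (-(2 * α)) * r) * ‖φ' r‖ ^ 2) +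
       (L ^ 2)⁻¹ * (∫ r in Ioi (0:ℝ), ((1 + r) ^ (-(2 * α)) * r) * ‖φ r‖ ^ 2) := ⟨_, rfl⟩
    have hS0 : 0 ≤ S := by rw [hS]; positivity
    obtain ⟨hk, hkint⟩ := hker_integral α L hα0 hα1 hL
    rw [← hS, ← integral_neg]
    have i1 := hI2.const_mul (L ^ (2 * α))
    have i2 := hI1.const_mul (ε ^ (-(1 + α)) * L ^ (2 * α))
    have i3 := hk.const_mul (ε ^ ((1 + α) / α))
    have hmono := setIntegral_mono_on hv.neg (((i1.add i2).add i3).const_mul (K * S))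
      measurableSet_Ioi (fun r hr => by
        rw [hKdef]
        exact pointwise_bound α ε hα0 hα1 hε L hL (v r) r hr φ φ' hφ hD0 hM0 S hS0 hS)
    refine hmono.trans ?_
    rw [integral_const_mul]
    rw [integral_add' (i1.add i2) i3, integral_add' i1 i2, integral_const_mul,
      integral_const_mul, integral_const_mul, hkint, hεq]
    generalize (∫ r in Ioi (0:ℝ), max (-v r) 0 ^ (1 + α) * r) = I1 at *
    generalize (∫ r in Ioi (0:ℝ), max (-v r) 0 * (1 + r) ^ (-(2 * α)) * r) = I2 at *
    have hl : 0 < L ^ (2 * α) := by positivity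
    generalize L ^ (2 * α) = l at *
    generalize ε ^ (-(1 + α)) = e at *
    have h2 : K * (l * I2 + e * l * I1) ≤ 1 / 2 := by
      have p1 : 0 ≤ K * l * I1 := by positivity
      have p2 : 0 ≤ K * l * e * I2 := by positivity
      nlinarith
    have h3 : K * ((1 - α) / (2 * K) * (1 / (1 - α))) = 1 / 2 := by field_simp
    calc K * S * (l * I2 + e * l * I1 + (1 - α) / (2 * K) * (1 / (1 - α)))
        = S * (K * (l * I2 + e * l * I1) + K * ((1 - α) / (2 * K) * (1 / (1 - α)))) := by ring
      _ ≤ S * (1 / 2 + 1 / 2) := by rw [h3]; gcongr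
      _ = S := by ring
  have hI := add_nonneg hI1n hI2n
  generalize (∫ r in Ioi (0:ℝ), max (-v r) 0 ^ (1 + α) * r) +
    (∫ r in Ioi (0:ℝ), max (-v r) 0 * (1 + r) ^ (-(2 * α)) * r) = I at *
  have hCI : 0 ≤ 2 * K * (1 + ε ^ (-(1 + α))) * I := by
    have : 0 ≤ I := hI
    positivity
  generalize 2 * K * (1 + ε ^ (-(1 + α))) * I = J at *
  generalize (∫ r in Ioi (0:ℝ), v r * ‖φ r‖ ^ 2 * (1 + r) ^ (-(2 * α)) * r) = W at *
  generalize (∫ r in Ioi (0:ℝ), ((1 + r) ^ (-(2 * α)) * r) * ‖φ' r‖ ^ 2) = D at *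
  generalize (∫ r in Ioi (0:ℝ), ((1 + r) ^ (-(2 * α)) * r) * ‖φ r‖ ^ 2) = M at *
  suffices h : -W ≤ D + J ^ (1 / α) * M by linarith
  apply le_of_forall_pos_le_add
  intro η hη
  have hE0 : 0 ≤ J ^ (1 / α) := by positivity
  obtain ⟨E, hE⟩ : ∃ E, E = J ^ (1 / α) + η / (M + 1) := ⟨_, rfl⟩
  have hη1 : 0 < η / (M + 1) := by positivity
  have hEpos : 0 < E := by linarith
  have hL1 : (E ^ (-(1 / 2 : ℝ))) ^ (2 * α) = (E ^ α)⁻¹ := by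
    rw [← rpow_mul hEpos.le, ← rpow_neg hEpos.le]
    congr 1; ring
  have hL2 : ((E ^ (-(1 / 2 : ℝ))) ^ 2)⁻¹ = E := by
    rw [← rpow_natCast, ← rpow_mul hEpos.le, ← rpow_neg hEpos.le]
    norm_num
  have hJE : J ≤ E ^ α := by
    calc J = (J ^ (1 / α)) ^ α := by
          rw [← rpow_mul hCI, one_div_mul_cancel hα0.ne', rpow_one]
      _ ≤ E ^ α := by
          apply rpow_le_rpow hE0 _ hα0.le
          linarith
  have := key (E ^ (-(1 / 2 : ℝ))) (by positivity) (by
    rw [hL1, ← div_eq_mul_inv]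
    exact div_le_one_of_le₀ hJE (by positivity))
  rw [hL2] at this
  have h5 : η / (M + 1) * M ≤ η := by
    rw [div_mul_eq_mul_div, div_le_iff₀ (by positivity)]
    nlinarith
  rw [hE] at this
  nlinarith
end

section
/- For every α ∈ (0,1) there exists a constant C_α > 0 with the following property. Let v : (0,∞) → ℝ be measurable with ∫₀^∞ v(r)₋^{1+α} r dr < ∞ and ∫₀^∞ v(r)₋ (1+r)^{-2α} r dr < ∞, where v₋ = max(-v, 0). Then for every continuously differentiable compactly supported function η : (0,∞) → ℂ one has ∫₀^∞ |η'(r)|² dr - α |η(1)|² - (1/4) ∫₀^1 r^{-2} |η(r)|² dr + (α² - 1/4) ∫₁^∞ r^{-2} |η(r)|² dr + ∫₀^∞ v(r) |η(r)|² dr ≥ - ( C_α ( ∫₀^∞ v(r)₋^{1+α} r dr + ∫₀^∞ v(r)₋ (1+r)^{-2α} r dr ) )^{1/α} · ∫₀^∞ |η(r)|² dr. -/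
open MeasureTheory Real Set

lemma cs_aux (x y : ℝ → ℝ) (a b : ℝ) (hab : a ≤ b) (hx : ContinuousOn x (Icc a b))
    (hy : ContinuousOn y (Icc a b)) :
    (∫ s in a..b, x s * y s) ^ 2 ≤ (∫ s in a..b, x s ^ 2) * ∫ s in a..b, y s ^ 2 := by
  have i1 : IntervalIntegrable (fun s => x s ^ 2) volume a b :=
    ContinuousOn.intervalIntegrable_of_Icc hab (by fun_prop)
  have i2 : IntervalIntegrable (fun s => y s ^ 2) volume a b :=
    ContinuousOn.intervalIntegrable_of_Icc hab (by fun_prop)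
  have i3 : IntervalIntegrable (fun s => x s * y s) volume a b :=
    ContinuousOn.intervalIntegrable_of_Icc hab (by fun_prop)
  have key : ∀ c : ℝ, 0 ≤ (∫ s in a..b, x s ^ 2) * (c * c) + (2 * ∫ s in a..b, x s * y s) * c +
      ∫ s in a..b, y s ^ 2 := by
    intro c
    have h0 : 0 ≤ ∫ s in a..b, (c * x s + y s) ^ 2 :=
      intervalIntegral.integral_nonneg hab (fun s _ => sq_nonneg _)
    have h1 : (∫ s in a..b, (c * x s + y s) ^ 2) =
        ∫ s in a..b, ((c * c) * x s ^ 2 + (2 * c) * (x s * y s) + y s ^ 2) := by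
      congr 1; ext s; ring
    rw [h1, intervalIntegral.integral_add ((i1.const_mul _).add (i3.const_mul _)) i2,
      intervalIntegral.integral_add (i1.const_mul _) (i3.const_mul _),
      intervalIntegral.integral_const_mul, intervalIntegral.integral_const_mul] at h0
    linarith
  have := discrim_le_zero key
  unfold discrim at this
  nlinarith

lemma piece_aux (η : ℝ → ℂ) (hη : ContDiff ℝ 1 η) (k a b : ℝ) (ha : 0 < a) (hab : a ≤ b) :
    ‖(b ^ (-k)) • η b - (a ^ (-k)) • η a‖ ^ 2 ≤
      (∫ s in a..b, s ^ (-(2 * k))) * ∫ s in a..b, ‖deriv η s - (k / s) • η s‖ ^ 2 := by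
  have hd : ∀ s, HasDerivAt η (deriv η s) s := fun s =>
    (hη.differentiable one_ne_zero s).hasDerivAt
  have hc : Continuous (deriv η) := hη.continuous_deriv le_rfl
  have hc0 : Continuous η := hη.continuous
  have hpos : ∀ s ∈ Icc a b, 0 < s := fun s hs => ha.trans_le hs.1
  have hpow : ContinuousOn (fun s : ℝ => s ^ (-k)) (Icc a b) := fun s hs =>
    (Real.continuousAt_rpow_const _ _ (Or.inl (hpos s hs).ne')).continuousWithinAt
  have hg : ContinuousOn (fun s : ℝ => deriv η s - (k / s) • η s) (Icc a b) := by
    apply hc.continuousOn.sub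
    exact ContinuousOn.fun_smul (f := fun s : ℝ => k / s)
      (continuousOn_const.div continuousOn_id (fun s hs => (hpos s hs).ne')) hc0.continuousOn
  have hder : ∀ s ∈ uIcc a b, HasDerivAt (fun s : ℝ => (s ^ (-k)) • η s)
      ((s ^ (-k)) • (deriv η s - (k / s) • η s)) s := by
    intro s hs
    rw [uIcc_of_le hab] at hs
    have h1 := (Real.hasDerivAt_rpow_const (p := -k) (Or.inl (hpos s hs).ne')).smul (hd s)
    refine HasDerivAt.congr_deriv h1 ?_
    rw [Real.rpow_sub_one (hpos s hs).ne', smul_sub, smul_smul, sub_eq_add_neg, ← neg_smul]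
    congr 2
    ring
  have hint : IntervalIntegrable (fun s : ℝ => (s ^ (-k)) • (deriv η s - (k / s) • η s)) volume a b :=
    ContinuousOn.intervalIntegrable_of_Icc hab (hpow.smul hg)
  have hftc := intervalIntegral.integral_eq_sub_of_hasDerivAt hder hint
  rw [← hftc]
  have hle : ‖∫ s in a..b, (s ^ (-k)) • (deriv η s - (k / s) • η s)‖ ≤
      ∫ s in a..b, s ^ (-k) * ‖deriv η s - (k / s) • η s‖ := by
    refine (intervalIntegral.norm_integral_le_integral_norm hab).trans (le_of_eq ?_)
    apply intervalIntegral.integral_congr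
    intro s hs
    rw [uIcc_of_le hab] at hs
    simp only [norm_smul, Real.norm_eq_abs]
    rw [abs_of_pos (Real.rpow_pos_of_pos (hpos s hs) _)]
  have hcs := cs_aux (fun s => s ^ (-k)) (fun s => ‖deriv η s - (k / s) • η s‖) a b hab hpow hg.norm
  have he : (∫ s in a..b, s ^ (-(2 * k))) = ∫ s in a..b, (s ^ (-k)) ^ 2 := by
    apply intervalIntegral.integral_congr
    intro s hs
    rw [uIcc_of_le hab] at hs
    simp only
    rw [← Real.rpow_natCast, ← Real.rpow_mul (hpos s hs).le]
    congr 1; push_cast; ring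
  rw [he]
  exact (pow_le_pow_left₀ (norm_nonneg _) hle 2).trans hcs

/-- two-point consequence -/
lemma two_pt (η : ℝ → ℂ) (hη : ContDiff ℝ 1 η) (k a b r t J P : ℝ) (ha : 0 < a) (hab : a ≤ b)
    (hrt : (r = a ∧ t = b) ∨ (r = b ∧ t = a))
    (hJ : (∫ s in a..b, s ^ (-(2 * k))) ≤ J)
    (hP : (∫ s in a..b, ‖deriv η s - (k / s) • η s‖ ^ 2) ≤ P) :
    r ^ (-(2 * k)) * ‖η r‖ ^ 2 ≤ 2 * (t ^ (-(2 * k)) * ‖η t‖ ^ 2) + 2 * (J * P) := by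
  have hb : 0 < b := ha.trans_le hab
  have h := piece_aux η hη k a b ha hab
  have hJ0 : 0 ≤ ∫ s in a..b, s ^ (-(2 * k)) :=
    intervalIntegral.integral_nonneg hab (fun s hs => Real.rpow_nonneg (ha.le.trans hs.1) _)
  have hP0 : 0 ≤ ∫ s in a..b, ‖deriv η s - (k / s) • η s‖ ^ 2 :=
    intervalIntegral.integral_nonneg hab (fun s hs => sq_nonneg _)
  have h2 : ‖(b ^ (-k)) • η b - (a ^ (-k)) • η a‖ ^ 2 ≤ J * P :=
    h.trans (mul_le_mul hJ hP hP0 (hJ0.trans hJ))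
  have hr : 0 < r := by rcases hrt with h | h <;> rw [h.1] <;> assumption
  have ht : 0 < t := by rcases hrt with h | h <;> rw [h.2] <;> assumption
  have h3 : ‖(r ^ (-k)) • η r - (t ^ (-k)) • η t‖ ^ 2 ≤ J * P := by
    rcases hrt with ⟨rfl, rfl⟩ | ⟨rfl, rfl⟩
    · rwa [norm_sub_rev]
    · exact h2
  have e : ∀ s, 0 < s → s ^ (-(2 * k)) * ‖η s‖ ^ 2 = ‖(s ^ (-k)) • η s‖ ^ 2 := by
    intro s hs
    rw [norm_smul, mul_pow, Real.norm_eq_abs, sq_abs, ← Real.rpow_natCast (s ^ (-k)),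
      ← Real.rpow_mul hs.le]
    congr 2; push_cast; ring
  rw [e r hr, e t ht]
  have h4 : ‖(r ^ (-k)) • η r‖ ≤ ‖(r ^ (-k)) • η r - (t ^ (-k)) • η t‖ + ‖(t ^ (-k)) • η t‖ := by
    simpa using norm_add_le ((r ^ (-k)) • η r - (t ^ (-k)) • η t) ((t ^ (-k)) • η t)
  have h5 := pow_le_pow_left₀ (norm_nonneg _) h4 2
  nlinarith [sq_nonneg (‖(r ^ (-k)) • η r - (t ^ (-k)) • η t‖ - ‖(t ^ (-k)) • η t‖)]

lemma rpow_le_two (x y : ℝ) (h1 : 1 / 2 ≤ x) (h2 : x ≤ 2) (h3 : -1 ≤ y) (h4 : y ≤ 1) :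
    x ^ y ≤ 2 := by
  rcases le_total 1 x with h | h
  · calc x ^ y ≤ x ^ (1:ℝ) := Real.rpow_le_rpow_of_exponent_le h h4
      _ ≤ 2 := by simpa using h2
  · calc x ^ y ≤ x ^ (-1:ℝ) := Real.rpow_le_rpow_of_exponent_ge (by linarith) h h3
      _ ≤ 2 := by
        rw [Real.rpow_neg_one]
        rw [inv_le_comm₀ (by linarith) (by norm_num)]; linarith

lemma exists_avg (η : ℝ → ℂ) (hη : Continuous η) (a b N : ℝ) (hab : a < b)
    (hN : (∫ s in a..b, ‖η s‖ ^ 2) ≤ N) : ∃ t ∈ Icc a b, ‖η t‖ ^ 2 ≤ N / (b - a) := by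
  by_contra! hcon
  have hba : 0 < b - a := sub_pos.2 hab
  obtain ⟨t, ht, hmin⟩ := isCompact_Icc.exists_isMinOn (nonempty_Icc.2 hab.le)
    (f := fun s => ‖η s‖ ^ 2) (by fun_prop)
  have h1 : (∫ s in a..b, ‖η t‖ ^ 2) ≤ ∫ s in a..b, ‖η s‖ ^ 2 := by
    apply intervalIntegral.integral_mono_on hab.le (by simp)
    · exact Continuous.intervalIntegrable (by fun_prop) _ _
    · intro s hs; exact hmin hs
  rw [intervalIntegral.integral_const, smul_eq_mul] at h1
  have h2 := hcon t ht
  rw [div_lt_iff₀ hba] at h2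
  linarith

lemma dyadic (η : ℝ → ℂ) (hη : ContDiff ℝ 1 η) (k a b r N P : ℝ) (ha : 0 < a) (hab : a < b)
    (hb2 : b ≤ 2 * a) (hk1 : -1 ≤ 2 * k) (hk2 : 2 * k ≤ 1) (hr : r ∈ Icc a b)
    (hN : (∫ s in a..b, ‖η s‖ ^ 2) ≤ N)
    (hP : (∫ s in a..b, ‖deriv η s - (k / s) • η s‖ ^ 2) ≤ P) :
    ‖η r‖ ^ 2 ≤ 4 * (N / (b - a)) + 4 * ((b - a) * P) := by
  have hc0 : Continuous η := hη.continuous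
  obtain ⟨t, ht, htN⟩ := exists_avg η hc0 a b N hab hN
  have hr0 : 0 < r := ha.trans_le hr.1
  have hpos : ∀ s ∈ Icc a b, 0 < s := fun s hs => ha.trans_le hs.1
  have hP0 : 0 ≤ P := le_trans
    (intervalIntegral.integral_nonneg hab.le (fun s hs => sq_nonneg _)) hP
  have hrat : ∀ s ∈ Icc a b, s ^ (-(2 * k)) ≤ 2 * r ^ (-(2 * k)) := by
    intro s hs
    have hs0 := hpos s hs
    have h1 : (s / r) ^ (-(2 * k)) ≤ 2 := by
      apply rpow_le_two
      · rw [le_div_iff₀ hr0]; linarith [hs.1, hr.2]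
      · rw [div_le_iff₀ hr0]; linarith [hs.2, hr.1]
      · linarith
      · linarith
    rw [Real.div_rpow hs0.le hr0.le, div_le_iff₀ (Real.rpow_pos_of_pos hr0 _)] at h1
    exact h1
  have gen : ∀ c d : ℝ, a ≤ c → c ≤ d → d ≤ b →
      (∫ s in c..d, s ^ (-(2 * k))) ≤ 2 * r ^ (-(2 * k)) * (b - a) ∧
      (∫ s in c..d, ‖deriv η s - (k / s) • η s‖ ^ 2) ≤ P := by
    intro c d h1 h2 h3
    constructor
    · have : (∫ s in c..d, s ^ (-(2 * k))) ≤ ∫ s in c..d, 2 * r ^ (-(2 * k)) := by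
        apply intervalIntegral.integral_mono_on h2 _ (by simp)
        · intro s hs; exact hrat s ⟨h1.trans hs.1, hs.2.trans h3⟩
        · apply ContinuousOn.intervalIntegrable_of_Icc h2
          intro s hs
          exact (Real.continuousAt_rpow_const _ _
            (Or.inl (ha.trans_le (h1.trans hs.1)).ne')).continuousWithinAt
      rw [intervalIntegral.integral_const, smul_eq_mul] at this
      have h5 := Real.rpow_pos_of_pos hr0 (-(2 * k))
      nlinarith
    · refine le_trans ?_ hP
      apply intervalIntegral.integral_mono_interval h1 h2 h3
      · exact Filter.Eventually.of_forall (fun s => sq_nonneg _)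
      · apply ContinuousOn.intervalIntegrable_of_Icc hab.le
        apply ContinuousOn.pow
        apply ContinuousOn.norm
        apply (hη.continuous_deriv le_rfl).continuousOn.sub
        exact ContinuousOn.fun_smul (f := fun s : ℝ => k / s)
          (continuousOn_const.div continuousOn_id (fun s hs => (hpos s hs).ne')) hc0.continuousOn
  have key : r ^ (-(2 * k)) * ‖η r‖ ^ 2 ≤
      2 * (t ^ (-(2 * k)) * ‖η t‖ ^ 2) + 2 * (2 * r ^ (-(2 * k)) * (b - a) * P) := by
    rcases le_total r t with h | h
    · obtain ⟨g1, g2⟩ := gen r t hr.1 h ht.2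
      exact two_pt η hη k r t r t _ P hr0 h (Or.inl ⟨rfl, rfl⟩) g1 g2
    · obtain ⟨g1, g2⟩ := gen t r ht.1 h hr.2
      exact two_pt η hη k t r r t _ P (hpos t ht) h (Or.inr ⟨rfl, rfl⟩) g1 g2
  have h5 := Real.rpow_pos_of_pos hr0 (-(2 * k))
  have h6 : t ^ (-(2 * k)) * ‖η t‖ ^ 2 ≤ 2 * r ^ (-(2 * k)) * (N / (b - a)) :=
    mul_le_mul (hrat t ht) htN (sq_nonneg _) (by positivity)
  have h7 : r ^ (-(2 * k)) * ‖η r‖ ^ 2 ≤ r ^ (-(2 * k)) *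
    (4 * (N / (b - a)) + 4 * ((b - a) * P)) := by nlinarith
  exact le_of_mul_le_mul_left h7 h5

lemma young_aux_s18 (α W τ y : ℝ) (hα : 0 < α) (hW : 0 ≤ W) (hτ : 0 < τ) (hy : 0 ≤ y) :
    W * y ^ α ≤ W ^ (1 + α) * τ ^ (-α) + τ * y ^ (1 + α) := by
  have hWp : 0 ≤ W ^ (1 + α) * τ ^ (-α) := by positivity
  have hyp : 0 ≤ τ * y ^ (1 + α) := by positivity
  have e : ∀ z : ℝ, 0 ≤ z → z ^ (1 + α) = z * z ^ α := fun z hz => by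
    rw [Real.rpow_add_of_nonneg hz zero_le_one hα.le, Real.rpow_one]
  rcases le_total W (τ * y) with h | h
  · have : W * y ^ α ≤ τ * y * y ^ α := mul_le_mul_of_nonneg_right h (by positivity)
    rw [e y hy] at *
    nlinarith
  · have h1 : y ≤ W / τ := by rw [le_div_iff₀ hτ]; linarith
    have h2 : y ^ α ≤ (W / τ) ^ α := Real.rpow_le_rpow hy h1 hα.le
    rw [Real.div_rpow hW hτ.le, div_eq_mul_inv, ← Real.rpow_neg hτ.le] at h2
    have := mul_le_mul_of_nonneg_left h2 hW
    rw [e W hW] at *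
    nlinarith

lemma tau_aux (α E τ : ℝ) (hα0 : 0 < α) (hα1 : α < 1) (hE : 0 < E) (h : E / 4 ≤ τ) :
    τ ^ (-α) ≤ 4 * E ^ (-α) := by
  calc τ ^ (-α) ≤ (E / 4) ^ (-α) :=
        Real.rpow_le_rpow_of_nonpos (by positivity) h (by linarith)
    _ = E ^ (-α) * 4 ^ α := by
        rw [Real.div_rpow hE.le (by norm_num), Real.rpow_neg (by norm_num : (0:ℝ) ≤ 4) α]
        field_simp
    _ ≤ E ^ (-α) * 4 ^ (1:ℝ) := by
        gcongr
        norm_num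
    _ = 4 * E ^ (-α) := by rw [Real.rpow_one]; ring

lemma regionI (α E W h Q r : ℝ) (hα0 : 0 < α) (hα1 : α < 1) (hE : 0 < E) (hW : 0 ≤ W)
    (hh : 0 ≤ h) (hb : h ≤ 34 * r * Q) :
    W * h ≤ E / 4 * h + 136 * E ^ (-α) * Q * (W ^ (1 + α) * r) := by
  have h1 := young_aux_s18 α W (E / 4) 1 hα0 hW (by positivity) zero_le_one
  rw [Real.one_rpow, Real.one_rpow, mul_one, mul_one] at h1
  have h2 := tau_aux α E (E / 4) hα0 hα1 hE le_rfl
  have h3 : W ^ (1 + α) * (E / 4) ^ (-α) ≤ W ^ (1 + α) * (4 * E ^ (-α)) := by gcongr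
  have h4 : W * h ≤ (W ^ (1 + α) * (4 * E ^ (-α)) + E / 4) * h := by
    apply mul_le_mul_of_nonneg_right _ hh; linarith
  have h5 : W ^ (1 + α) * (4 * E ^ (-α)) * h ≤ W ^ (1 + α) * (4 * E ^ (-α)) * (34 * r * Q) := by
    gcongr
  nlinarith

lemma regionII (α E W Q r L M : ℝ) (hα0 : 0 < α) (hα1 : α < 1) (hE : 0 < E) (hW : 0 ≤ W)
    (hQ : 0 ≤ Q) (hr : 0 < r) (hL : r < L) (hM : 0 ≤ M) (hEL : E * L ^ 2 ≤ 1) :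
    W * (r * (M + 2 * log (L / r)) * Q) ≤
      4 * (M + 2 * ((1 + α) / α)) ^ (1 + α) * E ^ (-α) * Q * (W ^ (1 + α) * r)
        + 1 / 4 * Q * (1 / L) := by
  have hL0 : 0 < L := hr.trans hL
  have hx1 : 1 ≤ L / r := by rw [le_div_iff₀ hr]; linarith
  have hx0 : 0 < L / r := by positivity
  set c := M + 2 * ((1 + α) / α) with hc
  have hc0 : 0 ≤ c := by positivity
  set y := (L / r) ^ (1 / (1 + α)) with hy
  have hy0 : 0 ≤ y := by positivity
  have hya : y ^ α = (L / r) ^ (α / (1 + α)) := by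
    rw [hy, ← Real.rpow_mul hx0.le]; congr 1; field_simp
  have hyb : y ^ (1 + α) = L / r := by
    rw [hy, ← Real.rpow_mul hx0.le, one_div, inv_mul_cancel₀ (by linarith), Real.rpow_one]
  have hlog : log (L / r) ≤ y ^ α * ((1 + α) / α) := by
    have := Real.log_le_rpow_div hx0.le (ε := α / (1 + α)) (by positivity)
    rw [hya]
    refine this.trans (le_of_eq ?_)
    field_simp
  have hy1 : 1 ≤ y ^ α := by rw [hya]; exact Real.one_le_rpow hx1 (by positivity)
  have h1 : M + 2 * log (L / r) ≤ c * y ^ α := by rw [hc]; nlinarith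
  have h2 := young_aux_s18 α (c * W) (1 / (4 * L ^ 2)) y hα0 (by positivity) (by positivity) hy0
  have h3 : (1 / (4 * L ^ 2)) ^ (-α) ≤ 4 * E ^ (-α) := by
    apply tau_aux α E _ hα0 hα1 hE
    rw [le_div_iff₀ (by positivity)]; nlinarith
  rw [hyb, Real.mul_rpow hc0 hW] at h2
  have h4 : c ^ (1 + α) * W ^ (1 + α) * (1 / (4 * L ^ 2)) ^ (-α) ≤
      c ^ (1 + α) * W ^ (1 + α) * (4 * E ^ (-α)) := by gcongr
  have h5 : W * (M + 2 * log (L / r)) ≤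
      c ^ (1 + α) * W ^ (1 + α) * (4 * E ^ (-α)) + 1 / (4 * L ^ 2) * (L / r) := by
    have := mul_le_mul_of_nonneg_left h1 hW
    nlinarith
  have h6 := mul_le_mul_of_nonneg_right h5 (mul_nonneg hr.le hQ)
  have h7 : 1 / (4 * L ^ 2) * (L / r) * (r * Q) = 1 / 4 * Q * (1 / L) := by field_simp
  rw [add_mul, h7] at h6
  nlinarith

lemma weight_small (α r : ℝ) (hα0 : 0 < α) (hα1 : α < 1) (hr : 0 < r) (hr1 : r ≤ 1) :
    1 ≤ 4 * (1 + r) ^ (-(2 * α)) := by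
  have h : (1 + r) ^ (2 * α) ≤ 4 := by
    calc (1 + r) ^ (2 * α) ≤ (2:ℝ) ^ (2 * α) := by gcongr; linarith
      _ ≤ (2:ℝ) ^ (2:ℝ) := by gcongr <;> linarith
      _ = 4 := by norm_num
  rw [Real.rpow_neg (by linarith), ← div_eq_mul_inv, le_div_iff₀ (by positivity)]
  linarith

lemma weight_large (α r : ℝ) (hα0 : 0 < α) (hα1 : α < 1) (hr1 : 1 ≤ r) :
    r ^ (-(2 * α)) ≤ 4 * (1 + r) ^ (-(2 * α)) := by
  have hr : 0 < r := by linarith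
  have h : (1 + r) ^ (2 * α) ≤ 4 * r ^ (2 * α) := by
    calc (1 + r) ^ (2 * α) ≤ (2 * r) ^ (2 * α) := by gcongr; linarith
      _ = 2 ^ (2 * α) * r ^ (2 * α) := by rw [Real.mul_rpow (by norm_num) hr.le]
      _ ≤ (2:ℝ) ^ (2:ℝ) * r ^ (2 * α) := by gcongr <;> linarith
      _ = 4 * r ^ (2 * α) := by norm_num
  rw [Real.rpow_neg (by linarith), Real.rpow_neg (by linarith), ← div_eq_mul_inv,
    le_div_iff₀ (by positivity), inv_mul_eq_div, div_le_iff₀ (by positivity)]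
  linarith

set_option maxHeartbeats 1600000 in
lemma bound_pt (α E P N : ℝ) (η : ℝ → ℂ) (hη : ContDiff ℝ 1 η) (hα0 : 0 < α) (hα1 : α < 1)
    (hE : 0 < E) (hP : 0 ≤ P) (hN : 0 ≤ N)
    (H1 : ∀ a b, 0 < a → a ≤ b → b ≤ 1 →
      (∫ s in a..b, ‖deriv η s - ((1 / 2) / s) • η s‖ ^ 2) ≤ P)
    (H2 : ∀ a b, 1 ≤ a → a ≤ b →
      (∫ s in a..b, ‖deriv η s - (((1 - 2 * α) / 2) / s) • η s‖ ^ 2) ≤ P)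
    (HN : ∀ a b, 0 < a → a ≤ b → (∫ s in a..b, ‖η s‖ ^ 2) ≤ N)
    (W r : ℝ) (hW : 0 ≤ W) (hr : 0 < r) :
    W * ‖η r‖ ^ 2 ≤ E / 4 * ‖η r‖ ^ 2 +
      (136 + 4 * (68 + 2 * ((1 + α) / α)) ^ (1 + α) + 8 * (16 + 1 / α)) * E ^ (-α) * (P + E * N) *
        (W ^ (1 + α) * r + W * (1 + r) ^ (-(2 * α)) * r) +
      1 / 4 * (P + E * N) * (Ioo 0 (min 1 (√E)⁻¹)).indicator
        (fun _ => 1 / (min 1 (√E)⁻¹)) r := by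
  have hEN : 0 ≤ E * N := by positivity
  set Q := P + E * N with hQdef
  have hQ : 0 ≤ Q := by positivity
  have hPQ : P ≤ Q := by linarith
  have hNQ : E * N ≤ Q := by linarith
  set R := (√E)⁻¹ with hR
  have hsE : 0 < √E := Real.sqrt_pos.2 hE
  have hR0 : 0 < R := by positivity
  have hER : E * R ^ 2 = 1 := by
    rw [hR, inv_pow, Real.sq_sqrt hE.le, mul_inv_cancel₀ hE.ne']
  -- basic bounds
  have B1 : ∀ r, 1 ≤ r → 1 ≤ E * r ^ 2 → ‖η r‖ ^ 2 ≤ 8 * r * Q := by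
    intro r hr hEr
    have h := dyadic η hη ((1 - 2 * α) / 2) r (2 * r) r N P (by linarith) (by linarith) le_rfl
      (by linarith) (by linarith) ⟨le_rfl, by linarith⟩ (HN _ _ (by linarith) (by linarith))
      (H2 _ _ hr (by linarith))
    have e : 2 * r - r = r := by ring
    rw [e] at h
    have h2 : N / r ≤ r * Q := by
      rw [div_le_iff₀ (by linarith)]
      nlinarith [mul_le_mul_of_nonneg_left hNQ (sq_nonneg r), mul_le_mul_of_nonneg_left hEr hN]
    nlinarith
  have B2 : ∀ r, 0 < r → r ≤ 1 → 1 ≤ 4 * (E * r ^ 2) → ‖η r‖ ^ 2 ≤ 34 * r * Q := by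
    intro r hr hr1 hEr
    have h := dyadic η hη (1 / 2) (r / 2) r r N P (by linarith) (by linarith) (by linarith)
      (by norm_num) (by norm_num) ⟨by linarith, le_rfl⟩ (HN _ _ (by linarith) (by linarith))
      (H1 _ _ (by linarith) (by linarith) hr1)
    have e : r - r / 2 = r / 2 := by ring
    rw [e] at h
    have h2 : N / (r / 2) ≤ 8 * r * Q := by
      rw [div_le_iff₀ (by linarith)]
      nlinarith [mul_le_mul_of_nonneg_left hNQ (sq_nonneg r), mul_le_mul_of_nonneg_left hEr hN]
    nlinarith
  have B3 : ∀ r t, 0 < r → r ≤ t → t ≤ 1 →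
      ‖η r‖ ^ 2 ≤ r * (2 * (‖η t‖ ^ 2 / t) + 2 * log (t / r) * Q) := by
    intro r t hr hrt ht
    have ht0 : 0 < t := hr.trans_le hrt
    have hI : (∫ s in r..t, s ^ (-(2 * (1 / 2 : ℝ)))) = log (t / r) := by
      rw [← integral_inv_of_pos hr ht0]
      congr 1; ext s
      norm_num [Real.rpow_neg_one]
    have h := two_pt η hη (1 / 2) r t r t _ Q hr hrt (Or.inl ⟨rfl, rfl⟩) hI.le
      ((H1 r t hr hrt ht).trans hPQ)
    have e : -(2 * (1 / 2 : ℝ)) = -1 := by norm_num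
    rw [e, Real.rpow_neg_one, Real.rpow_neg_one, inv_mul_eq_div, inv_mul_eq_div,
      div_le_iff₀ hr] at h
    linarith
  have B5 : ∀ r, 1 ≤ r → E * r ^ 2 ≤ 1 →
      r ^ (2 * α - 1) * ‖η r‖ ^ 2 ≤ (16 + 1 / α) * E ^ (-α) * Q := by
    intro r hr hEr
    have hrR : r ≤ R := by
      rw [← hER] at hEr
      exact (sq_le_sq₀ (by linarith) hR0.le).1 (le_of_mul_le_mul_left hEr hE)
    have hR1 : 1 ≤ R := hr.trans hrR
    have hRα : R ^ (2 * α) = E ^ (-α) := by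
      rw [hR, Real.sqrt_eq_rpow, ← Real.rpow_neg hE.le, ← Real.rpow_mul hE.le]
      congr 1; ring
    have e : -(2 * ((1 - 2 * α) / 2)) = 2 * α - 1 := by ring
    have hI : (∫ s in r..R, s ^ (-(2 * ((1 - 2 * α) / 2)))) ≤ R ^ (2 * α) / (2 * α) := by
      rw [e, integral_rpow (Or.inl (by linarith))]
      have e2 : 2 * α - 1 + 1 = 2 * α := by ring
      rw [e2]
      gcongr
      have : 0 < r ^ (2 * α) := Real.rpow_pos_of_pos (by linarith) _
      linarith
    have h := two_pt η hη _ r R r R _ Q (by linarith) hrR (Or.inl ⟨rfl, rfl⟩) hI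
      ((H2 r R hr hrR).trans hPQ)
    rw [e] at h
    have h8 := B1 R hR1 hER.ge
    have h9 : R ^ (2 * α - 1) * ‖η R‖ ^ 2 ≤ R ^ (2 * α - 1) * (8 * R * Q) := by gcongr
    have h10 : R ^ (2 * α - 1) * R = R ^ (2 * α) := by
      rw [Real.rpow_sub_one hR0.ne']; field_simp
    have h11 : R ^ (2 * α - 1) * (8 * R * Q) = 8 * R ^ (2 * α) * Q := by rw [← h10]; ring
    rw [h11] at h9
    rw [← hRα]
    refine h.trans ((add_le_add_left (mul_le_mul_of_nonneg_left h9 zero_le_two) _).trans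
      (le_of_eq ?_))
    field_simp
    ring
  -- constants
  have hEα : 0 < E ^ (-α) := Real.rpow_pos_of_pos hE _
  have hWr : 0 ≤ W ^ (1 + α) * r := by positivity
  have hWr2 : 0 ≤ W * (1 + r) ^ (-(2 * α)) * r := by positivity
  set c1 := (68 + 2 * ((1 + α) / α)) ^ (1 + α) with hc1
  have hc1p : 0 ≤ c1 := by positivity
  set K2 := 16 + 1 / α with hK2
  have hK2p : 0 ≤ K2 := by positivity
  set X := E ^ (-α) * Q with hX
  have hX0 : 0 ≤ X := by positivity
  have hind : 0 ≤ 1 / 4 * Q * (Ioo 0 (min 1 R)).indicator (fun _ => 1 / (min 1 R)) r := by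
    apply mul_nonneg (by positivity)
    apply indicator_nonneg
    intro _ _; positivity
  have hη0 : 0 ≤ E / 4 * ‖η r‖ ^ 2 := by positivity
  set U := W ^ (1 + α) * r with hU
  set Z := W * (1 + r) ^ (-(2 * α)) * r with hZ
  have hXU : 0 ≤ X * U := by positivity
  have hXZ : 0 ≤ X * Z := by positivity
  have hexp : (136 + 4 * c1 + 8 * K2) * E ^ (-α) * Q * (U + Z) =
      136 * (X * U) + 4 * (c1 * (X * U)) + 8 * (K2 * (X * U)) +
      136 * (X * Z) + 4 * (c1 * (X * Z)) + 8 * (K2 * (X * Z)) := by rw [hX]; ring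
  rw [hexp]
  have p1 : 0 ≤ c1 * (X * U) := by positivity
  have p2 : 0 ≤ c1 * (X * Z) := by positivity
  have p3 : 0 ≤ K2 * (X * U) := by positivity
  have p4 : 0 ≤ K2 * (X * Z) := by positivity
  have regI : ‖η r‖ ^ 2 ≤ 34 * r * Q → W * ‖η r‖ ^ 2 ≤ E / 4 * ‖η r‖ ^ 2 + 136 * (X * U) := by
    intro h
    have := regionI α E W (‖η r‖ ^ 2) Q r hα0 hα1 hE hW (sq_nonneg _) h
    rw [hX, hU]; linarith
  rcases le_total 1 E with hE1 | hE1
  · -- large E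
    have hR1 : R ≤ 1 := by
      rw [hR]; exact inv_le_one_of_one_le₀ (Real.one_le_sqrt.2 hE1)
    by_cases hrR : r < R / 2
    · have hmin : min 1 R = R := min_eq_right hR1
      have hmem : r ∈ Ioo 0 (min 1 R) := by rw [hmin]; exact ⟨hr, by linarith⟩
      rw [indicator_of_mem hmem, hmin]
      have h1 := B3 r (R / 2) hr hrR.le (by linarith)
      have h2 := B2 (R / 2) (by linarith) (by linarith) (by nlinarith)
      have h3 : ‖η (R / 2)‖ ^ 2 / (R / 2) ≤ 34 * Q := by
        rw [div_le_iff₀ (by positivity)]; linarith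
      have h4 : log (R / 2 / r) ≤ log (R / r) := by
        apply Real.log_le_log (by positivity); gcongr; linarith
      have h5 : ‖η r‖ ^ 2 ≤ r * (68 + 2 * log (R / r)) * Q := by
        refine h1.trans ?_
        rw [mul_assoc r]
        apply mul_le_mul_of_nonneg_left _ hr.le
        nlinarith [mul_le_mul_of_nonneg_right h4 hQ]
      have h6 := regionII α E W Q r R 68 hα0 hα1 hE hW hQ hr (by linarith) (by norm_num) hER.le
      have h7 := mul_le_mul_of_nonneg_left h5 hW
      have h8 : 4 * c1 * E ^ (-α) * Q * U = 4 * (c1 * (X * U)) := by rw [hX]; ring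
      rw [← hc1, ← hU, h8] at h6
      linarith
    · have hb : ‖η r‖ ^ 2 ≤ 34 * r * Q := by
        push Not at hrR
        have h4 : 1 ≤ 4 * (E * r ^ 2) := by
          rw [← hER]
          have h3 : (R / 2) ^ 2 ≤ r ^ 2 := pow_le_pow_left₀ (by positivity) hrR 2
          have h5 := mul_le_mul_of_nonneg_left h3 hE.le
          linarith
        rcases le_total r 1 with h | h
        · exact B2 r hr h h4
        · have h5 : 1 ≤ r ^ 2 := one_le_pow₀ h
          have h6 : 1 ≤ E * r ^ 2 := one_le_mul_of_one_le_of_one_le hE1 h5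
          have h7 := B1 r h h6
          have h8 := mul_nonneg hr.le hQ
          linarith
      have := regI hb
      linarith
  · -- small E
    have hR1 : 1 ≤ R := by
      rw [hR]; exact (one_le_inv₀ hsE).2 (Real.sqrt_le_one.2 hE1)
    have hmin : min 1 R = 1 := min_eq_left hR1
    rcases lt_or_ge r 1 with h | h
    · have hmem : r ∈ Ioo 0 (min 1 R) := by rw [hmin]; exact ⟨hr, h⟩
      rw [indicator_of_mem hmem, hmin]
      have h1 := B3 r 1 hr h.le le_rfl
      have h2 := B5 1 le_rfl (by linarith)
      rw [Real.one_rpow, one_mul, mul_assoc, ← hX] at h2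
      rw [div_one] at h1
      have h3 := regionII α E W Q r 1 0 hα0 hα1 hE hW hQ hr h le_rfl (by linarith)
      have hcc : (0 + 2 * ((1 + α) / α)) ^ (1 + α) ≤ c1 := by
        rw [hc1]; gcongr; norm_num
      have h4 : 4 * (0 + 2 * ((1 + α) / α)) ^ (1 + α) * E ^ (-α) * Q * (W ^ (1 + α) * r) ≤
          4 * (c1 * (X * U)) := by
        calc _ ≤ 4 * c1 * E ^ (-α) * Q * (W ^ (1 + α) * r) := by gcongr
          _ = _ := by rw [hX, hU]; ring
      have h5 : W * ‖η r‖ ^ 2 ≤ W * r * (2 * (K2 * X)) +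
          W * (r * (0 + 2 * log (1 / r)) * Q) := by
        have := mul_le_mul_of_nonneg_left h1 hW
        have h6 := mul_le_mul_of_nonneg_left h2 (mul_nonneg hW hr.le)
        nlinarith
      have h6 := weight_small α r hα0 hα1 hr h.le
      have h7 : W * r * (2 * (K2 * X)) ≤ W * r * (2 * (K2 * X)) * (4 * (1 + r) ^ (-(2 * α))) :=
        le_mul_of_one_le_right (by positivity) h6
      have h8 : W * r * (2 * (K2 * X)) * (4 * (1 + r) ^ (-(2 * α))) = 8 * (K2 * (X * Z)) := by
        rw [hZ]; ring
      linarith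
    · rcases le_total (E * r ^ 2) 1 with h' | h'
      · have h2 := B5 r h h'
        rw [mul_assoc, ← hX] at h2
        have h3 : ‖η r‖ ^ 2 ≤ r * r ^ (-(2 * α)) * (K2 * X) := by
          have h4 : r * r ^ (-(2 * α)) * r ^ (2 * α - 1) = 1 := by
            rw [Real.rpow_sub_one hr.ne', Real.rpow_neg hr.le]
            field_simp
          calc ‖η r‖ ^ 2 = r * r ^ (-(2 * α)) * (r ^ (2 * α - 1) * ‖η r‖ ^ 2) := by
                rw [← mul_assoc, h4, one_mul]
            _ ≤ _ := by gcongr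
        have h5 := weight_large α r hα0 hα1 h
        have h6 : ‖η r‖ ^ 2 ≤ r * (4 * (1 + r) ^ (-(2 * α))) * (K2 * X) := by
          refine h3.trans ?_
          gcongr
        have h7 := mul_le_mul_of_nonneg_left h6 hW
        have h8 : W * (r * (4 * (1 + r) ^ (-(2 * α))) * (K2 * X)) = 4 * (K2 * (X * Z)) := by
          rw [hZ]; ring
        linarith
      · have := regI (by have := B1 r h h'; nlinarith [mul_nonneg hr.le hQ])
        linarith

lemma form_facts (η : ℝ → ℂ) (hη : ContDiff ℝ 1 η) (hcs : HasCompactSupport η)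
    (hsub : tsupport η ⊆ Ioi 0) :
    Integrable (fun r => ‖η r‖ ^ 2) ∧
    (∀ k : ℝ, Integrable (fun s => ‖deriv η s - (k / s) • η s‖ ^ 2)) ∧
    ∀ α : ℝ, (∫ r in Ioi (0:ℝ), ‖deriv η r‖ ^ 2) - α * ‖η 1‖ ^ 2 -
              (1 / 4) * (∫ r in Ioc (0:ℝ) 1, ‖η r‖ ^ 2 / r ^ 2) +
              (α ^ 2 - 1 / 4) * (∫ r in Ioi (1:ℝ), ‖η r‖ ^ 2 / r ^ 2) =
      (∫ s in Ioc (0:ℝ) 1, ‖deriv η s - ((1 / 2) / s) • η s‖ ^ 2) +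
      ∫ s in Ioi (1:ℝ), ‖deriv η s - (((1 - 2 * α) / 2) / s) • η s‖ ^ 2 := by
  have hd : ∀ s, HasDerivAt η (deriv η s) s := fun s =>
    (hη.differentiable one_ne_zero s).hasDerivAt
  have hc : Continuous (deriv η) := hη.continuous_deriv le_rfl
  have hc0 : Continuous η := hη.continuous
  set ψ : ℝ → ℂ := fun s => (s⁻¹ : ℝ) • η s with hψ
  have hψs : tsupport ψ ⊆ tsupport η := by
    apply closure_mono
    intro s hs h
    apply hs
    simp only [hψ]
    rw [h, smul_zero]
  have hψcs : HasCompactSupport ψ := hcs.mono' ((subset_tsupport ψ).trans hψs)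
  have hψc : Continuous ψ := by
    apply continuous_of_tsupport
    intro s hs
    have hs0 : (0:ℝ) < s := hsub (hψs hs)
    exact (continuousAt_inv₀ hs0.ne').smul hc0.continuousAt
  have hdcs : HasCompactSupport (deriv η) := hcs.deriv
  have hg : ∀ (k s : ℝ), deriv η s - (k / s) • η s = deriv η s - k • ψ s := by
    intro k s
    simp only [hψ]
    rw [smul_smul, div_eq_mul_inv]
  have sqint : ∀ f : ℝ → ℂ, Continuous f → HasCompactSupport f →
      Integrable (fun s => ‖f s‖ ^ 2) := by
    intro f hf hfc
    apply Continuous.integrable_of_hasCompactSupport (by fun_prop)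
    apply hfc.mono
    intro s hs h
    apply hs
    simp only [h, norm_zero]
    norm_num
  have hgint : ∀ k : ℝ, Integrable (fun s => ‖deriv η s - (k / s) • η s‖ ^ 2) := by
    intro k
    simp_rw [hg]
    apply sqint (fun s => deriv η s - k • ψ s) (by fun_prop)
    have hk : HasCompactSupport (fun s => k • ψ s) := by
      apply hψcs.mono
      intro s hs h
      apply hs
      simp only [h, smul_zero]
    exact hdcs.sub hk
  refine ⟨sqint η hc0 hcs, hgint, ?_⟩
  intro α
  set D : ℝ → ℝ := fun s => 2 * inner ℝ (ψ s) (deriv η s) - ‖ψ s‖ ^ 2 with hD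
  have hDc : Continuous D := by fun_prop
  have hDcs : HasCompactSupport D := by
    apply hψcs.mono
    intro s hs h
    apply hs
    simp only [hD, h, inner_zero_left, norm_zero]
    norm_num
  have hDint : Integrable D := hDc.integrable_of_hasCompactSupport hDcs
  set G : ℝ → ℝ := fun s => s⁻¹ * ‖η s‖ ^ 2 with hG
  have hGcs : HasCompactSupport G := by
    apply hcs.mono
    intro s hs h
    apply hs
    simp only [hG, h, norm_zero]
    norm_num
  have hGd : ∀ s, HasDerivAt G (D s) s := by
    intro s
    by_cases hs : s = 0
    · subst hs
      have h0 : (0:ℝ) ∉ tsupport η := fun h => lt_irrefl (0:ℝ) (hsub h)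
      have hev : G =ᶠ[nhds 0] fun _ => 0 := by
        filter_upwards [notMem_tsupport_iff_eventuallyEq.1 h0] with s hs
        simp only [hG, hs, Pi.zero_apply, norm_zero]
        norm_num
      have hD0 : D 0 = 0 := by simp [hD, hψ]
      rw [hD0]
      exact (hasDerivAt_const (0:ℝ) (0:ℝ)).congr_of_eventuallyEq hev
    · have h1 := (hasDerivAt_inv hs).mul (hd s).norm_sq
      refine HasDerivAt.congr_deriv h1 ?_
      simp only [hD, hψ, norm_smul, inner_smul_left, mul_pow, Real.norm_eq_abs, sq_abs]
      simp
      ring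
  have hG1 : G 1 = ‖η 1‖ ^ 2 := by simp [hG]
  have hG0 : G 0 = 0 := by simp [hG]
  have hI1 : (∫ s in Ioc (0:ℝ) 1, D s) = ‖η 1‖ ^ 2 := by
    rw [← intervalIntegral.integral_of_le zero_le_one,
      intervalIntegral.integral_eq_sub_of_hasDerivAt (fun s _ => hGd s)
        (hDc.intervalIntegrable _ _), hG1, hG0, sub_zero]
  have hI2 : (∫ s in Ioi (1:ℝ), D s) = - ‖η 1‖ ^ 2 := by
    have hGc : Continuous G := continuous_iff_continuousAt.2 fun s => (hGd s).continuousAt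
    have ht : Filter.Tendsto G Filter.atTop (nhds 0) :=
      (hGcs.is_zero_at_infty).mono_left atTop_le_cocompact
    rw [integral_Ioi_of_hasDerivAt_of_tendsto' (fun s _ => hGd s) hDint.integrableOn ht, hG1,
      zero_sub]
  have hexp : ∀ k s : ℝ, ‖deriv η s - (k / s) • η s‖ ^ 2 =
      ‖deriv η s‖ ^ 2 + (k ^ 2 - k) * ‖ψ s‖ ^ 2 - k * D s := by
    intro k s
    rw [hg, norm_sub_sq_real, norm_smul, mul_pow, Real.norm_eq_abs, sq_abs, inner_smul_right,
      real_inner_comm]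
    simp only [hD]
    ring
  have hψ2 : ∀ s, ‖η s‖ ^ 2 / s ^ 2 = ‖ψ s‖ ^ 2 := by
    intro s
    simp only [hψ, norm_smul, mul_pow, Real.norm_eq_abs, sq_abs]
    rw [inv_pow, inv_mul_eq_div]
  have i1 := sqint _ hc hdcs
  have i2 := sqint _ hψc hψcs
  have hint : ∀ (k : ℝ) (S : Set ℝ), (∫ s in S, ‖deriv η s - (k / s) • η s‖ ^ 2) =
      (∫ s in S, ‖deriv η s‖ ^ 2) + (k ^ 2 - k) * (∫ s in S, ‖ψ s‖ ^ 2) - k * ∫ s in S, D s := by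
    intro k S
    simp_rw [hexp]
    have j12 : IntegrableOn (fun s => ‖deriv η s‖ ^ 2 + (k ^ 2 - k) * ‖ψ s‖ ^ 2) S :=
      i1.integrableOn.add (i2.integrableOn.const_mul _)
    rw [integral_sub j12 (hDint.integrableOn.const_mul _), integral_add i1.integrableOn (i2.integrableOn.const_mul _),
      integral_const_mul, integral_const_mul]
  rw [hint, hint, hI1, hI2]
  simp_rw [hψ2]
  have hsplit : (∫ r in Ioi (0:ℝ), ‖deriv η r‖ ^ 2) =
      (∫ r in Ioc (0:ℝ) 1, ‖deriv η r‖ ^ 2) + ∫ r in Ioi (1:ℝ), ‖deriv η r‖ ^ 2 := by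
    rw [← Ioc_union_Ioi_eq_Ioi (zero_le_one : (0:ℝ) ≤ 1)]
    exact setIntegral_union (by
      rw [Set.disjoint_left]; intro x hx hx2; exact absurd hx.2 (not_le.2 hx2)) measurableSet_Ioi
      i1.integrableOn i1.integrableOn
  rw [hsplit]
  ring

/-- The lowest eigenvalue bound for the operator `T_α`, in quadratic-form formulation,
for `C¹` compactly supported test functions `η` on `(0,∞)`. -/
theorem lowest_eigenvalue_bound_Talpha
    (α : ℝ) (hα0 : 0 < α) (hα1 : α < 1) :
    ∃ C : ℝ, 0 < C ∧
      ∀ (v : ℝ → ℝ), Measurable v →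
        IntegrableOn (fun r => max (-v r) 0 ^ (1 + α) * r) (Ioi 0) volume →
        IntegrableOn (fun r => max (-v r) 0 * (1 + r) ^ (-(2 * α)) * r) (Ioi 0) volume →
        ∀ (η : ℝ → ℂ), ContDiff ℝ 1 η → HasCompactSupport η → tsupport η ⊆ Ioi 0 →
          IntegrableOn (fun r => v r * ‖η r‖ ^ 2) (Ioi 0) volume →
          (∫ r in Ioi (0:ℝ), ‖deriv η r‖ ^ 2) - α * ‖η 1‖ ^ 2 -
              (1 / 4) * (∫ r in Ioc (0:ℝ) 1, ‖η r‖ ^ 2 / r ^ 2) +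
              (α ^ 2 - 1 / 4) * (∫ r in Ioi (1:ℝ), ‖η r‖ ^ 2 / r ^ 2) +
              (∫ r in Ioi (0:ℝ), v r * ‖η r‖ ^ 2) ≥
            - (C * ((∫ r in Ioi (0:ℝ), max (-v r) 0 ^ (1 + α) * r) +
                  ∫ r in Ioi (0:ℝ), max (-v r) 0 * (1 + r) ^ (-(2 * α)) * r)) ^ (1 / α) *
              ∫ r in Ioi (0:ℝ), ‖η r‖ ^ 2 := by
  set K := 136 + 4 * (68 + 2 * ((1 + α) / α)) ^ (1 + α) + 8 * (16 + 1 / α) with hK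
  have hK0 : 0 < K := by positivity
  refine ⟨2 * K, by positivity, ?_⟩
  intro v hv hA hB η hη hcs hsub hvη
  obtain ⟨iη, ig, hform⟩ := form_facts η hη hcs hsub
  rw [hform α]
  set A := ∫ r in Ioi (0:ℝ), max (-v r) 0 ^ (1 + α) * r with hAdef
  set B := ∫ r in Ioi (0:ℝ), max (-v r) 0 * (1 + r) ^ (-(2 * α)) * r with hBdef
  set N := ∫ r in Ioi (0:ℝ), ‖η r‖ ^ 2 with hNdef
  set P1 := ∫ s in Ioc (0:ℝ) 1, ‖deriv η s - ((1 / 2) / s) • η s‖ ^ 2 with hP1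
  set P2 := ∫ s in Ioi (1:ℝ), ‖deriv η s - (((1 - 2 * α) / 2) / s) • η s‖ ^ 2 with hP2
  have hP10 : 0 ≤ P1 := integral_nonneg fun s => sq_nonneg _
  have hP20 : 0 ≤ P2 := integral_nonneg fun s => sq_nonneg _
  have hN0 : 0 ≤ N := integral_nonneg fun s => sq_nonneg _
  have hA0 : 0 ≤ A := setIntegral_nonneg measurableSet_Ioi fun r hr => by
    have : (0:ℝ) < r := hr
    positivity
  have hB0 : 0 ≤ B := setIntegral_nonneg measurableSet_Ioi fun r hr => by
    have : (0:ℝ) < r := hr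
    positivity
  have mono : ∀ (f : ℝ → ℝ) (S : Set ℝ) (a b : ℝ), Integrable f → (∀ s, 0 ≤ f s) → a ≤ b →
      Ioc a b ⊆ S → (∫ s in a..b, f s) ≤ ∫ s in S, f s := by
    intro f S a b hf h0 hab hS
    rw [intervalIntegral.integral_of_le hab]
    exact setIntegral_mono_set hf.integrableOn (Filter.Eventually.of_forall h0)
      (Filter.Eventually.of_forall hS)
  have H1 : ∀ a b, 0 < a → a ≤ b → b ≤ 1 →
      (∫ s in a..b, ‖deriv η s - ((1 / 2) / s) • η s‖ ^ 2) ≤ P1 + P2 := by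
    intro a b ha hab hb
    have := mono _ (Ioc 0 1) a b (ig (1 / 2)) (fun s => sq_nonneg _) hab
      (Ioc_subset_Ioc ha.le hb)
    linarith
  have H2 : ∀ a b, 1 ≤ a → a ≤ b →
      (∫ s in a..b, ‖deriv η s - (((1 - 2 * α) / 2) / s) • η s‖ ^ 2) ≤ P1 + P2 := by
    intro a b ha hab
    have := mono _ (Ioi 1) a b (ig ((1 - 2 * α) / 2)) (fun s => sq_nonneg _) hab
      (fun s hs => ha.trans_lt hs.1)
    linarith
  have HN : ∀ a b, 0 < a → a ≤ b → (∫ s in a..b, ‖η s‖ ^ 2) ≤ N := by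
    intro a b ha hab
    exact mono _ (Ioi 0) a b iη (fun s => sq_nonneg _) hab (fun s hs => ha.trans hs.1)
  set E0 := (2 * K * (A + B)) ^ (1 / α) with hE0
  have hS0 : 0 ≤ 2 * K * (A + B) := by positivity
  have hE00 : 0 ≤ E0 := by positivity
  have main : ∀ E, E0 < E → -(E * N) ≤ P1 + P2 + ∫ r in Ioi (0:ℝ), v r * ‖η r‖ ^ 2 := by
    intro E hE
    have hEp : 0 < E := hE00.trans_lt hE
    have hEα : 2 * K * (A + B) ≤ E ^ α := by
      have h1 := Real.rpow_le_rpow hE00 hE.le hα0.le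
      rw [hE0, ← Real.rpow_mul hS0, one_div, inv_mul_cancel₀ hα0.ne', Real.rpow_one] at h1
      exact h1
    set L := min 1 (√E)⁻¹ with hL
    have hL0 : 0 < L := lt_min one_pos (inv_pos.2 (Real.sqrt_pos.2 hEp))
    set Q := P1 + P2 + E * N with hQ
    have hQ0 : 0 ≤ Q := by positivity
    set u : ℝ → ℝ := (Ioo 0 L).indicator (fun _ => 1 / L) with hu
    have hui : IntegrableOn u (Ioi 0) := by
      apply Integrable.integrableOn
      rw [hu, integrable_indicator_iff measurableSet_Ioo]
      exact integrableOn_const (by simp)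
    have hu1 : (∫ r in Ioi (0:ℝ), u r) = 1 := by
      rw [hu, setIntegral_indicator measurableSet_Ioo]
      have : Ioi (0:ℝ) ∩ Ioo 0 L = Ioo 0 L := inter_eq_right.2 (fun x hx => hx.1)
      rw [this, setIntegral_const]
      simp [Measure.real, hL0.le, hL0.ne']
    have hpt : ∀ r ∈ Ioi (0:ℝ), -(v r * ‖η r‖ ^ 2) ≤ E / 4 * ‖η r‖ ^ 2 +
        K * E ^ (-α) * Q * (max (-v r) 0 ^ (1 + α) * r +
          max (-v r) 0 * (1 + r) ^ (-(2 * α)) * r) + 1 / 4 * Q * u r := by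
      intro r hr
      have h := bound_pt α E (P1 + P2) N η hη hα0 hα1 hEp (by positivity) hN0 H1 H2 HN
        (max (-v r) 0) r (le_max_right _ _) hr
      refine le_trans ?_ h
      have : -v r * ‖η r‖ ^ 2 ≤ max (-v r) 0 * ‖η r‖ ^ 2 :=
        mul_le_mul_of_nonneg_right (le_max_left _ _) (sq_nonneg _)
      linarith
    have j1 : IntegrableOn (fun r => E / 4 * ‖η r‖ ^ 2) (Ioi 0) := iη.integrableOn.const_mul _
    have j2 : IntegrableOn (fun r => K * E ^ (-α) * Q * (max (-v r) 0 ^ (1 + α) * r +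
          max (-v r) 0 * (1 + r) ^ (-(2 * α)) * r)) (Ioi 0) := (hA.add hB).const_mul _
    have j3 : IntegrableOn (fun r => 1 / 4 * Q * u r) (Ioi 0) := hui.const_mul _
    have hI := setIntegral_mono_on hvη.neg ((j1.add j2).add j3) measurableSet_Ioi hpt
    have hr : (∫ r in Ioi (0:ℝ), (E / 4 * ‖η r‖ ^ 2 +
        K * E ^ (-α) * Q * (max (-v r) 0 ^ (1 + α) * r +
          max (-v r) 0 * (1 + r) ^ (-(2 * α)) * r) + 1 / 4 * Q * u r)) =
        E / 4 * N + K * E ^ (-α) * Q * (A + B) + 1 / 4 * Q * 1 := by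
      have j12 : IntegrableOn (fun r => E / 4 * ‖η r‖ ^ 2 +
        K * E ^ (-α) * Q * (max (-v r) 0 ^ (1 + α) * r +
          max (-v r) 0 * (1 + r) ^ (-(2 * α)) * r)) (Ioi 0) := j1.add j2
      rw [integral_add j12 j3, integral_add j1 j2, integral_const_mul, integral_const_mul,
        integral_const_mul, integral_add hA hB, hu1]
    have hl : (∫ r in Ioi (0:ℝ), -(v r * ‖η r‖ ^ 2)) = -∫ r in Ioi (0:ℝ), v r * ‖η r‖ ^ 2 :=
      integral_neg _
    have hI' : (∫ r in Ioi (0:ℝ), -(v r * ‖η r‖ ^ 2)) ≤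
        E / 4 * N + K * E ^ (-α) * Q * (A + B) + 1 / 4 * Q * 1 := by
      rw [← hr]; exact hI
    rw [hl] at hI'
    have hKE : K * E ^ (-α) * Q * (A + B) ≤ 1 / 2 * Q := by
      have hEm : E ^ (-α) * E ^ α = 1 := by
        rw [← Real.rpow_add hEp]; simp
      have h3 := mul_le_mul_of_nonneg_left hEα (Real.rpow_pos_of_pos hEp (-α)).le
      rw [hEm] at h3
      have h4 := mul_le_mul_of_nonneg_right h3 hQ0
      linarith
    have hEN : E * N ≤ Q := by linarith
    linarith
  have hfin : -(E0 * N) ≤ P1 + P2 + ∫ r in Ioi (0:ℝ), v r * ‖η r‖ ^ 2 := by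
    have hcl : Filter.Tendsto (fun E : ℝ => -(E * N)) (nhdsWithin E0 (Ioi E0))
        (nhds (-(E0 * N))) :=
      (Continuous.tendsto (by fun_prop) E0).mono_left nhdsWithin_le_nhds
    exact le_of_tendsto hcl (by
      filter_upwards [self_mem_nhdsWithin] with E hE using main E hE)
  rw [ge_iff_le, neg_mul]
  exact hfin
end

section
/- Let 0 < α < 1. Then there is no constant S > 0 such that the inequality ( ∫₀^∞ (1+r)^{-2α} |φ'(r)|² r dr )^{1/(1+α)} ( ∫₀^∞ (1+r)^{-2α} |φ(r)|² r dr )^{α/(1+α)} ≥ S ( ∫₀^∞ (1+r)^{-2(1+α)} |φ(r)|^{2(1+α)/α} r dr )^{α/(1+α)} holds for all locally absolutely continuous functions φ : (0,∞) → ℝ for which the two integrals on the left side are finite. Equivalently, for every S > 0 there exists such a φ violating the inequality. -/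
open MeasureTheory Real Set

lemma aux_upper (α R c : ℝ) (hα1 : α < 1) (hR : 0 < R) (f : ℝ → ℝ) (hf : Measurable f)
    (h0 : ∀ r, 0 < r → 0 ≤ f r) (h1 : ∀ r, 0 < r → r ≤ R → f r ≤ c * r ^ (1 - 2 * α))
    (h2 : ∀ r, R < r → f r = 0) :
    IntegrableOn f (Ioi 0) volume ∧ 0 ≤ ∫ r in Ioi (0:ℝ), f r ∧
      ∫ r in Ioi (0:ℝ), f r ≤ c * (R ^ (2 - 2 * α) / (2 - 2 * α)) := by
  have hg0 : IntegrableOn (fun r : ℝ => c * r ^ (1 - 2 * α)) (Ioc 0 R) volume := by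
    have := (intervalIntegral.intervalIntegrable_rpow' (a := 0) (b := R) (r := 1 - 2 * α)
      (by linarith)).const_mul c
    exact (intervalIntegrable_iff_integrableOn_Ioc_of_le hR.le).1 this
  have hg : IntegrableOn ((Ioc 0 R).indicator (fun r : ℝ => c * r ^ (1 - 2 * α))) (Ioi 0) volume :=
    ((integrable_indicator_iff measurableSet_Ioc).2 hg0).integrableOn
  have hle : ∀ r, 0 < r → f r ≤ (Ioc 0 R).indicator (fun r : ℝ => c * r ^ (1 - 2 * α)) r := by
    intro r hr
    by_cases h : r ≤ R
    · have hm : r ∈ Ioc 0 R := ⟨hr, h⟩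
      rw [indicator_of_mem hm]
      exact h1 r hr h
    · rw [indicator_of_notMem (fun h' => h h'.2), h2 r (not_le.1 h)]
  have hfi : IntegrableOn f (Ioi 0) volume := by
    refine hg.mono' hf.aestronglyMeasurable ?_
    filter_upwards [ae_restrict_mem measurableSet_Ioi] with r hr
    rw [Real.norm_of_nonneg (h0 r hr)]
    exact hle r hr
  refine ⟨hfi, setIntegral_nonneg measurableSet_Ioi h0, ?_⟩
  refine (setIntegral_mono_on hfi hg measurableSet_Ioi hle).trans (le_of_eq ?_)
  have hs : Ioi 0 ∩ Ioc 0 R = Ioc 0 R := inter_eq_right.2 (fun x hx => hx.1)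
  rw [setIntegral_indicator measurableSet_Ioc,
    hs, integral_const_mul,
    ← intervalIntegral.integral_of_le hR.le, integral_rpow (Or.inl (by linarith)),
    Real.zero_rpow (by linarith), sub_zero]
  congr 2 <;> ring_nf

lemma aux_pow (α r : ℝ) (hα0 : 0 < α) (hr : 0 < r) :
    (1 + r) ^ (-(2 * α)) * r ≤ r ^ (1 - 2 * α) := by
  have h : r ^ (1 - 2 * α) = r ^ (-(2 * α)) * r := by
    rw [sub_eq_neg_add, Real.rpow_add hr, Real.rpow_one]
  rw [h]
  refine mul_le_mul_of_nonneg_right ?_ hr.le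
  exact Real.rpow_le_rpow_of_nonpos hr (by linarith) (by linarith)

lemma aux_ftc (R : ℝ) (hR : 0 < R) (a b : ℝ) :
    IntervalIntegrable (fun r : ℝ => if r < R then -(1 / R) else 0) volume a b ∧
    max 0 (1 - b / R) - max 0 (1 - a / R) = ∫ t in a..b, if t < R then -(1 / R) else 0 := by
  have hR' : 0 < 1 / R := by positivity
  have hm : Monotone (fun r : ℝ => if r < R then -(1 / R) else 0) := by
    intro x y hxy
    dsimp only
    split_ifs <;> linarith
  refine ⟨hm.intervalIntegrable, ?_⟩
  symm
  refine intervalIntegral.integral_eq_sub_of_hasDeriv_right (f := fun r => max 0 (1 - r / R))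
    (by fun_prop) ?_ hm.intervalIntegrable
  intro x _
  split_ifs with h
  · have : HasDerivAt (fun r : ℝ => 1 - r / R) (-(1 / R)) x := by
      simpa using ((hasDerivAt_id x).div_const R).const_sub 1
    refine (this.congr_of_eventuallyEq ?_).hasDerivWithinAt
    filter_upwards [Iio_mem_nhds h] with r hr
    refine max_eq_right ?_
    rw [sub_nonneg, div_le_one hR]
    exact (mem_Iio.1 hr).le
  · have : ∀ r, x ≤ r → max 0 (1 - r / R) = 0 := by
      intro r hr
      refine max_eq_left ?_
      rw [sub_nonpos, one_le_div hR]
      linarith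
    exact (hasDerivWithinAt_const x (Ioi x) (0:ℝ)).congr (fun r hr => this r (le_of_lt hr))
      (this x le_rfl)

lemma aux_lower (α R : ℝ) (hα0 : 0 < α) (hα1 : α < 1) (hR : 2 ≤ R) :
    (2:ℝ) ^ (-(2 * (1 + α))) * (1 / 2) ^ (2 * (1 + α) / α) * (1 / 2) * (1 / 2) ≤
    ∫ r in Ioi (0:ℝ),
      (1 + r) ^ (-(2 * (1 + α))) * |max 0 (1 - r / R)| ^ (2 * (1 + α) / α) * r := by
  have hR0 : 0 < R := by linarith
  have hp : 0 < 2 * (1 + α) / α := by positivity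
  have hfi : IntegrableOn (fun r : ℝ =>
      (1 + r) ^ (-(2 * (1 + α))) * |max 0 (1 - r / R)| ^ (2 * (1 + α) / α) * r) (Ioi 0) := by
    refine (aux_upper 0 R 1 (by norm_num) hR0 _ (by fun_prop) ?_ ?_ ?_).1
    · intro r hr; positivity
    · intro r hr hrR
      simp only [mul_zero, sub_zero, Real.rpow_one]
      refine mul_le_mul_of_nonneg_right ?_ hr.le
      refine mul_le_one₀ ?_ (by positivity) ?_
      · exact Real.rpow_le_one_of_one_le_of_nonpos (by linarith) (by linarith)
      · refine Real.rpow_le_one (abs_nonneg _) ?_ hp.le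
        rw [abs_of_nonneg (le_max_left _ _)]
        have : 0 < r / R := by positivity
        exact max_le (by norm_num) (by linarith)
    · intro r hr
      have : max 0 (1 - r / R) = 0 := by
        refine max_eq_left ?_
        rw [sub_nonpos, one_le_div hR0]
        linarith
      rw [this, abs_zero, Real.zero_rpow hp.ne']
      simp
  set c : ℝ := (2:ℝ) ^ (-(2 * (1 + α))) * (1 / 2) ^ (2 * (1 + α) / α) * (1 / 2) with hc
  have hsub : Ioc (1/2:ℝ) 1 ⊆ Ioi 0 := fun x hx => by
    have := hx.1
    simp only [mem_Ioi]; linarith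
  have h1 : c * (1 / 2) = ∫ r in Ioc (1/2:ℝ) 1, c := by
    rw [setIntegral_const]
    simp [Measure.real]
    norm_num
    ring
  rw [h1]
  refine (setIntegral_mono_on (integrableOn_const (by simp)) (hfi.mono_set hsub)
    measurableSet_Ioc ?_).trans (setIntegral_mono_set hfi ?_ hsub.eventuallyLE)
  · intro r hr
    have hr1 := hr.1
    have hr2 := hr.2
    rw [hc]
    have e : (1/2:ℝ) ≤ |max 0 (1 - r / R)| := by
      rw [abs_of_nonneg (le_max_left _ _)]
      refine le_trans ?_ (le_max_right _ _)
      have : r / R ≤ 1 / 2 := by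
        rw [div_le_div_iff₀ hR0 (by norm_num)]; linarith
      linarith
    have e1 : (2:ℝ) ^ (-(2 * (1 + α))) ≤ (1 + r) ^ (-(2 * (1 + α))) :=
      Real.rpow_le_rpow_of_nonpos (by linarith) (by linarith) (by linarith)
    have e2 := Real.rpow_le_rpow (by norm_num) e hp.le
    have : 0 < 1 + r := by linarith
    gcongr
  · filter_upwards [ae_restrict_mem measurableSet_Ioi] with r hr
    have : 0 < r := hr
    simp only [Pi.zero_apply]
    positivity

/-- Appendix B: failure of the one-term Sobolev interpolation inequality
(B.3) for `0 < α < 1`. -/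
theorem sobolev_interpolation_fails
    (α : ℝ) (hα0 : 0 < α) (hα1 : α < 1) :
    ¬ ∃ S : ℝ, 0 < S ∧
      ∀ (φ φ' : ℝ → ℝ),
        (∀ a b : ℝ, 0 < a → a ≤ b →
          IntervalIntegrable φ' volume a b ∧ φ b - φ a = ∫ t in a..b, φ' t) →
        IntegrableOn (fun r => (1 + r) ^ (-(2 * α)) * φ' r ^ 2 * r) (Ioi 0) volume →
        IntegrableOn (fun r => (1 + r) ^ (-(2 * α)) * φ r ^ 2 * r) (Ioi 0) volume →
        (∫ r in Ioi (0:ℝ), (1 + r) ^ (-(2 * α)) * φ' r ^ 2 * r) ^ (1 / (1 + α)) *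
            (∫ r in Ioi (0:ℝ), (1 + r) ^ (-(2 * α)) * φ r ^ 2 * r) ^ (α / (1 + α)) ≥
          S * (∫ r in Ioi (0:ℝ),
              (1 + r) ^ (-(2 * (1 + α))) * |φ r| ^ (2 * (1 + α) / α) * r) ^ (α / (1 + α)) := by
  rintro ⟨S, hS, H⟩
  set c : ℝ := (2:ℝ) ^ (-(2 * (1 + α))) * (1 / 2) ^ (2 * (1 + α) / α) * (1 / 2) * (1 / 2) with hc
  have hc0 : 0 < c := by positivity
  set K : ℝ := 1 / (2 - 2 * α) with hK
  have hK0 : 0 < K := by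
    have : 0 < 2 - 2 * α := by linarith
    positivity
  have h1α : 0 < 1 + α := by linarith
  have key : ∀ R : ℝ, 2 ≤ R → S * c ^ (α / (1 + α)) ≤ K * R ^ (-(2 * α ^ 2 / (1 + α))) := by
    intro R hR
    have hR0 : 0 < R := by linarith
    have hmeas : Measurable (fun r : ℝ => if r < R then -(1 / R) else (0:ℝ)) :=
      Measurable.ite measurableSet_Iio measurable_const measurable_const
    obtain ⟨iA, pA, bA⟩ := aux_upper α R (R ^ (-2:ℝ)) hα1 hR0
      (fun r => (1 + r) ^ (-(2 * α)) * (if r < R then -(1 / R) else 0) ^ 2 * r)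
      (by fun_prop) (by intro r hr; positivity)
      (by
        intro r hr _
        have hR2 : R ^ (-2:ℝ) = (-(1 / R)) ^ 2 := by
          rw [Real.rpow_neg hR0.le]; norm_num
        have hb : (if r < R then -(1 / R) else (0:ℝ)) ^ 2 ≤ R ^ (-2:ℝ) := by
          split_ifs
          · rw [hR2]
          · simp; positivity
        have h3 := aux_pow α r hα0 hr
        calc _ = (if r < R then -(1 / R) else (0:ℝ)) ^ 2 * ((1 + r) ^ (-(2 * α)) * r) := by ring
          _ ≤ _ := by gcongr)
      (by
        intro r hr
        rw [if_neg (by linarith)]; simp)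
    obtain ⟨iB, pB, bB⟩ := aux_upper α R 1 hα1 hR0
      (fun r => (1 + r) ^ (-(2 * α)) * (max 0 (1 - r / R)) ^ 2 * r)
      (by fun_prop) (by intro r hr; positivity)
      (by
        intro r hr _
        have hb : (max 0 (1 - r / R)) ^ 2 ≤ 1 := by
          refine pow_le_one₀ (le_max_left _ _) (max_le (by norm_num) ?_)
          have : 0 < r / R := by positivity
          linarith
        have h3 := aux_pow α r hα0 hr
        calc _ = (max 0 (1 - r / R)) ^ 2 * ((1 + r) ^ (-(2 * α)) * r) := by ring
          _ ≤ _ := by gcongr)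
      (by
        intro r hr
        have : max 0 (1 - r / R) = 0 := by
          refine max_eq_left ?_
          rw [sub_nonpos, one_le_div hR0]
          linarith
        rw [this]; simp)
    have hC := aux_lower α R hα0 hα1 hR
    have h := H (fun r => max 0 (1 - r / R)) (fun r => if r < R then -(1 / R) else 0)
      (fun a b _ _ => aux_ftc R hR0 a b) iA iB
    have hq : 0 ≤ α / (1 + α) := by positivity
    have hq1 : 0 ≤ 1 / (1 + α) := by positivity
    have l1 := Real.rpow_le_rpow hc0.le hC hq
    have l2 := Real.rpow_le_rpow pA bA hq1
    have l3 := Real.rpow_le_rpow pB bB hq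
    refine (mul_le_mul_of_nonneg_left l1 hS.le).trans (h.le.trans
      ((mul_le_mul l2 l3 (by positivity) (by
        have : 0 < 2 - 2 * α := by linarith
        positivity)).trans (le_of_eq ?_)))
    have eA : R ^ (-2:ℝ) * (R ^ (2 - 2 * α) / (2 - 2 * α)) = K * R ^ (-(2 * α)) := by
      rw [hK, show -(2 * α) = -2 + (2 - 2 * α) by ring, Real.rpow_add hR0]; ring
    have eB : 1 * (R ^ (2 - 2 * α) / (2 - 2 * α)) = K * R ^ (2 - 2 * α) := by
      rw [hK]; ring
    rw [eA, eB, Real.mul_rpow hK0.le (by positivity), Real.mul_rpow hK0.le (by positivity),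
      ← Real.rpow_mul hR0.le, ← Real.rpow_mul hR0.le, mul_mul_mul_comm, ← Real.rpow_add hK0,
      ← Real.rpow_add hR0]
    rw [show 1 / (1 + α) + α / (1 + α) = 1 by field_simp, Real.rpow_one]
    congr 2
    field_simp
    ring
  have hlim : Filter.Tendsto (fun R : ℝ => K * R ^ (-(2 * α ^ 2 / (1 + α)))) Filter.atTop
      (nhds (K * 0)) :=
    (tendsto_rpow_neg_atTop (by positivity)).const_mul K
  have := ge_of_tendsto hlim (Filter.eventually_atTop.2 ⟨2, key⟩)
  have h2 : 0 < S * c ^ (α / (1 + α)) := by positivity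
  linarith
end
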